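/- Let g(n) be defined by ∑_{n≥0} g(n) q^n = 1/((q;q^4)_∞ (-q^3;q^4)_∞). Then as n → ∞, g(n) ~ (π^{1/4} Γ(1/4))/(2^{9/4} 3^{3/8} n^{3/8}) · I_{-3/4}((π/2)√(n/3)) + (-1)^n (π^{3/4} Γ(3/4))/(2^{11/4} 3^{5/8} n^{5/8}) · I_{-5/4}((π/2)√(n/3)), where I_s is the modified Bessel function of the first kind. -/

import Mathlib

open Real Filter

/-- The modified Bessel function of the first kind `I_s(x)`, for real order `s` and
`x > 0`, defined by its power series `∑_{m≥0} (x/2)^(2m+s) / (m! Γ(m+s+1))`. -/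
noncomputable def besselI (s x : ℝ) : ℝ :=
  ∑' m : ℕ, (x / 2) ^ ((2 * m : ℝ) + s) / (m.factorial * Real.Gamma (m + s + 1))

namespace S18

lemma norm_sinh_ge (w : ℂ) : Real.sinh w.re ≤ ‖Complex.sinh w‖ := by
  have h1 : ‖Complex.exp w‖ - ‖Complex.exp (-w)‖ ≤ ‖Complex.exp w - Complex.exp (-w)‖ :=
    norm_sub_norm_le _ _
  rw [Complex.norm_exp, Complex.norm_exp, Complex.neg_re] at h1
  rw [Complex.sinh, norm_div, Real.sinh_eq]
  simp only [Complex.norm_ofNat]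
  linarith

lemma norm_cosh_ge (w : ℂ) : Real.sinh w.re ≤ ‖Complex.cosh w‖ := by
  have h1 : ‖Complex.exp w‖ - ‖-Complex.exp (-w)‖ ≤ ‖Complex.exp w - -Complex.exp (-w)‖ :=
    norm_sub_norm_le _ _
  rw [norm_neg, Complex.norm_exp, Complex.norm_exp, Complex.neg_re, sub_neg_eq_add] at h1
  rw [Complex.cosh, norm_div, Real.sinh_eq]
  simp only [Complex.norm_ofNat]
  linarith

lemma norm_cosh_le (w : ℂ) : ‖Complex.cosh w‖ ≤ Real.cosh w.re := by
  have h1 := norm_add_le (Complex.exp w) (Complex.exp (-w))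
  rw [Complex.norm_exp, Complex.norm_exp, Complex.neg_re] at h1
  rw [Complex.cosh, norm_div, Real.cosh_eq]
  simp only [Complex.norm_ofNat]
  linarith

lemma norm_sinh_le (w : ℂ) : ‖Complex.sinh w‖ ≤ Real.cosh w.re := by
  have h1 := norm_sub_le (Complex.exp w) (Complex.exp (-w))
  rw [Complex.norm_exp, Complex.norm_exp, Complex.neg_re] at h1
  rw [Complex.sinh, norm_div, Real.cosh_eq]
  simp only [Complex.norm_ofNat]
  linarith

lemma sinh_ne (w : ℂ) (h : 0 < w.re) : Complex.sinh w ≠ 0 := by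
  have := norm_sinh_ge w
  have h2 := Real.sinh_pos_iff.2 h
  exact norm_pos_iff.1 (by linarith)

lemma cosh_ne (w : ℂ) (h : 0 < w.re) : Complex.cosh w ≠ 0 := by
  have := norm_cosh_ge w
  have h2 := Real.sinh_pos_iff.2 h
  exact norm_pos_iff.1 (by linarith)

lemma le_sinh {x : ℝ} (h : 0 ≤ x) : x ≤ Real.sinh x := Real.self_le_sinh_iff.2 h

/-- 1/sinh w - 1/w -/
noncomputable def sF (w : ℂ) : ℂ := 1 / Complex.sinh w - 1 / w

noncomputable def sechF (w : ℂ) : ℂ := 1 / Complex.cosh w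

lemma sinh_big {x : ℝ} (hx : 1 ≤ x) :
    (1 + x) ^ 2 / 6 ≤ Real.sinh x ∧ Real.cosh x ≤ 2 * Real.sinh x := by
  have h1 := Real.quadratic_le_exp_of_nonneg (by linarith : 0 ≤ x)
  have h2 : 3 ≤ Real.exp (2 * x) := by
    have := Real.add_one_le_exp (2 * x); linarith
  have h3 : 3 * Real.exp (-x) ≤ Real.exp x := by
    have : Real.exp x = Real.exp (2 * x) * Real.exp (-x) := by
      rw [← Real.exp_add]; congr 1; ring
    rw [this]
    exact mul_le_mul_of_nonneg_right h2 (Real.exp_pos _).le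
  rw [Real.sinh_eq, Real.cosh_eq]
  constructor <;> nlinarith

lemma csch_deriv_big {x : ℝ} (hx : 1 ≤ x) :
    Real.cosh x / Real.sinh x ^ 2 ≤ 12 / (1 + x) ^ 2 := by
  obtain ⟨h1, h2⟩ := sinh_big hx
  have hp : 0 < (1 + x) ^ 2 := by positivity
  have hs : 0 < Real.sinh x := by linarith
  rw [div_le_div_iff₀ (by positivity) hp]
  calc Real.cosh x * (1 + x) ^ 2 ≤ (2 * Real.sinh x) * (6 * Real.sinh x) := by
        apply mul_le_mul h2 (by linarith) hp.le (by linarith)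
    _ = 12 * Real.sinh x ^ 2 := by ring

lemma hasDerivAt_sF (w : ℂ) (h : 0 < w.re) :
    HasDerivAt sF (-Complex.cosh w / Complex.sinh w ^ 2 + 1 / w ^ 2) w := by
  have hw : w ≠ 0 := by rintro rfl; simp at h
  have h1 := (Complex.hasDerivAt_sinh w).inv (sinh_ne w h)
  have h2 := (hasDerivAt_id w).inv hw
  have h3 := h1.sub h2
  have e : sF = (Complex.sinh⁻¹ - id⁻¹) := by
    funext v; simp [sF]
  rw [e]
  refine h3.congr_deriv ?_
  simp only [id]
  rw [neg_div, neg_div, sub_neg_eq_add]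

lemma hasDerivAt_sechF (w : ℂ) (h : 0 < w.re) :
    HasDerivAt sechF (-Complex.sinh w / Complex.cosh w ^ 2) w := by
  have h1 := (Complex.hasDerivAt_cosh w).inv (cosh_ne w h)
  have e : sechF = (Complex.cosh⁻¹) := by
    funext v; simp [sechF]
  rw [e]
  exact h1

lemma isCompact_sector (M : ℝ) :
    IsCompact {w : ℂ | 0 ≤ w.re ∧ w.re ≤ 1 ∧ |w.im| ≤ M * w.re} := by
  have hsub : {w : ℂ | 0 ≤ w.re ∧ w.re ≤ 1 ∧ |w.im| ≤ M * w.re} ⊆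
      Metric.closedBall 0 (1 + |M|) := by
    rintro w ⟨h0, h1, h2⟩
    rw [mem_closedBall_zero_iff]
    have a := Complex.norm_le_abs_re_add_abs_im w
    rw [abs_of_nonneg h0] at a
    have : M * w.re ≤ |M| * 1 := by
      apply mul_le_mul (le_abs_self _) h1 h0 (abs_nonneg _)
    linarith
  apply (isCompact_closedBall (0:ℂ) (1 + |M|)).of_isClosed_subset _ hsub
  have e : {w : ℂ | 0 ≤ w.re ∧ w.re ≤ 1 ∧ |w.im| ≤ M * w.re} =
    {w : ℂ | 0 ≤ w.re} ∩ ({w : ℂ | w.re ≤ 1} ∩ {w : ℂ | |w.im| ≤ M * w.re}) := rfl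
  rw [e]
  refine (isClosed_le (by fun_prop) (by fun_prop)).inter
    ((isClosed_le (by fun_prop) (by fun_prop)).inter (isClosed_le (by fun_prop) (by fun_prop)))

/-- sinh w / w -/
noncomputable def shc : ℂ → ℂ := dslope Complex.sinh 0
noncomputable def shT : ℂ → ℂ := dslope shc 0

lemma shc_diff : Differentiable ℂ shc := by
  rw [← differentiableOn_univ]
  exact (Complex.differentiableOn_dslope univ_mem).2 Complex.differentiable_sinh.differentiableOn

lemma shT_diff : Differentiable ℂ shT := by
  rw [← differentiableOn_univ]
  exact (Complex.differentiableOn_dslope univ_mem).2 shc_diff.differentiableOn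

lemma shc_zero : shc 0 = 1 := by
  simp [shc, dslope_same]

lemma shc_ne (w : ℂ) (hw : w ≠ 0) : shc w = Complex.sinh w / w := by
  rw [shc, dslope_of_ne _ hw, slope_def_field]; simp

lemma shT_ne (w : ℂ) (hw : w ≠ 0) : shT w = (shc w - 1) / w := by
  rw [shT, dslope_of_ne _ hw, slope_def_field, shc_zero]; simp

noncomputable def hF (w : ℂ) : ℂ := -shT w / shc w

lemma hF_eq (w : ℂ) (h : 0 < w.re) : sF w = hF w := by
  have hw : w ≠ 0 := by rintro rfl; simp at h
  have := sinh_ne w h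
  rw [hF, shT_ne w hw, shc_ne w hw, sF]
  field_simp
  ring

lemma sector_bound_aux (φ : ℂ → ℂ) (U : Set ℂ) (hU : IsOpen U) (hφ : DifferentiableOn ℂ φ U)
    (M : ℝ) (hK : {w : ℂ | 0 ≤ w.re ∧ w.re ≤ 1 ∧ |w.im| ≤ M * w.re} ⊆ U) :
    ∃ C, ∀ w : ℂ, 0 < w.re → w.re ≤ 1 → |w.im| ≤ M * w.re → ‖φ w‖ ≤ C ∧ ‖deriv φ w‖ ≤ C := by
  obtain ⟨C1, h1⟩ := (isCompact_sector M).exists_bound_of_continuousOn (hφ.continuousOn.mono hK)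
  obtain ⟨C2, h2⟩ := (isCompact_sector M).exists_bound_of_continuousOn
    ((hφ.deriv hU).continuousOn.mono hK)
  refine ⟨max C1 C2, fun w a b c => ⟨(h1 w ⟨a.le, b, c⟩).trans (le_max_left _ _),
    (h2 w ⟨a.le, b, c⟩).trans (le_max_right _ _)⟩⟩

lemma sF_bound (M : ℝ) : ∃ C, 0 < C ∧ ∀ w : ℂ, 0 < w.re → |w.im| ≤ M * w.re →
    ‖sF w‖ ≤ C / (1 + w.re) ∧ ‖deriv sF w‖ ≤ C / (1 + w.re) ^ 2 := by
  have hU : IsOpen {w : ℂ | shc w ≠ 0} := isOpen_ne_fun shc_diff.continuous continuous_const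
  obtain ⟨C, hC⟩ := sector_bound_aux hF {w | shc w ≠ 0} hU
    (fun w hw => ((shT_diff w).neg.div (shc_diff w) hw).differentiableWithinAt) M (by
      rintro w ⟨a, b, c⟩
      by_cases h0 : w = 0
      · simp [h0, shc_zero]
      · have hre : 0 < w.re := by
          rcases a.lt_or_eq with h | h
          · exact h
          · exfalso; apply h0
            rw [← h] at c
            simp at c
            exact Complex.ext h.symm c
        simp only [Set.mem_ofPred_eq]
        rw [shc_ne w h0]
        exact div_ne_zero (sinh_ne w hre) h0)
  refine ⟨4 * |C| + 20, by positivity, fun w h0 hw => ?_⟩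
  rcases le_total w.re 1 with h1 | h1
  · obtain ⟨b1, b2⟩ := hC w h0 h1 hw
    have e1 := hF_eq w h0
    have e2 : deriv sF w = deriv hF w := by
      apply Filter.EventuallyEq.deriv_eq
      have : {v : ℂ | 0 < v.re} ∈ nhds w :=
        (isOpen_lt continuous_const Complex.continuous_re).mem_nhds h0
      filter_upwards [this] with v hv
      exact hF_eq v hv
    rw [e1, e2]
    have hCC := le_abs_self C
    have hCp := abs_nonneg C
    constructor
    · rw [le_div_iff₀ (by linarith)]
      have : ‖hF w‖ * (1 + w.re) ≤ |C| * 2 :=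
        mul_le_mul (b1.trans hCC) (by linarith) (by linarith) (abs_nonneg _)
      linarith
    · rw [le_div_iff₀ (by positivity)]
      have : ‖deriv hF w‖ * (1 + w.re) ^ 2 ≤ |C| * 4 :=
        mul_le_mul (b2.trans hCC) (by nlinarith) (by positivity) (abs_nonneg _)
      linarith
  · have hCp := abs_nonneg C
    have hsb := sinh_big h1
    have hs : 0 < Real.sinh w.re := Real.sinh_pos_iff.2 h0
    have hwre : w.re ≤ ‖w‖ := (le_abs_self _).trans (Complex.abs_re_le_norm w)
    constructor
    · have : ‖sF w‖ ≤ 1 / Real.sinh w.re + 1 / w.re := by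
        refine (norm_sub_le _ _).trans (add_le_add ?_ ?_)
        · rw [norm_div, norm_one]
          exact one_div_le_one_div_of_le hs (norm_sinh_ge w)
        · rw [norm_div, norm_one]
          exact one_div_le_one_div_of_le h0 hwre
      have h3 : 1 / Real.sinh w.re ≤ 1 / w.re := one_div_le_one_div_of_le h0 (le_sinh h0.le)
      have h4 : 1 / w.re ≤ 2 / (1 + w.re) := by
        rw [div_le_div_iff₀ h0 (by linarith)]; linarith
      have h5 : 4 / (1 + w.re) ≤ (4 * |C| + 20) / (1 + w.re) :=
        div_le_div_of_nonneg_right (by linarith) (by linarith)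
      have h6 : 2 / (1 + w.re) + 2 / (1 + w.re) = 4 / (1 + w.re) := by ring
      linarith
    · rw [(hasDerivAt_sF w h0).deriv]
      have : ‖-Complex.cosh w / Complex.sinh w ^ 2 + 1 / w ^ 2‖ ≤
          Real.cosh w.re / Real.sinh w.re ^ 2 + 1 / w.re ^ 2 := by
        refine (norm_add_le _ _).trans (add_le_add ?_ ?_)
        · rw [norm_div, norm_neg, norm_pow]
          exact div_le_div₀ (Real.cosh_pos _).le (norm_cosh_le w) (by positivity)
            (pow_le_pow_left₀ hs.le (norm_sinh_ge w) 2)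
        · rw [norm_div, norm_one, norm_pow]
          exact one_div_le_one_div_of_le (by positivity) (pow_le_pow_left₀ h0.le hwre 2)
      have h3 := csch_deriv_big h1
      have h4 : 1 / w.re ^ 2 ≤ 4 / (1 + w.re) ^ 2 := by
        rw [div_le_div_iff₀ (by positivity) (by positivity)]; nlinarith
      have h5 : 16 / (1 + w.re) ^ 2 ≤ (4 * |C| + 20) / (1 + w.re) ^ 2 :=
        div_le_div_of_nonneg_right (by linarith) (by positivity)
      have h6 : 12 / (1 + w.re) ^ 2 + 4 / (1 + w.re) ^ 2 = 16 / (1 + w.re) ^ 2 := by ring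
      linarith

lemma sechF_bound (M : ℝ) : ∃ C, 0 < C ∧ ∀ w : ℂ, 0 < w.re → |w.im| ≤ M * w.re →
    ‖deriv sechF w‖ ≤ C / (1 + w.re) ^ 2 := by
  have hU : IsOpen {w : ℂ | Complex.cosh w ≠ 0} :=
    isOpen_ne_fun Complex.continuous_cosh continuous_const
  obtain ⟨C, hC⟩ := sector_bound_aux sechF {w | Complex.cosh w ≠ 0} hU
    (fun w hw => ((differentiableAt_const _).div
      (Complex.differentiable_cosh w) hw).differentiableWithinAt) M (by
      rintro w ⟨a, b, c⟩
      by_cases h0 : w = 0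
      · simp [h0]
      · have hre : 0 < w.re := by
          rcases a.lt_or_eq with h | h
          · exact h
          · exfalso; apply h0
            rw [← h] at c
            simp at c
            exact Complex.ext h.symm c
        exact cosh_ne w hre)
  refine ⟨4 * |C| + 20, by positivity, fun w h0 hw => ?_⟩
  have hCC := le_abs_self C
  have hCp := abs_nonneg C
  rcases le_total w.re 1 with h1 | h1
  · obtain ⟨b1, b2⟩ := hC w h0 h1 hw
    rw [le_div_iff₀ (by positivity)]
    have : ‖deriv sechF w‖ * (1 + w.re) ^ 2 ≤ |C| * 4 :=
      mul_le_mul (b2.trans hCC) (by nlinarith) (by positivity) (abs_nonneg _)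
    linarith
  · have hs : 0 < Real.sinh w.re := Real.sinh_pos_iff.2 h0
    rw [(hasDerivAt_sechF w h0).deriv]
    have : ‖-Complex.sinh w / Complex.cosh w ^ 2‖ ≤ Real.cosh w.re / Real.sinh w.re ^ 2 := by
      rw [norm_div, norm_neg, norm_pow]
      exact div_le_div₀ (Real.cosh_pos _).le (norm_sinh_le w) (by positivity)
        (pow_le_pow_left₀ hs.le (norm_cosh_ge w) 2)
    have h3 := csch_deriv_big h1
    have h5 : 12 / (1 + w.re) ^ 2 ≤ (4 * |C| + 20) / (1 + w.re) ^ 2 :=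
      div_le_div_of_nonneg_right (by linarith) (by positivity)
    linarith

end S18

namespace S18

lemma hs_congr {M : Type*} [AddCommMonoid M] [TopologicalSpace M] {f g : ℕ → M} {a b : M}
    (h : HasSum f a) (hfg : ∀ k, g k = f k) (hab : b = a) : HasSum g b := by
  rw [hab, funext hfg]; exact h

noncomputable def EvT (z : ℂ) (k : ℕ) : ℂ := 1 / (4 * ((k : ℂ) + 1) * Complex.sinh (2 * ((k : ℂ) + 1) * z))
noncomputable def OdT (z : ℂ) (k : ℕ) : ℂ := 1 / (2 * (2 * (k : ℂ) + 1) * Complex.cosh ((2 * (k : ℂ) + 1) * z))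
noncomputable def Ev (z : ℂ) : ℂ := ∑' k : ℕ, EvT z k
noncomputable def Od (z : ℂ) : ℂ := ∑' k : ℕ, OdT z k

lemma EvT_norm {z : ℂ} (hz : 0 < z.re) (k : ℕ) :
    ‖EvT z k‖ ≤ 1 / (8 * ((k : ℝ) + 1) ^ 2 * z.re) := by
  rw [EvT, norm_div, norm_one, norm_mul, norm_mul]
  have e1 : ‖((k : ℂ) + 1)‖ = (k : ℝ) + 1 := by
    have : ((k : ℂ) + 1) = ((k + 1 : ℕ) : ℂ) := by push_cast; ring
    rw [this, Complex.norm_natCast]; push_cast; ring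
  have e2 : (2 * ((k : ℂ) + 1) * z).re = 2 * ((k : ℝ) + 1) * z.re := by
    simp
  have h1 := norm_sinh_ge (2 * ((k : ℂ) + 1) * z)
  rw [e2] at h1
  have h2 := le_sinh (x := 2 * ((k : ℝ) + 1) * z.re) (by positivity)
  rw [e1]
  simp only [Complex.norm_ofNat]
  apply one_div_le_one_div_of_le (by positivity)
  calc 8 * ((k : ℝ) + 1) ^ 2 * z.re = 4 * ((k : ℝ) + 1) * (2 * ((k : ℝ) + 1) * z.re) := by ring
    _ ≤ _ := by gcongr; linarith

lemma OdT_norm {z : ℂ} (hz : 0 < z.re) (k : ℕ) :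
    ‖OdT z k‖ ≤ 1 / (2 * (2 * (k : ℝ) + 1) ^ 2 * z.re) := by
  rw [OdT, norm_div, norm_one, norm_mul, norm_mul]
  have e1 : ‖(2 * (k : ℂ) + 1)‖ = 2 * (k : ℝ) + 1 := by
    have : (2 * (k : ℂ) + 1) = ((2 * k + 1 : ℕ) : ℂ) := by push_cast; ring
    rw [this, Complex.norm_natCast]; push_cast; ring
  have e2 : ((2 * (k : ℂ) + 1) * z).re = (2 * (k : ℝ) + 1) * z.re := by
    simp
  have h1 := norm_cosh_ge ((2 * (k : ℂ) + 1) * z)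
  rw [e2] at h1
  have h2 := le_sinh (x := (2 * (k : ℝ) + 1) * z.re) (by positivity)
  rw [e1]
  simp only [Complex.norm_ofNat]
  apply one_div_le_one_div_of_le (by positivity)
  calc 2 * (2 * (k : ℝ) + 1) ^ 2 * z.re = 2 * (2 * (k : ℝ) + 1) * ((2 * (k : ℝ) + 1) * z.re) := by ring
    _ ≤ _ := by gcongr; linarith

lemma hasSum_sq : HasSum (fun k : ℕ => 1 / ((k : ℝ) + 1) ^ 2) (π ^ 2 / 6) := by
  have h := hasSum_zeta_two
  have := (hasSum_nat_add_iff' 1).2 h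
  simpa using this

lemma hasSum_oddsq : HasSum (fun k : ℕ => 1 / (2 * (k : ℝ) + 1) ^ 2) (π ^ 2 / 8) := by
  have h := hasSum_sq
  have h1 : HasSum (fun k : ℕ => 1 / (((2 * k + 1 : ℕ) : ℝ) + 1) ^ 2) (π ^ 2 / 24) := by
    have := h.mul_left (1 / 4)
    refine hs_congr this (fun k => ?_) (by ring)
    push_cast
    have : (2 * (k : ℝ) + 1 + 1) = 2 * ((k : ℝ) + 1) := by ring
    rw [this, mul_pow, one_div, mul_inv]; norm_num
  have hs : Summable (fun k : ℕ => 1 / (((2 * k : ℕ) : ℝ) + 1) ^ 2) :=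
    h.summable.comp_injective (i := fun k => 2 * k) (fun a b hab => by simpa using hab)
  obtain ⟨a, ha⟩ := hs
  have h2 := HasSum.even_add_odd (f := fun k : ℕ => 1 / ((k : ℝ) + 1) ^ 2) ha h1
  have h3 := h2.unique h
  have : a = π ^ 2 / 8 := by linarith
  rw [this] at ha
  simpa using ha

lemma EvB_hasSum (x : ℝ) : HasSum (fun k : ℕ => 1 / (8 * ((k : ℝ) + 1) ^ 2 * x)) (π ^ 2 / 48 / x) := by
  have := hasSum_sq.mul_left (1 / (8 * x))
  refine hs_congr this (fun k => ?_) ?_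
  · rw [div_mul_div_comm]; congr 1 <;> ring
  · rw [div_mul_div_comm, div_div]; ring

lemma OdB_hasSum (x : ℝ) :
    HasSum (fun k : ℕ => 1 / (2 * (2 * (k : ℝ) + 1) ^ 2 * x)) (π ^ 2 / 16 / x) := by
  have := hasSum_oddsq.mul_left (1 / (2 * x))
  refine hs_congr this (fun k => ?_) ?_
  · rw [div_mul_div_comm]; congr 1 <;> ring
  · rw [div_mul_div_comm, div_div]; ring

lemma EvT_summable {z : ℂ} (hz : 0 < z.re) : Summable (EvT z) :=
  Summable.of_norm_bounded (EvB_hasSum z.re).summable (EvT_norm hz)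

lemma OdT_summable {z : ℂ} (hz : 0 < z.re) : Summable (OdT z) :=
  Summable.of_norm_bounded (OdB_hasSum z.re).summable (OdT_norm hz)

/-! The double sum. -/

noncomputable def lamT (a X : ℂ) (m : ℕ) : ℂ := a ^ (m + 1) / (((m : ℂ) + 1) * (1 - X ^ (m + 1)))

lemma lam_aux {a X : ℂ} (ha : ‖a‖ < 1) (hX : ‖X‖ < 1) :
    Summable (lamT a X) ∧ Summable (fun k : ℕ => Complex.log (1 - a * X ^ k)) ∧
    ∑' m, lamT a X m = ∑' k : ℕ, -Complex.log (1 - a * X ^ k) := by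
  set f : ℕ → ℕ → ℂ := fun k m => (a * X ^ k) ^ (m + 1) / ((m : ℂ) + 1) with hf
  have e1 : ∀ m : ℕ, ‖((m : ℂ) + 1)‖ = (m : ℝ) + 1 := by
    intro m
    have : ((m : ℂ) + 1) = ((m + 1 : ℕ) : ℂ) := by push_cast; ring
    rw [this, Complex.norm_natCast]; push_cast; ring
  have hs : Summable (Function.uncurry f) := by
    have hb : Summable (fun p : ℕ × ℕ => ‖X‖ ^ p.1 * ‖a‖ ^ p.2) :=
      (summable_geometric_of_lt_one (norm_nonneg _) hX).mul_of_nonneg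
        (summable_geometric_of_lt_one (norm_nonneg _) ha)
        (fun _ => by positivity) (fun _ => by positivity)
    refine Summable.of_norm_bounded hb ?_
    rintro ⟨k, m⟩
    simp only [Function.uncurry, hf]
    rw [norm_div, e1, norm_pow, norm_mul, norm_pow, mul_pow]
    have h1 : ‖a‖ ^ (m + 1) ≤ ‖a‖ ^ m := pow_le_pow_of_le_one (norm_nonneg _) ha.le (Nat.le_succ m)
    have h2 : (‖X‖ ^ k) ^ (m + 1) ≤ ‖X‖ ^ k := by
      have : (‖X‖ ^ k) ≤ 1 := pow_le_one₀ (norm_nonneg _) hX.le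
      calc (‖X‖ ^ k) ^ (m + 1) ≤ (‖X‖ ^ k) ^ 1 :=
            pow_le_pow_of_le_one (by positivity) this (by omega)
        _ = _ := pow_one _
    calc ‖a‖ ^ (m + 1) * (‖X‖ ^ k) ^ (m + 1) / ((m : ℝ) + 1)
        ≤ ‖a‖ ^ (m + 1) * (‖X‖ ^ k) ^ (m + 1) := by
          apply div_le_self (by positivity)
          have : (0 : ℝ) ≤ m := Nat.cast_nonneg m
          linarith
      _ ≤ ‖a‖ ^ m * ‖X‖ ^ k := by gcongr
      _ = _ := by ring
  have hk : ∀ k, HasSum (f k) (-Complex.log (1 - a * X ^ k)) := by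
    intro k
    have hn : ‖a * X ^ k‖ < 1 := by
      rw [norm_mul, norm_pow]
      have : (‖X‖ ^ k) ≤ 1 := pow_le_one₀ (norm_nonneg _) hX.le
      calc ‖a‖ * ‖X‖ ^ k ≤ ‖a‖ * 1 := by gcongr
        _ < 1 := by linarith
    have := (hasSum_nat_add_iff' 1).2 (Complex.hasSum_taylorSeries_neg_log hn)
    simpa [hf] using this
  have hm : ∀ m, HasSum (fun k => f k m) (lamT a X m) := by
    intro m
    have hn : ‖X ^ (m + 1)‖ < 1 := by
      rw [norm_pow]; exact pow_lt_one₀ (norm_nonneg _) hX (by omega)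
    have := (hasSum_geometric_of_norm_lt_one hn).mul_left (a ^ (m + 1) / ((m : ℂ) + 1))
    refine hs_congr this (fun k => ?_) ?_
    · simp only [hf]
      rw [mul_pow, ← pow_mul, ← pow_mul, mul_comm k (m + 1)]
      ring
    · simp only [lamT]
      rw [div_mul_eq_div_div]; ring
  have hs' : Summable (Function.uncurry (fun m k => f k m)) :=
    (Equiv.prodComm ℕ ℕ).summable_iff.2 hs |>.congr (fun p => rfl)
  refine ⟨?_, ?_, ?_⟩
  · have := hs'.prod
    refine this.congr (fun m => ?_)
    exact ((hm m).tsum_eq).symm ▸ rfl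
  · have := hs.prod
    have h2 : Summable (fun k : ℕ => -Complex.log (1 - a * X ^ k)) := by
      refine this.congr (fun k => ?_)
      exact ((hk k).tsum_eq).symm ▸ rfl
    exact summable_neg_iff.1 h2
  · have := hs.tsum_comm
    rw [tsum_congr (fun m => (hm m).tsum_eq), tsum_congr (fun k => (hk k).tsum_eq)] at this
    exact this

lemma tprod_eq {a X : ℂ} (ha : ‖a‖ < 1) (hX : ‖X‖ < 1) :
    ∏' k : ℕ, (1 - a * X ^ k) = Complex.exp (-∑' m, lamT a X m) := by
  obtain ⟨h1, h2, h3⟩ := lam_aux ha hX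
  rw [← Complex.cexp_tsum_eq_tprod _ h2, h3, tsum_neg, neg_neg]
  intro k h
  have : a * X ^ k = 1 := by linear_combination -h
  have hn : ‖a * X ^ k‖ < 1 := by
      rw [norm_mul, norm_pow]
      have : (‖X‖ ^ k) ≤ 1 := pow_le_one₀ (norm_nonneg _) hX.le
      calc ‖a‖ * ‖X‖ ^ k ≤ ‖a‖ * 1 := by gcongr
        _ < 1 := by linarith
  rw [this] at hn
  simp at hn

lemma q_norm {z : ℂ} (hz : 0 < z.re) : ‖Complex.exp (-z)‖ < 1 := by
  rw [Complex.norm_exp]; simpa using hz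

lemma lam_even {z : ℂ} (hz : 0 < z.re) {e : ℂ} (he : e ^ 2 = 1) (k : ℕ) :
    lamT (e * Complex.exp (-z)) ((e * Complex.exp (-z)) ^ 4) (2 * k) +
      lamT (-(e * Complex.exp (-z)) ^ 3) ((e * Complex.exp (-z)) ^ 4) (2 * k) = e * OdT z k := by
  set w := (2 * (k : ℂ) + 1) * z with hw
  have hwre : 0 < w.re := by
    rw [hw]; simp; positivity
  have hq : Complex.exp (-z) ^ (2 * k + 1) = Complex.exp (-w) := by
    rw [← Complex.exp_nat_mul, hw]; congr 1; push_cast; ring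
  have h4 : e ^ 4 = 1 := by linear_combination (e ^ 2 + 1) * he
  have hek : e ^ (2 * k + 1) = e := by rw [pow_succ, pow_mul, he]; simp
  have hodd : (-1 : ℂ) ^ (2 * k + 1) = -1 := by rw [pow_succ, pow_mul]; simp
  have hc : Complex.cosh w = (Complex.exp w + Complex.exp (-w)) / 2 := rfl
  have hcn := cosh_ne w hwre
  rw [hc] at hcn
  have hE : Complex.exp w = (Complex.exp (-w))⁻¹ := by rw [Complex.exp_neg, inv_inv]
  have hxn : ‖Complex.exp (-w)‖ < 1 := q_norm hwre
  have hx0 := Complex.exp_ne_zero (-w)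
  simp only [lamT, OdT]
  rw [← hw, hc, hE]
  rw [hE] at hcn
  rw [neg_pow ((e * Complex.exp (-z)) ^ 3), hodd, ← pow_mul, ← pow_mul, mul_comm 3, mul_comm 4, pow_mul, pow_mul _ _ 3, mul_pow e,
    hq, hek]
  set x := Complex.exp (-w)
  have hm : (2 * (k : ℂ) + 1) ≠ 0 := by
    have : (2 * (k : ℂ) + 1) = ((2 * k + 1 : ℕ) : ℂ) := by push_cast; ring
    rw [this]; exact Nat.cast_ne_zero.2 (by omega)
  have hx4 : (1 - x ^ 4) ≠ 0 := by
    intro h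
    have h1 : x ^ 4 = 1 := by linear_combination -h
    have h2 : ‖x‖ ^ 4 < 1 := pow_lt_one₀ (norm_nonneg _) hxn (by norm_num)
    rw [← norm_pow, h1] at h2; simp at h2
  have hx2 : (1 + x ^ 2) ≠ 0 := fun h => hx4 (by linear_combination (1 - x ^ 2) * h)
  have hcx : x⁻¹ + x ≠ 0 := fun h => hcn (by rw [h]; simp)
  have e3 : (e * x) ^ 3 = e * x ^ 3 := by linear_combination e * x ^ 3 * he
  have e4 : (e * x) ^ 4 = x ^ 4 := by linear_combination x ^ 4 * h4
  rw [e3, e4]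
  have : x⁻¹ + x = (1 + x ^ 2) / x := by field_simp
  rw [this]
  push_cast
  have f1 : (1 - x ^ 4) = (1 - x ^ 2) * (1 + x ^ 2) := by ring
  have hx2' : 1 - x ^ 2 ≠ 0 := fun h => hx4 (by rw [f1, h]; simp)
  rw [f1]
  field_simp
  ring

lemma lam_odd {z : ℂ} (hz : 0 < z.re) {e : ℂ} (he : e ^ 2 = 1) (k : ℕ) :
    lamT (e * Complex.exp (-z)) ((e * Complex.exp (-z)) ^ 4) (2 * k + 1) +
      lamT (-(e * Complex.exp (-z)) ^ 3) ((e * Complex.exp (-z)) ^ 4) (2 * k + 1) = EvT z k := by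
  set w := (2 * ((k : ℂ) + 1)) * z with hw
  have hwre : 0 < w.re := by
    rw [hw]; simp; positivity
  have hq : Complex.exp (-z) ^ (2 * k + 1 + 1) = Complex.exp (-w) := by
    rw [← Complex.exp_nat_mul, hw]; congr 1; push_cast; ring
  have hek : e ^ (2 * k + 1 + 1) = 1 := by
    rw [show 2 * k + 1 + 1 = 2 * (k + 1) by ring, pow_mul, he]; simp
  have hodd : (-1 : ℂ) ^ (2 * k + 1 + 1) = 1 := by
    rw [show 2 * k + 1 + 1 = 2 * (k + 1) by ring, pow_mul]; simp
  have hc : Complex.sinh w = (Complex.exp w - Complex.exp (-w)) / 2 := rfl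
  have hcn := sinh_ne w hwre
  rw [hc] at hcn
  have hE : Complex.exp w = (Complex.exp (-w))⁻¹ := by rw [Complex.exp_neg, inv_inv]
  have hxn : ‖Complex.exp (-w)‖ < 1 := q_norm hwre
  have hx0 := Complex.exp_ne_zero (-w)
  simp only [lamT, EvT]
  rw [← hw, hc, hE]
  rw [hE] at hcn
  rw [neg_pow ((e * Complex.exp (-z)) ^ 3), hodd, ← pow_mul, ← pow_mul, mul_comm 3, mul_comm 4, pow_mul, pow_mul _ _ 3, mul_pow e,
    hq, hek]
  set x := Complex.exp (-w)
  have hm : ((k : ℂ) + 1) ≠ 0 := by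
    have : ((k : ℂ) + 1) = ((k + 1 : ℕ) : ℂ) := by push_cast; ring
    rw [this]; exact Nat.cast_ne_zero.2 (by omega)
  have hx4 : (1 - x ^ 4) ≠ 0 := by
    intro h
    have h1 : x ^ 4 = 1 := by linear_combination -h
    have h2 : ‖x‖ ^ 4 < 1 := pow_lt_one₀ (norm_nonneg _) hxn (by norm_num)
    rw [← norm_pow, h1] at h2; simp at h2
  have : x⁻¹ - x = (1 - x ^ 2) / x := by field_simp
  rw [this]
  push_cast
  have f1 : (1 - x ^ 4) = (1 - x ^ 2) * (1 + x ^ 2) := by ring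
  have hx2' : 1 - x ^ 2 ≠ 0 := fun h => hx4 (by rw [f1, h]; simp)
  have hx2 : (1 + x ^ 2) ≠ 0 := fun h => hx4 (by linear_combination (1 - x ^ 2) * h)
  have hm2 : (2 * (k : ℂ) + 1 + 1) = 2 * ((k : ℂ) + 1) := by ring
  rw [one_mul, one_mul, f1, hm2]
  field_simp
  ring

lemma lam_sum {z : ℂ} (hz : 0 < z.re) {e : ℂ} (he : e ^ 2 = 1) :
    ∑' m, lamT (e * Complex.exp (-z)) ((e * Complex.exp (-z)) ^ 4) m +
      ∑' m, lamT (-(e * Complex.exp (-z)) ^ 3) ((e * Complex.exp (-z)) ^ 4) m = Ev z + e * Od z := by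
  have hn : ‖e‖ = 1 := by
    have : ‖e‖ ^ 2 = 1 := by rw [← norm_pow, he]; simp
    nlinarith [norm_nonneg e]
  have hq : ‖e * Complex.exp (-z)‖ < 1 := by
    rw [norm_mul, hn, one_mul]; exact q_norm hz
  have h4 : ‖(e * Complex.exp (-z)) ^ 4‖ < 1 := by
    rw [norm_pow]; exact pow_lt_one₀ (norm_nonneg _) hq (by norm_num)
  have h3 : ‖-(e * Complex.exp (-z)) ^ 3‖ < 1 := by
    rw [norm_neg, norm_pow]; exact pow_lt_one₀ (norm_nonneg _) hq (by norm_num)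
  obtain ⟨a1, -, -⟩ := lam_aux hq h4
  obtain ⟨b1, -, -⟩ := lam_aux h3 h4
  rw [← a1.tsum_add b1]
  have hs1 : HasSum (fun k => e * OdT z k) (e * Od z) := (OdT_summable hz).hasSum.mul_left e
  have hs2 : HasSum (EvT z) (Ev z) := (EvT_summable hz).hasSum
  simp_rw [← lam_even hz he] at hs1
  have hs2' : HasSum (fun k => lamT (e * Complex.exp (-z)) ((e * Complex.exp (-z)) ^ 4) (2 * k + 1) +
      lamT (-(e * Complex.exp (-z)) ^ 3) ((e * Complex.exp (-z)) ^ 4) (2 * k + 1)) (Ev z) := by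
    simp_rw [lam_odd hz he]; exact hs2
  rw [(HasSum.even_add_odd (f := fun m => lamT (e * Complex.exp (-z)) ((e * Complex.exp (-z)) ^ 4) m +
      lamT (-(e * Complex.exp (-z)) ^ 3) ((e * Complex.exp (-z)) ^ 4) m) hs1 hs2').tsum_eq, add_comm]

lemma G_eq {z : ℂ} (hz : 0 < z.re) {e : ℂ} (he : e ^ 2 = 1) :
    1 / ((∏' k : ℕ, (1 - (e * Complex.exp (-z)) * ((e * Complex.exp (-z)) ^ 4) ^ k)) *
              (∏' k : ℕ, (1 - (-(e * Complex.exp (-z)) ^ 3) * ((e * Complex.exp (-z)) ^ 4) ^ k))) =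
      Complex.exp (Ev z + e * Od z) := by
  have hn : ‖e‖ = 1 := by
    have : ‖e‖ ^ 2 = 1 := by rw [← norm_pow, he]; simp
    nlinarith [norm_nonneg e]
  have hq : ‖e * Complex.exp (-z)‖ < 1 := by
    rw [norm_mul, hn, one_mul]; exact q_norm hz
  have h4 : ‖(e * Complex.exp (-z)) ^ 4‖ < 1 := by
    rw [norm_pow]; exact pow_lt_one₀ (norm_nonneg _) hq (by norm_num)
  have h3 : ‖-(e * Complex.exp (-z)) ^ 3‖ < 1 := by
    rw [norm_neg, norm_pow]; exact pow_lt_one₀ (norm_nonneg _) hq (by norm_num)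
  rw [tprod_eq hq h4, tprod_eq h3 h4, ← Complex.exp_add, one_div, ← Complex.exp_neg, ← lam_sum hz he]
  congr 1
  ring

end S18

namespace S18

lemma tele {t : ℝ} (ht : 0 < t) : Summable (fun k : ℕ => 1 / (1 + ((k : ℝ) + 1) * t) ^ 2) ∧
    ∑' k : ℕ, 1 / (1 + ((k : ℝ) + 1) * t) ^ 2 ≤ 1 / t := by
  have hp : ∀ n, ∑ k ∈ Finset.range n, 1 / (1 + ((k : ℝ) + 1) * t) ^ 2 ≤ 1 / t - 1 / (t * (1 + n * t)) := by
    intro n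
    induction n with
    | zero => simp
    | succ n ih =>
      rw [Finset.sum_range_succ]
      have hn : (0 : ℝ) ≤ n := Nat.cast_nonneg n
      have : 1 / (1 + ((n : ℝ) + 1) * t) ^ 2 ≤ 1 / (t * (1 + n * t)) - 1 / (t * (1 + ((n : ℝ) + 1) * t)) := by
        have e : 1 / (t * (1 + n * t)) - 1 / (t * (1 + ((n : ℝ) + 1) * t)) =
          1 / ((1 + n * t) * (1 + ((n : ℝ) + 1) * t)) := by
          field_simp
          ring
        rw [e]
        apply one_div_le_one_div_of_le (by positivity)
        rw [sq]
        gcongr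
        linarith
      push_cast
      linarith
  have hp' : ∀ n, ∑ k ∈ Finset.range n, 1 / (1 + ((k : ℝ) + 1) * t) ^ 2 ≤ 1 / t := by
    intro n
    have : 0 ≤ 1 / (t * (1 + n * t)) := by positivity
    linarith [hp n]
  exact ⟨summable_of_sum_range_le (fun _ => by positivity) hp',
    Real.tsum_le_of_sum_range_le (fun _ => by positivity) hp'⟩

lemma lip_aux (φ : ℂ → ℂ) (M C : ℝ) (hd : ∀ w : ℂ, 0 < w.re → DifferentiableAt ℂ φ w)
    (hb : ∀ w : ℂ, 0 < w.re → |w.im| ≤ M * w.re → ‖deriv φ w‖ ≤ C / (1 + w.re) ^ 2)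
    (c t θ : ℝ) (hc : 0 < c) (ht : 0 < t) (hθ : |θ| ≤ M * t) :
    ‖φ (c * (t + θ * Complex.I)) - φ (c * t)‖ ≤ C / (1 + c * t) ^ 2 * (c * |θ|) := by
  have hM : 0 ≤ M * t := (abs_nonneg _).trans hθ
  set s : Set ℂ := {w | w.re = c * t} ∩ ({w | w.im ≤ c * (M * t)} ∩ {w | -(c * (M * t)) ≤ w.im}) with hs
  have hconv : Convex ℝ s := by
    refine (convex_hyperplane (f := Complex.re) ?_ _).inter
      ((convex_halfSpace_le (f := Complex.im) ?_ _).inter (convex_halfSpace_ge (f := Complex.im) ?_ _))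
    · exact Complex.reLm.isLinear
    · exact Complex.imLm.isLinear
    · exact Complex.imLm.isLinear
  have hsp : ∀ w ∈ s, 0 < w.re ∧ |w.im| ≤ M * w.re ∧ w.re = c * t := by
    rintro w ⟨h1, h2, h3⟩
    simp only [Set.mem_ofPred_eq] at h1 h2 h3
    refine ⟨by rw [h1]; positivity, ?_, h1⟩
    rw [h1, abs_le]; constructor <;> nlinarith
  have hx : ((c : ℂ) * t) ∈ s := by
    have : 0 ≤ c * (M * t) := by positivity
    simp [hs]; linarith
  have hy : ((c : ℂ) * (t + θ * Complex.I)) ∈ s := by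
    rw [abs_le] at hθ
    simp [hs]
    constructor
    · nlinarith
    · nlinarith
  have := Convex.norm_image_sub_le_of_norm_deriv_le (f := φ) (C := C / (1 + c * t) ^ 2)
    (fun w hw => hd w (hsp w hw).1) (fun w hw => by
      have h := hsp w hw
      have := hb w h.1 h.2.1
      rwa [h.2.2] at this) hconv hx hy
  refine this.trans (le_of_eq ?_)
  congr 1
  have : (c : ℂ) * (t + θ * Complex.I) - c * t = ((c * θ : ℝ) : ℂ) * Complex.I := by
    push_cast; ring
  rw [this, norm_mul, Complex.norm_I, mul_one, Complex.norm_real, Real.norm_eq_abs, abs_mul, abs_of_pos hc]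

lemma Acx_hasSum (z : ℂ) :
    HasSum (fun k : ℕ => 1 / (8 * ((k : ℂ) + 1) ^ 2 * z)) ((π ^ 2 / 48 : ℝ) / z) := by
  have := (Complex.hasSum_ofReal.2 hasSum_sq).mul_left (1 / (8 * z))
  refine hs_congr this (fun k => ?_) ?_
  · push_cast; rw [div_mul_div_comm]; congr 1 <;> ring
  · push_cast; rw [div_mul_div_comm, div_div]; ring

lemma EvT_eq {z : ℂ} (hz : 0 < z.re) (k : ℕ) :
    EvT z k = 1 / (8 * ((k : ℂ) + 1) ^ 2 * z) + 1 / (4 * ((k : ℂ) + 1)) * sF (2 * ((k : ℂ) + 1) * z) := by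
  have hz0 : z ≠ 0 := by rintro rfl; simp at hz
  have hk : ((k : ℂ) + 1) ≠ 0 := by exact_mod_cast Nat.succ_ne_zero k
  have hs : Complex.sinh (2 * ((k : ℂ) + 1) * z) ≠ 0 := by
    apply sinh_ne; simp; positivity
  rw [EvT, sF]
  generalize Complex.sinh (2 * ((k : ℂ) + 1) * z) = s at *
  field_simp
  ring

lemma OdT_eq (z : ℂ) (k : ℕ) :
    OdT z k = 1 / (2 * (2 * (k : ℂ) + 1)) * sechF ((2 * (k : ℂ) + 1) * z) := by
  rw [OdT, sechF, div_mul_div_comm, one_mul]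

lemma Ev_eq {z : ℂ} (hz : 0 < z.re) :
    HasSum (fun k : ℕ => 1 / (4 * ((k : ℂ) + 1)) * sF (2 * ((k : ℂ) + 1) * z))
      (Ev z - (π ^ 2 / 48 : ℝ) / z) := by
  have := (EvT_summable hz).hasSum.sub (Acx_hasSum z)
  refine hs_congr this (fun k => ?_) rfl
  rw [EvT_eq hz]; ring

lemma norm_k1 (k : ℕ) : ‖((k : ℂ) + 1)‖ = (k : ℝ) + 1 := by
  have : ((k : ℂ) + 1) = ((k + 1 : ℕ) : ℂ) := by push_cast; ring
  rw [this, Complex.norm_natCast]; push_cast; ring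

lemma norm_2k1 (k : ℕ) : ‖(2 * (k : ℂ) + 1)‖ = 2 * (k : ℝ) + 1 := by
  have : (2 * (k : ℂ) + 1) = ((2 * k + 1 : ℕ) : ℂ) := by push_cast; ring
  rw [this, Complex.norm_natCast]; push_cast; ring

lemma lip_main (M : ℝ) : ∃ C, 0 < C ∧ ∀ t θ : ℝ, 0 < t → |θ| ≤ M * t →
    ‖(Ev (t + θ * Complex.I) - (π ^ 2 / 48 : ℝ) / (t + θ * Complex.I)) -
      (Ev t - (π ^ 2 / 48 : ℝ) / t)‖ ≤ C * (|θ| / t) ∧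
    ‖Od (t + θ * Complex.I) - Od t‖ ≤ C * (|θ| / t) := by
  obtain ⟨C1, hC1, h1⟩ := sF_bound M
  obtain ⟨C2, hC2, h2⟩ := sechF_bound M
  refine ⟨C1 + C2, by positivity, fun t θ ht hθ => ?_⟩
  have hre : 0 < ((t : ℂ) + θ * Complex.I).re := by simpa using ht
  have hre' : 0 < (t : ℂ).re := by simpa using ht
  obtain ⟨ts, tb⟩ := tele ht
  have hq : 0 ≤ |θ| / t := by positivity
  have fin : ∀ C : ℝ, 0 < C → ∑' k : ℕ, C * |θ| * (1 / (1 + ((k : ℝ) + 1) * t) ^ 2) ≤ C * (|θ| / t) := by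
    intro C hC
    rw [tsum_mul_left]
    calc C * |θ| * _ ≤ C * |θ| * (1 / t) := by gcongr
      _ = _ := by ring
  constructor
  · have hs := (Ev_eq hre).sub (Ev_eq hre')
    rw [← hs.tsum_eq]
    refine (tsum_of_norm_bounded (ts.mul_left (C1 * |θ|)).hasSum (fun k => ?_)).trans ?_
    · rw [← mul_sub, norm_mul, norm_div, norm_one, norm_mul, norm_k1]
      have := lip_aux sF M C1 (fun w hw => (hasDerivAt_sF w hw).differentiableAt)
        (fun w hw hw' => (h1 w hw hw').2) (2 * (k + 1)) t θ (by positivity) ht hθ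
      push_cast at this
      simp only [Complex.norm_ofNat]
      calc _ ≤ 1 / (4 * ((k : ℝ) + 1)) * (C1 / (1 + 2 * (k + 1) * t) ^ 2 * (2 * (k + 1) * |θ|)) := by
            gcongr
        _ = (C1 * |θ|) * (1 / 2 * (1 / (1 + 2 * ((k:ℝ) + 1) * t) ^ 2)) := by
            field_simp
            norm_num
        _ ≤ (C1 * |θ|) * (1 * (1 / (1 + ((k : ℝ) + 1) * t) ^ 2)) := by
            gcongr
            · norm_num
            · nlinarith
        _ = _ := by ring
    · refine (fin C1 hC1).trans ?_
      gcongr; linarith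
  · have hs := ((OdT_summable hre).hasSum).sub ((OdT_summable hre').hasSum)
    change ‖(∑' k, OdT _ k) - ∑' k, OdT _ k‖ ≤ _
    rw [← hs.tsum_eq]
    refine (tsum_of_norm_bounded (ts.mul_left (C2 * |θ|)).hasSum (fun k => ?_)).trans ?_
    · rw [OdT_eq, OdT_eq, ← mul_sub, norm_mul, norm_div, norm_one, norm_mul, norm_2k1]
      have := lip_aux sechF M C2 (fun w hw => (hasDerivAt_sechF w hw).differentiableAt)
        (fun w hw hw' => (h2 w hw hw')) (2 * k + 1) t θ (by positivity) ht hθ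
      push_cast at this
      simp only [Complex.norm_ofNat]
      calc _ ≤ 1 / (2 * (2 * (k : ℝ) + 1)) * (C2 / (1 + (2 * k + 1) * t) ^ 2 * ((2 * k + 1) * |θ|)) := by
            gcongr
        _ = (C2 * |θ|) * (1 / 2 * (1 / (1 + (2 * (k:ℝ) + 1) * t) ^ 2)) := by
            field_simp
        _ ≤ (C2 * |θ|) * (1 * (1 / (1 + ((k : ℝ) + 1) * t) ^ 2)) := by
            have : (0:ℝ) ≤ k := Nat.cast_nonneg k
            gcongr
            · norm_num
            · nlinarith
        _ = _ := by ring
    · refine (fin C2 hC2).trans ?_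
      gcongr; linarith

end S18

namespace S18

lemma Ev_conj (z : ℂ) : Ev ((starRingEnd ℂ) z) = (starRingEnd ℂ) (Ev z) := by
  rw [Ev, Ev, Complex.conj_tsum]
  congr 1; funext k
  have h2 : (starRingEnd ℂ) 2 = 2 := map_ofNat _ 2
  have h4 : (starRingEnd ℂ) 4 = 4 := map_ofNat _ 4
  simp [EvT, ← Complex.sinh_conj, h2, h4]

lemma Od_conj (z : ℂ) : Od ((starRingEnd ℂ) z) = (starRingEnd ℂ) (Od z) := by
  rw [Od, Od, Complex.conj_tsum]
  congr 1; funext k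
  have h2 : (starRingEnd ℂ) 2 = 2 := map_ofNat _ 2
  simp [OdT, ← Complex.cosh_conj, h2]

lemma cos_nat_mul_pi_c (k : ℕ) : Complex.cos ((k : ℂ) * π) = (-1) ^ k := by
  have := Real.cos_nat_mul_pi k
  have h := congrArg (fun x : ℝ => (x : ℂ)) this
  push_cast at h
  exact h

lemma sinh_shift (w : ℂ) (k : ℕ) :
    Complex.sinh (w + (k + 1) * (π * Complex.I)) = (-1) ^ (k + 1) * Complex.sinh w := by
  have hs : Complex.sinh ((k + 1) * (π * Complex.I)) = 0 := by
    rw [← mul_assoc, Complex.sinh_mul_I]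
    have : ((k : ℂ) + 1) * π = ((k + 1 : ℕ) : ℂ) * π := by push_cast; ring
    rw [this, Complex.sin_nat_mul_pi]; simp
  have hc : Complex.cosh ((k + 1) * (π * Complex.I)) = (-1) ^ (k + 1) := by
    rw [← mul_assoc, Complex.cosh_mul_I]
    have : ((k : ℂ) + 1) * π = ((k + 1 : ℕ) : ℂ) * π := by push_cast; ring
    rw [this, cos_nat_mul_pi_c]
  rw [Complex.sinh_add, hs, hc]; ring

lemma cosh_shift (w : ℂ) (k : ℕ) :
    Complex.cosh (w + (2 * k + 1) * (π / 2 * Complex.I)) = Complex.I * (-1) ^ k * Complex.sinh w := by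
  have e : (2 * (k : ℂ) + 1) * (π / 2 * Complex.I) = (k * π + π / 2) * Complex.I := by ring
  have hs : Complex.sinh ((2 * (k : ℂ) + 1) * (π / 2 * Complex.I)) = (-1) ^ k * Complex.I := by
    rw [e, Complex.sinh_mul_I, Complex.sin_add_pi_div_two, cos_nat_mul_pi_c]
  have hc : Complex.cosh ((2 * (k : ℂ) + 1) * (π / 2 * Complex.I)) = 0 := by
    rw [e, Complex.cosh_mul_I, Complex.cos_add_pi_div_two, Complex.sin_nat_mul_pi, neg_zero]
  rw [Complex.cosh_add, hs, hc]; ring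

lemma hasSum_altsq : HasSum (fun k : ℕ => (-1 : ℝ) ^ k / ((k : ℝ) + 1) ^ 2) (π ^ 2 / 12) := by
  have h1 : HasSum (fun k : ℕ => (-1 : ℝ) ^ (2 * k) / (((2 * k : ℕ) : ℝ) + 1) ^ 2) (π ^ 2 / 8) := by
    refine hs_congr hasSum_oddsq (fun k => ?_) rfl
    rw [pow_mul]; push_cast; simp
  have h2 : HasSum (fun k : ℕ => (-1 : ℝ) ^ (2 * k + 1) / (((2 * k + 1 : ℕ) : ℝ) + 1) ^ 2) (-(π ^ 2 / 24)) := by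
    refine hs_congr (hasSum_sq.mul_left (-1 / 4)) (fun k => ?_) (by ring)
    rw [pow_succ, pow_mul]; push_cast
    have : (2 * (k : ℝ) + 1 + 1) = 2 * ((k : ℝ) + 1) := by ring
    rw [this, mul_pow, div_mul_div_comm]; norm_num
  have := HasSum.even_add_odd (f := fun k : ℕ => (-1 : ℝ) ^ k / ((k : ℝ) + 1) ^ 2) h1 h2
  refine hs_congr this (fun k => rfl) (by ring)

lemma hasSum_catalan : ∃ b : ℝ, 0 ≤ b ∧ b ≤ 1 ∧
    HasSum (fun k : ℕ => (-1 : ℝ) ^ k / (2 * (k : ℝ) + 1) ^ 2) b := by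
  have hs : Summable (fun k : ℕ => (-1 : ℝ) ^ k / (2 * (k : ℝ) + 1) ^ 2) := by
    refine Summable.of_norm_bounded hasSum_oddsq.summable (fun k => ?_)
    rw [norm_div, norm_pow, norm_neg, norm_one, one_pow, Real.norm_of_nonneg (by positivity)]
  obtain ⟨b, hb⟩ := hs
  have ht := hb.tendsto_sum_nat
  have ht' : Tendsto (fun n => ∑ i ∈ Finset.range n, (-1 : ℝ) ^ i * (1 / (2 * (i : ℝ) + 1) ^ 2)) atTop (nhds b) := by
    refine ht.congr (fun n => Finset.sum_congr rfl (fun i _ => by ring))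
  have ha : Antitone (fun i : ℕ => 1 / (2 * (i : ℝ) + 1) ^ 2) := by
    intro i j hij
    have : (i : ℝ) ≤ j := by exact_mod_cast hij
    have h0 : (0 : ℝ) ≤ i := Nat.cast_nonneg i
    apply one_div_le_one_div_of_le (by positivity)
    apply pow_le_pow_left₀ (by positivity)
    linarith
  refine ⟨b, ?_, ?_, hb⟩
  · simpa using ha.alternating_series_le_tendsto ht' 0
  · simpa using ha.tendsto_le_alternating_series ht' 0

/-- Error sum. -/
lemma err_sum {t : ℝ} (ht : 0 < t) :
    Summable (fun k : ℕ => 1 / ((k : ℝ) + 1) * (1 / (1 + ((k : ℝ) + 1) * t))) ∧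
    ∑' k : ℕ, 1 / ((k : ℝ) + 1) * (1 / (1 + ((k : ℝ) + 1) * t)) ≤ 2 / √t := by
  obtain ⟨ts, tb⟩ := tele ht
  have hst : 0 < √t := Real.sqrt_pos.2 ht
  have hsq : √t * √t = t := Real.mul_self_sqrt ht.le
  have hS : HasSum (fun k : ℕ => 1 / (2 * √t) * (1 / ((k : ℝ) + 1) ^ 2) +
      √t / 2 * (1 / (1 + ((k : ℝ) + 1) * t) ^ 2))
      (1 / (2 * √t) * (π ^ 2 / 6) + √t / 2 * ∑' k : ℕ, 1 / (1 + ((k : ℝ) + 1) * t) ^ 2) :=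
    (hasSum_sq.mul_left _).add (ts.hasSum.mul_left _)
  have hle : ∀ k : ℕ, 1 / ((k : ℝ) + 1) * (1 / (1 + ((k : ℝ) + 1) * t)) ≤
      1 / (2 * √t) * (1 / ((k : ℝ) + 1) ^ 2) + √t / 2 * (1 / (1 + ((k : ℝ) + 1) * t) ^ 2) := by
    intro k
    set x := 1 / ((k : ℝ) + 1)
    set y := 1 / (1 + ((k : ℝ) + 1) * t)
    have hx : 1 / ((k : ℝ) + 1) ^ 2 = x ^ 2 := by simp [x]
    have hy : 1 / (1 + ((k : ℝ) + 1) * t) ^ 2 = y ^ 2 := by simp [y]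
    rw [hx, hy]
    have h1 : 1 / (2 * √t) * x ^ 2 + √t / 2 * y ^ 2 - x * y = (x - √t * y) ^ 2 / (2 * √t) := by
      field_simp; ring
    have : 0 ≤ (x - √t * y) ^ 2 / (2 * √t) := by positivity
    linarith
  have hsum := Summable.of_nonneg_of_le (fun k => by positivity) hle hS.summable
  refine ⟨hsum, ?_⟩
  refine (hsum.tsum_le_tsum hle hS.summable).trans ?_
  rw [hS.tsum_eq]
  have h1 : √t / 2 * ∑' k : ℕ, 1 / (1 + ((k : ℝ) + 1) * t) ^ 2 ≤ √t / 2 * (1 / t) := by gcongr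
  have h2 : √t / 2 * (1 / t) = 1 / (2 * √t) := by
    nth_rewrite 2 [← hsq]; field_simp
  have h3 : 1 / (2 * √t) * (π ^ 2 / 6) ≤ 1 / (2 * √t) * 2 := by
    gcongr
    nlinarith [Real.pi_lt_d2, Real.pi_pos]
  have h4 : 1 / (2 * √t) * 2 + 1 / (2 * √t) ≤ 2 / √t := by
    have : 1 / (2 * √t) * 2 + 1 / (2 * √t) = (3 / 2) / √t := by field_simp; norm_num
    rw [this]; gcongr; norm_num
  linarith

lemma near_i (K : ℝ) : ∃ C, 0 < C ∧ ∀ b : ℝ, HasSum (fun k : ℕ => (-1 : ℝ) ^ k / (2 * (k : ℝ) + 1) ^ 2) b →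
    ∀ t φ : ℝ, 0 < t → |φ| ≤ K * t →
    ‖Ev ((t + φ * Complex.I) + π / 2 * Complex.I) + (π ^ 2 / 96 : ℝ) / (t + φ * Complex.I)‖ ≤ C / √t ∧
    ‖Od ((t + φ * Complex.I) + π / 2 * Complex.I) + Complex.I * ((b / 2 : ℝ) / (t + φ * Complex.I))‖ ≤ C / √t := by
  obtain ⟨C, hC, h1⟩ := sF_bound K
  refine ⟨2 * C, by positivity, fun b hb t φ ht hφ => ?_⟩
  set z : ℂ := t + φ * Complex.I with hz
  have hre : z.re = t := by simp [hz]
  have him : z.im = φ := by simp [hz]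
  have hre0 : 0 < z.re := by rw [hre]; exact ht
  have hz0 : z ≠ 0 := by intro h; rw [h] at hre0; simp at hre0
  have hre2 : 0 < (z + π / 2 * Complex.I).re := by simpa using hre0
  obtain ⟨es, eb⟩ := err_sum ht
  have hfin : ∑' k : ℕ, C * (1 / ((k : ℝ) + 1) * (1 / (1 + ((k : ℝ) + 1) * t))) ≤ 2 * C / √t := by
    rw [tsum_mul_left]
    calc C * _ ≤ C * (2 / √t) := by gcongr
      _ = _ := by ring
  have hsb : ∀ c : ℝ, 0 < c → ‖sF ((c : ℂ) * z)‖ ≤ C / (1 + c * t) := by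
    intro c hc
    have e1 : ((c : ℂ) * z).re = c * t := by simp [hre]
    have e2 : ((c : ℂ) * z).im = c * φ := by simp [him]
    have := (h1 ((c : ℂ) * z) (by rw [e1]; positivity) (by
      rw [e1, e2, abs_mul, abs_of_pos hc]; nlinarith)).1
    rwa [e1] at this
  constructor
  · have hs1 := (EvT_summable hre2).hasSum
    have hs2 : HasSum (fun k : ℕ => (((-1 : ℝ) ^ k / ((k : ℝ) + 1) ^ 2 : ℝ) : ℂ) * (1 / (8 * z)))
        ((π ^ 2 / 96 : ℝ) / z) := by
      refine hs_congr ((Complex.hasSum_ofReal.2 hasSum_altsq).mul_right (1 / (8 * z))) (fun k => rfl) ?_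
      push_cast; field_simp; norm_num
    have hs := hs1.add hs2
    change ‖(∑' k, EvT _ k) + _‖ ≤ _
    rw [← hs.tsum_eq]
    refine (tsum_of_norm_bounded (es.mul_left C).hasSum (fun k => ?_)).trans hfin
    have hk : ((k : ℂ) + 1) ≠ 0 := by exact_mod_cast Nat.succ_ne_zero k
    have e : EvT (z + π / 2 * Complex.I) k + (((-1 : ℝ) ^ k / ((k : ℝ) + 1) ^ 2 : ℝ) : ℂ) * (1 / (8 * z)) =
        (-1) ^ (k + 1) * (1 / (4 * ((k : ℂ) + 1)) * sF (((2 * ((k : ℝ) + 1) : ℝ) : ℂ) * z)) := by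
      have hsn : Complex.sinh (2 * ((k : ℂ) + 1) * z) ≠ 0 := by
        apply sinh_ne; simp; positivity
      rw [EvT, show 2 * ((k : ℂ) + 1) * (z + π / 2 * Complex.I) =
        2 * ((k : ℂ) + 1) * z + (k + 1) * (π * Complex.I) by ring, sinh_shift, sF]
      push_cast
      have hm : ((-1 : ℂ)) ^ (k + 1) * (-1) ^ (k + 1) = 1 := by rw [← mul_pow]; simp
      have hm0 : ((-1 : ℂ)) ^ (k + 1) ≠ 0 := by simp
      have hinv : 1 / ((-1 : ℂ)) ^ (k + 1) = (-1) ^ (k + 1) := by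
        rw [div_eq_iff hm0, hm]
      generalize Complex.sinh (2 * ((k : ℂ) + 1) * z) = s at *
      have : 1 / (4 * ((k : ℂ) + 1) * ((-1) ^ (k + 1) * s)) = (1 / ((-1 : ℂ)) ^ (k + 1)) * (1 / (4 * ((k : ℂ) + 1) * s)) := by
        field_simp
      rw [this, hinv, pow_succ]
      field_simp
      ring
    rw [e, norm_mul, norm_pow, norm_neg, norm_one, one_pow, one_mul, norm_mul, norm_div, norm_one,
      norm_mul, norm_k1]
    have := hsb (2 * ((k : ℝ) + 1)) (by positivity)
    simp only [Complex.norm_ofNat]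
    calc _ ≤ 1 / (4 * ((k : ℝ) + 1)) * (C / (1 + 2 * ((k : ℝ) + 1) * t)) := by gcongr
      _ ≤ 1 / (1 * ((k : ℝ) + 1)) * (C / (1 + 1 * ((k : ℝ) + 1) * t)) := by
        gcongr <;> norm_num
      _ = _ := by ring
  · have hs1 := (OdT_summable hre2).hasSum
    have hs2 : HasSum (fun k : ℕ => (((-1 : ℝ) ^ k / (2 * (k : ℝ) + 1) ^ 2 : ℝ) : ℂ) * (Complex.I / (2 * z)))
        (Complex.I * ((b / 2 : ℝ) / z)) := by
      refine hs_congr ((Complex.hasSum_ofReal.2 hb).mul_right (Complex.I / (2 * z))) (fun k => rfl) ?_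
      push_cast; field_simp
    have hs := hs1.add hs2
    change ‖(∑' k, OdT _ k) + _‖ ≤ _
    rw [← hs.tsum_eq]
    refine (tsum_of_norm_bounded (es.mul_left C).hasSum (fun k => ?_)).trans hfin
    have hk : (2 * (k : ℂ) + 1) ≠ 0 := by
      have : (2 * (k : ℂ) + 1) = ((2 * k + 1 : ℕ) : ℂ) := by push_cast; ring
      rw [this]; exact Nat.cast_ne_zero.2 (by omega)
    have e : OdT (z + π / 2 * Complex.I) k + (((-1 : ℝ) ^ k / (2 * (k : ℝ) + 1) ^ 2 : ℝ) : ℂ) * (Complex.I / (2 * z)) =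
        (-1) ^ k * (-Complex.I) * (1 / (2 * (2 * (k : ℂ) + 1)) * sF (((2 * (k : ℝ) + 1 : ℝ) : ℂ) * z)) := by
      have hsn : Complex.sinh ((2 * (k : ℂ) + 1) * z) ≠ 0 := by
        apply sinh_ne; simp; positivity
      rw [OdT, show (2 * (k : ℂ) + 1) * (z + π / 2 * Complex.I) =
        (2 * (k : ℂ) + 1) * z + (2 * k + 1) * (π / 2 * Complex.I) by ring, cosh_shift, sF]
      push_cast
      have hm : ((-1 : ℂ)) ^ k * (-1) ^ k = 1 := by rw [← mul_pow]; simp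
      have hm0 : ((-1 : ℂ)) ^ k ≠ 0 := by simp
      have hinv : 1 / (Complex.I * (-1 : ℂ) ^ k) = -Complex.I * (-1) ^ k := by
        rw [div_eq_iff (mul_ne_zero Complex.I_ne_zero hm0)]
        linear_combination (-1 : ℂ) * hm + (-1 : ℂ)^k * (-1)^k * Complex.I_mul_I
      generalize Complex.sinh ((2 * (k : ℂ) + 1) * z) = s at *
      have : 1 / (2 * (2 * (k : ℂ) + 1) * (Complex.I * (-1) ^ k * s)) =
          (1 / (Complex.I * (-1 : ℂ) ^ k)) * (1 / (2 * (2 * (k : ℂ) + 1) * s)) := by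
        rw [div_mul_div_comm]; congr 1
        · ring
        · ring
      rw [this, hinv]
      field_simp
      ring
    rw [e, norm_mul, norm_mul, norm_neg, Complex.norm_I, norm_pow, norm_neg, norm_one, one_pow, one_mul, one_mul, norm_mul, norm_div, norm_one,
      norm_mul, norm_2k1]
    have := hsb (2 * (k : ℝ) + 1) (by positivity)
    simp only [Complex.norm_ofNat]
    have hk0 : (0 : ℝ) ≤ k := Nat.cast_nonneg k
    calc _ ≤ 1 / (2 * (2 * (k : ℝ) + 1)) * (C / (1 + (2 * (k : ℝ) + 1) * t)) := by gcongr
      _ ≤ 1 / ((k : ℝ) + 1) * (C / (1 + ((k : ℝ) + 1) * t)) := by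
        gcongr <;> linarith
      _ = _ := by ring

end S18

namespace S18

lemma mid_arc {t θ s : ℝ} (ht : 0 < t) (hs : s = 1 ∨ s = -1) (h1 : 1000 * t ≤ θ) (h2 : θ ≤ π / 2 - 1000 * t) :
    (Ev (t + θ * Complex.I) + s * Od (t + θ * Complex.I)).re ≤ (π ^ 2 / 48 - 1 / 2000) / t := by
  set z : ℂ := t + θ * Complex.I with hz
  have hre : z.re = t := by simp [hz]
  have him : z.im = θ := by simp [hz]
  have hre0 : 0 < z.re := by rw [hre]; exact ht
  have hπ := Real.pi_pos
  -- tails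
  have hE1 : HasSum (fun k : ℕ => 1 / (8 * (((k + 1 : ℕ) : ℝ) + 1) ^ 2 * t)) ((π ^ 2 / 48 - 1 / 8) / t) := by
    have := (hasSum_nat_add_iff' (f := fun k : ℕ => 1 / (8 * ((k : ℝ) + 1) ^ 2 * t)) 1).2 (EvB_hasSum t)
    refine hs_congr this (fun k => rfl) ?_
    simp; field_simp
  have hO1 : HasSum (fun k : ℕ => 1 / (2 * (2 * ((k + 1 : ℕ) : ℝ) + 1) ^ 2 * t)) ((π ^ 2 / 16 - 1 / 2) / t) := by
    have := (hasSum_nat_add_iff' (f := fun k : ℕ => 1 / (2 * (2 * (k : ℝ) + 1) ^ 2 * t)) 1).2 (OdB_hasSum t)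
    refine hs_congr this (fun k => rfl) ?_
    simp; field_simp
  have hE2 : Ev z = EvT z 0 + ∑' k, EvT z (k + 1) := (EvT_summable hre0).tsum_eq_zero_add
  have hO2 : Od z = OdT z 0 + ∑' k, OdT z (k + 1) := (OdT_summable hre0).tsum_eq_zero_add
  have hE3 : ‖∑' k, EvT z (k + 1)‖ ≤ (π ^ 2 / 48 - 1 / 8) / t :=
    tsum_of_norm_bounded hE1 (fun k => by simpa [hre] using EvT_norm hre0 (k + 1))
  have hO3 : ‖∑' k, OdT z (k + 1)‖ ≤ (π ^ 2 / 16 - 1 / 2) / t :=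
    tsum_of_norm_bounded hO1 (fun k => by simpa [hre] using OdT_norm hre0 (k + 1))
  have hO4 : ‖OdT z 0‖ ≤ π / (4000 * t) := by
    have e : OdT z 0 = 1 / (2 * Complex.cosh z) := by simp [OdT]
    have hc : Complex.cosh z = (Real.cosh t * Real.cos θ : ℝ) + (Real.sinh t * Real.sin θ : ℝ) * Complex.I := by
      rw [hz, Complex.cosh_add, Complex.cosh_mul_I, Complex.sinh_mul_I]; push_cast; ring
    have hcos : 2000 * t / π ≤ Real.cos θ := by
      rw [← Real.sin_pi_div_two_sub]
      refine le_trans ?_ (Real.mul_le_sin (x := π / 2 - θ) (by nlinarith) (by nlinarith))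
      rw [div_mul_eq_mul_div]
      exact div_le_div_of_nonneg_right (by linarith) hπ.le
    have hn : 2000 * t / π ≤ ‖Complex.cosh z‖ := by
      refine le_trans ?_ (Complex.abs_re_le_norm _)
      have : (Complex.cosh z).re = Real.cosh t * Real.cos θ := by
        rw [hc]; simp only [Complex.add_re, Complex.ofReal_re, Complex.re_ofReal_mul, Complex.I_re]; ring
      rw [this]
      refine le_trans ?_ (le_abs_self _)
      have := Real.one_le_cosh t
      have h0 : 0 ≤ Real.cos θ := le_trans (by positivity) hcos
      nlinarith
    rw [e, norm_div, norm_mul, norm_one]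
    simp only [Complex.norm_ofNat]
    calc 1 / (2 * ‖Complex.cosh z‖) ≤ 1 / (2 * (2000 * t / π)) := by gcongr
      _ = _ := by field_simp; norm_num
  have hE4 : (EvT z 0).re ≤ π / (16000 * t) := by
    have e : EvT z 0 = 1 / (4 * Complex.sinh (2 * z)) := by simp [EvT]
    have hsc : Complex.sinh (2 * z) = (Real.sinh (2 * t) * Real.cos (2 * θ) : ℝ) + (Real.cosh (2 * t) * Real.sin (2 * θ) : ℝ) * Complex.I := by
      rw [hz, show 2 * ((t : ℂ) + θ * Complex.I) = (2 * t) + (2 * θ) * Complex.I by ring,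
        Complex.sinh_add, Complex.cosh_mul_I, Complex.sinh_mul_I]; push_cast; ring
    rcases le_total (π / 4) θ with h | h
    · have : (EvT z 0).re ≤ 0 := by
        rw [e, one_div, Complex.inv_re]
        apply div_nonpos_of_nonpos_of_nonneg _ (Complex.normSq_nonneg _)
        have : (4 * Complex.sinh (2 * z)).re = 4 * (Real.sinh (2 * t) * Real.cos (2 * θ)) := by
          rw [hsc]; simp [Complex.mul_re, ← Complex.ofReal_mul, -Complex.ofReal_sinh, -Complex.ofReal_cos,
            -Complex.ofReal_cosh, -Complex.ofReal_sin]
        rw [this]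
        have hc : Real.cos (2 * θ) ≤ 0 :=
          Real.cos_nonpos_of_pi_div_two_le_of_le (by linarith) (by linarith)
        have := (Real.sinh_pos_iff (x := 2 * t)).2 (by linarith)
        nlinarith
      exact this.trans (by positivity)
    · refine (Complex.re_le_norm _).trans ?_
      have hsin : 4000 * t / π ≤ Real.sin (2 * θ) := by
        refine le_trans ?_ (Real.mul_le_sin (x := 2 * θ) (by nlinarith) (by nlinarith))
        rw [div_mul_eq_mul_div]
        exact div_le_div_of_nonneg_right (by linarith) hπ.le
      have hn : 4000 * t / π ≤ ‖Complex.sinh (2 * z)‖ := by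
        refine le_trans ?_ (Complex.abs_im_le_norm _)
        have : (Complex.sinh (2 * z)).im = Real.cosh (2 * t) * Real.sin (2 * θ) := by
          rw [hsc]; simp only [Complex.add_im, Complex.ofReal_im, Complex.im_ofReal_mul, Complex.I_im]; ring
        rw [this]
        refine le_trans ?_ (le_abs_self _)
        have := Real.one_le_cosh (2 * t)
        have h0 : 0 ≤ Real.sin (2 * θ) := le_trans (by positivity) hsin
        nlinarith
      rw [e, norm_div, norm_mul, norm_one]
      simp only [Complex.norm_ofNat]
      calc 1 / (4 * ‖Complex.sinh (2 * z)‖) ≤ 1 / (4 * (4000 * t / π)) := by gcongr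
        _ = _ := by field_simp; norm_num
  have hO5 : ((s : ℂ) * Od z).re ≤ π / (4000 * t) + (π ^ 2 / 16 - 1 / 2) / t := by
    refine (Complex.re_le_norm _).trans ?_
    have : ‖(s : ℂ)‖ = 1 := by rcases hs with h | h <;> simp [h]
    rw [norm_mul, this, one_mul, hO2]
    exact (norm_add_le _ _).trans (add_le_add hO4 hO3)
  have hE5 : (Ev z).re ≤ π / (16000 * t) + (π ^ 2 / 48 - 1 / 8) / t := by
    rw [hE2, Complex.add_re]
    exact add_le_add hE4 ((Complex.re_le_norm _).trans hE3)
  rw [Complex.add_re]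
  refine (add_le_add hE5 hO5).trans ?_
  have : π / (16000 * t) + (π ^ 2 / 48 - 1 / 8) / t + (π / (4000 * t) + (π ^ 2 / 16 - 1 / 2) / t) =
    (π / 16000 + (π ^ 2 / 48 - 1 / 8) + (π / 4000 + (π ^ 2 / 16 - 1 / 2))) / t := by
    field_simp
  rw [this]
  gcongr
  nlinarith [Real.pi_lt_d4, Real.pi_gt_d4]

lemma i_arc : ∃ t0 > 0, ∀ t θ s : ℝ, 0 < t → t < t0 → (s = 1 ∨ s = -1) → π / 2 - 1000 * t ≤ θ → θ ≤ π / 2 →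
    (Ev (t + θ * Complex.I) + s * Od (t + θ * Complex.I)).re ≤ (π ^ 2 / 48 - 1 / 2000) / t := by
  obtain ⟨C, hC, h⟩ := near_i 1000
  obtain ⟨b, hb0, hb1, hb⟩ := hasSum_catalan
  refine ⟨(1 / (4000 * C)) ^ 2, by positivity, fun t θ s ht ht0 hs h1 h2 => ?_⟩
  obtain ⟨hE, hO⟩ := h b hb t (θ - π / 2) ht (by rw [abs_le]; constructor <;> linarith)
  have e : ((t : ℂ) + ((θ - π / 2 : ℝ) : ℂ) * Complex.I) + π / 2 * Complex.I = t + θ * Complex.I := by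
    push_cast; ring
  rw [e] at hE hO
  set φ := θ - π / 2 with hφ
  set z' : ℂ := t + φ * Complex.I with hz'
  set z : ℂ := t + θ * Complex.I
  have hst : 0 < √t := Real.sqrt_pos.2 ht
  have hsq : √t * √t = t := Real.mul_self_sqrt ht.le
  have hst2 : √t < 1 / (4000 * C) := by
    rw [Real.sqrt_lt' (by positivity)]; exact ht0
  have hD : 0 < t ^ 2 + φ ^ 2 := by positivity
  have hns : Complex.normSq z' = t ^ 2 + φ ^ 2 := by simp [hz', Complex.normSq_apply]; ring
  have hinvre : (1 / z').re = t / (t ^ 2 + φ ^ 2) := by rw [one_div, Complex.inv_re, hns]; simp [hz']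
  have hinvim : (1 / z').im = -φ / (t ^ 2 + φ ^ 2) := by rw [one_div, Complex.inv_im, hns]; simp [hz']
  have hE' : (Ev z).re ≤ -(π ^ 2 / 96) * (t / (t ^ 2 + φ ^ 2)) + C / √t := by
    have h3 := (Complex.re_le_norm _).trans hE
    rw [Complex.add_re, div_eq_mul_one_div, Complex.re_ofReal_mul, hinvre] at h3
    linarith
  have hO' : (s * Od z).re ≤ 1 / 2 * (-φ / (t ^ 2 + φ ^ 2)) + C / √t := by
    have h3 := (Complex.abs_re_le_norm _).trans hO
    rw [Complex.add_re, div_eq_mul_one_div, mul_left_comm, Complex.re_ofReal_mul, Complex.I_mul_re, hinvim, abs_le] at h3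
    rw [Complex.re_ofReal_mul]
    have hφ0 : 0 ≤ -φ / (t ^ 2 + φ ^ 2) := div_nonneg (by linarith) hD.le
    rcases hs with h | h <;> rw [h] <;> nlinarith
  rw [Complex.add_re]
  have hkey : -(π ^ 2 / 96) * (t / (t ^ 2 + φ ^ 2)) + 1 / 2 * (-φ / (t ^ 2 + φ ^ 2)) ≤ (π ^ 2 / 48 - 1 / 1000) / t := by
    rw [← mul_div_assoc, ← mul_div_assoc, ← add_div, div_le_div_iff₀ hD ht]
    have hp : (9.869 : ℝ) ≤ π ^ 2 := by nlinarith [Real.pi_gt_d4]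
    nlinarith [sq_nonneg (t + 0.81 * φ), sq_nonneg φ, sq_nonneg t, mul_nonneg (sub_nonneg.2 hp) (sq_nonneg t), mul_nonneg (sub_nonneg.2 hp) (sq_nonneg φ)]
  have hC2 : 2 * (C / √t) ≤ (1 / 2000) / t := by
    rw [← mul_div_assoc, div_le_div_iff₀ hst ht]
    have h4 : √t * (4000 * C) < 1 := by rwa [lt_div_iff₀ (by positivity)] at hst2
    nlinarith
  have : (π ^ 2 / 48 - 1 / 2000) / t = (π ^ 2 / 48 - 1 / 1000) / t + (1 / 2000) / t := by
    rw [← add_div]; congr 1; ring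
  linarith

lemma minor : ∃ t0 > 0, ∀ t θ s : ℝ, 0 < t → t < t0 → (s = 1 ∨ s = -1) → 1000 * t ≤ |θ| → |θ| ≤ π / 2 →
    (Ev (t + θ * Complex.I) + s * Od (t + θ * Complex.I)).re ≤ (π ^ 2 / 48 - 1 / 2000) / t := by
  obtain ⟨t0, h0, h⟩ := i_arc
  refine ⟨t0, h0, fun t θ s ht htt hs h1 h2 => ?_⟩
  have key : ∀ θ : ℝ, 1000 * t ≤ θ → θ ≤ π / 2 → (Ev (t + θ * Complex.I) + s * Od (t + θ * Complex.I)).re ≤ (π ^ 2 / 48 - 1 / 2000) / t := by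
    intro θ h1 h2
    rcases le_total θ (π / 2 - 1000 * t) with h3 | h3
    · exact mid_arc ht hs h1 h3
    · exact h t θ s ht htt hs h3 h2
  rcases le_total 0 θ with h3 | h3
  · rw [abs_of_nonneg h3] at h1 h2; exact key θ h1 h2
  · rw [abs_of_nonpos h3] at h1 h2
    have := key (-θ) h1 h2
    have e : (t : ℂ) + ((-θ : ℝ) : ℂ) * Complex.I = (starRingEnd ℂ) (t + θ * Complex.I) := by simp
    rw [e, Ev_conj, Od_conj] at this
    simpa [Complex.add_re, Complex.re_ofReal_mul] using this

end S18

namespace S18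

lemma sd {r r1 r2 : ℝ → ℝ} {C x k : ℝ} (hk : 0 ≤ k) (hx : 0 < x) (hC : 0 ≤ C)
    (h1 : ∀ y > 0, HasDerivAt r (r1 y) y) (h2 : ∀ y > 0, HasDerivAt r1 (r2 y) y)
    (h3 : ∀ y > 0, |r2 y| ≤ C / (1 + y) ^ 2) :
    |r x - 2 * r (x + k) + r (x + 2 * k)| ≤ C / (1 + x) ^ 2 * k ^ 2 := by
  have hb : ∀ y ∈ Set.Ici x, |r2 y| ≤ C / (1 + x) ^ 2 := by
    intro y hy
    have hy' : x ≤ y := hy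
    refine (h3 y (lt_of_lt_of_le hx hy)).trans ?_
    gcongr
  have s1 : ∀ y ∈ Set.Ici x, |r1 (y + k) - r1 y| ≤ C / (1 + x) ^ 2 * k := by
    intro y hy
    have hy' : x ≤ y := hy
    have := Convex.norm_image_sub_le_of_norm_hasDerivWithin_le (f := r1) (f' := r2) (s := Set.Ici x)
      (fun w hw => (h2 w (lt_of_lt_of_le hx hw)).hasDerivWithinAt) hb (convex_Ici x) hy
      (show y + k ∈ Set.Ici x from by simp; linarith)
    simpa [abs_of_nonneg hk] using this
  have := Convex.norm_image_sub_le_of_norm_hasDerivWithin_le (f := fun y => r (y + k) - r y)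
      (f' := fun y => r1 (y + k) - r1 y) (s := Set.Ici x)
      (fun w hw => by
        have hw' : x ≤ w := hw
        exact (((h1 (w + k) (by linarith)).comp_add_const w k).sub (h1 w (by linarith))).hasDerivWithinAt)
      s1 (convex_Ici x) (show x ∈ Set.Ici x by simp)
      (show x + k ∈ Set.Ici x from by simp; linarith)
  have e : r x - 2 * r (x + k) + r (x + 2 * k) = (r (x + k + k) - r (x + k)) - (r (x + k) - r x) := by
    rw [show x + 2 * k = x + k + k by ring]; ring
  rw [e]
  simp only [Real.norm_eq_abs, add_sub_cancel_left, abs_of_nonneg hk] at this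
  calc _ ≤ _ := this
    _ = _ := by ring

lemma halfsum {r r1 r2 : ℝ → ℝ} {C : ℝ} (hC : 0 ≤ C)
    (h1 : ∀ y > 0, HasDerivAt r (r1 y) y) (h2 : ∀ y > 0, HasDerivAt r1 (r2 y) y)
    (h3 : ∀ y > 0, |r2 y| ≤ C / (1 + y) ^ 2) (h4 : Tendsto r atTop (nhds 0))
    {a h S : ℝ} (ha : 0 < a) (hh : 0 < h)
    (hS : Tendsto (fun N => ∑ i ∈ Finset.range N, (r ((i + a) * h) - r ((i + a + 1 / 2) * h))) atTop (nhds S)) :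
    |S - 1 / 2 * r (a * h)| ≤ C * (h ^ 2 + h) := by
  have hpart : ∀ N : ℕ, |∑ i ∈ Finset.range N, (r ((i + a) * h) - r ((i + a + 1 / 2) * h)) -
      1 / 2 * (r (a * h) - r ((N + a) * h))| ≤ C * (h ^ 2 + h) := by
    intro N
    have e : ∑ i ∈ Finset.range N, (r ((i + a) * h) - r ((i + a + 1 / 2) * h)) -
      1 / 2 * (r (a * h) - r ((N + a) * h)) = ∑ i ∈ Finset.range N, 1 / 2 * (r ((i + a) * h) - 2 * r ((i + a) * h + h / 2) +
        r ((i + a) * h + 2 * (h / 2))) := by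
      induction N with
      | zero => simp
      | succ n ih =>
        rw [Finset.sum_range_succ, Finset.sum_range_succ, ← ih]
        rw [show ((n : ℝ) + a) * h + h / 2 = (n + a + 1 / 2) * h by ring,
          show ((n : ℝ) + a) * h + 2 * (h / 2) = ((n + 1 : ℕ) + a) * h by push_cast; ring]
        ring
    rw [e]
    refine (Finset.abs_sum_le_sum_abs _ _).trans ?_
    have ht : ∀ i ∈ Finset.range N, |1 / 2 * (r ((i + a) * h) - 2 * r ((i + a) * h + h / 2) +
        r ((i + a) * h + 2 * (h / 2)))| ≤ C * h ^ 2 * (1 / (1 + (i : ℝ) * h) ^ 2) := by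
      intro i _
      have hi : (0 : ℝ) ≤ i := Nat.cast_nonneg i
      have := sd (k := h / 2) (x := (i + a) * h) (by positivity) (by positivity) hC h1 h2 h3
      rw [abs_mul, abs_of_pos (by norm_num : (0 : ℝ) < 1 / 2)]
      have h5 : C / (1 + (i + a) * h) ^ 2 * (h / 2) ^ 2 ≤ C / (1 + i * h) ^ 2 * h ^ 2 := by
        gcongr
        · linarith
        · linarith
      have h6 : C / (1 + i * h) ^ 2 * h ^ 2 = C * h ^ 2 * (1 / (1 + (i : ℝ) * h) ^ 2) := by ring
      have h7 : 0 ≤ C / (1 + i * h) ^ 2 * h ^ 2 := by positivity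
      linarith
    refine (Finset.sum_le_sum ht).trans ?_
    rw [← Finset.mul_sum]
    obtain ⟨ts, tb⟩ := tele hh
    have hle : ∑ i ∈ Finset.range N, 1 / (1 + (i : ℝ) * h) ^ 2 ≤ 1 + 1 / h := by
      calc _ ≤ ∑ i ∈ Finset.range (N + 1), 1 / (1 + (i : ℝ) * h) ^ 2 := by
            apply Finset.sum_le_sum_of_subset_of_nonneg
            · exact Finset.range_mono (Nat.le_succ N)
            · intros; positivity
        _ = ∑ i ∈ Finset.range N, 1 / (1 + ((i : ℝ) + 1) * h) ^ 2 + 1 := by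
            rw [Finset.sum_range_succ']; simp
        _ ≤ 1 / h + 1 := by
            have := (ts.sum_le_tsum (Finset.range N) (fun i _ => by positivity)).trans tb
            linarith
        _ = _ := by ring
    calc C * h ^ 2 * _ ≤ C * h ^ 2 * (1 + 1 / h) := by gcongr
      _ = _ := by field_simp
  have hlim : Tendsto (fun N : ℕ => |∑ i ∈ Finset.range N, (r ((i + a) * h) - r ((i + a + 1 / 2) * h)) -
      1 / 2 * (r (a * h) - r ((N + a) * h))|) atTop (nhds |S - 1 / 2 * (r (a * h) - 0)|) := by
    refine (hS.sub (Tendsto.const_mul _ (tendsto_const_nhds.sub (h4.comp ?_)))).abs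
    apply Tendsto.atTop_mul_const hh
    exact tendsto_atTop_add_const_right _ _ tendsto_natCast_atTop_atTop
  have := le_of_tendsto hlim (Eventually.of_forall hpart)
  simpa using this

/-! ### log(1+e^{-x}) -/

noncomputable def fL (x : ℝ) : ℝ := Real.log (1 + Real.exp (-x))

lemma fL_d1 (x : ℝ) : HasDerivAt fL (-Real.exp (-x) / (1 + Real.exp (-x))) x := by
  have h := ((hasDerivAt_neg x).exp.const_add 1).log (by positivity)
  exact h.congr_deriv (by ring)

lemma fL_d2 (x : ℝ) : HasDerivAt (fun x => -Real.exp (-x) / (1 + Real.exp (-x)))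
    (Real.exp (-x) / (1 + Real.exp (-x)) ^ 2) x := by
  have h := (hasDerivAt_neg x).exp.neg.div ((hasDerivAt_neg x).exp.const_add 1) (by positivity)
  refine h.congr_deriv ?_
  simp only [Pi.neg_apply]
  ring

lemma exp_sq_bound {x : ℝ} (hx : 0 < x) : Real.exp (-x) ≤ 2 / (1 + x) ^ 2 := by
  rw [Real.exp_neg, ← one_div, div_le_div_iff₀ (Real.exp_pos x) (by positivity)]
  nlinarith [Real.quadratic_le_exp_of_nonneg hx.le]

lemma fL_b (x : ℝ) (hx : 0 < x) : |Real.exp (-x) / (1 + Real.exp (-x)) ^ 2| ≤ 2 / (1 + x) ^ 2 := by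
  rw [abs_of_nonneg (by positivity)]
  refine le_trans ?_ (exp_sq_bound hx)
  apply div_le_self (Real.exp_pos _).le
  have := Real.exp_pos (-x)
  nlinarith

lemma exp_neg_tendsto : Tendsto (fun x : ℝ => Real.exp (-x)) atTop (nhds 0) :=
  Real.tendsto_exp_neg_atTop_nhds_zero

lemma fL_inf : Tendsto fL atTop (nhds 0) := by
  have := (exp_neg_tendsto.const_add 1).log (by norm_num)
  simp at this
  exact this

lemma real_of_conj_Ev (t : ℝ) : Ev t = ((Ev t).re : ℝ) := by
  have := Ev_conj t
  rw [Complex.conj_ofReal] at this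
  exact (Complex.conj_eq_iff_re.1 this.symm).symm

lemma real_of_conj_Od (t : ℝ) : Od t = ((Od t).re : ℝ) := by
  have := Od_conj t
  rw [Complex.conj_ofReal] at this
  exact (Complex.conj_eq_iff_re.1 this.symm).symm

end S18

namespace S18

lemma expq_norm {x : ℝ} (hx : 0 < x) : ‖((Real.exp (-x) : ℝ) : ℂ)‖ < 1 := by
  rw [Complex.norm_real, Real.norm_of_nonneg (Real.exp_pos _).le]
  rw [Real.exp_lt_one_iff]; linarith

lemma log_cast {x : ℝ} (hx : 0 ≤ x) (k : ℕ) (c d : ℝ) (h : x = 1 - c * d ^ k) :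
    Complex.log (1 - (c : ℂ) * (d : ℂ) ^ k) = (Real.log x : ℝ) := by
  rw [Complex.ofReal_log hx, h]; push_cast; rfl

lemma Ev_log {t : ℝ} (ht : 0 < t) : HasSum (fun j : ℕ => fL ((j + 1) * (2 * t))) (2 * (Ev t).re) := by
  set Q : ℝ := Real.exp (-(2 * t)) with hQ
  have hQ0 : 0 < Q := Real.exp_pos _
  have hQ1 : Q < 1 := by rw [hQ, Real.exp_lt_one_iff]; linarith
  have hn1 : ‖(Q : ℂ)‖ < 1 := expq_norm (by positivity)
  have hn2 : ‖((Q ^ 2 : ℝ) : ℂ)‖ < 1 := by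
    push_cast; rw [norm_pow]; nlinarith [norm_nonneg (Q : ℂ)]
  obtain ⟨a1, b1, c1⟩ := lam_aux hn1 hn1
  obtain ⟨a2, b2, c2⟩ := lam_aux hn2 hn2
  have hpow : ∀ k : ℕ, Q ^ (k + 1) = Real.exp (-((k + 1) * (2 * t))) := by
    intro k; rw [hQ, ← Real.exp_nat_mul]; congr 1; push_cast; ring
  have hE : HasSum (EvT t) (1 / 2 * (∑' m, lamT Q Q m - ∑' m, lamT (Q ^ 2 : ℝ) (Q ^ 2 : ℝ) m)) := by
    refine hs_congr ((a1.hasSum.sub a2.hasSum).mul_left (1 / 2)) (fun k => ?_) rfl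
    have hk : ((k : ℂ) + 1) ≠ 0 := by exact_mod_cast Nat.succ_ne_zero k
    have hp1 : Q ^ (k + 1) < 1 := pow_lt_one₀ hQ0.le hQ1 (by omega)
    have hp0 : 0 < Q ^ (k + 1) := by positivity
    have hsinh : Complex.sinh (2 * ((k : ℂ) + 1) * t) = ((1 / Q ^ (k + 1) - Q ^ (k + 1)) / 2 : ℝ) := by
      have : (2 * ((k : ℂ) + 1) * t) = ((2 * (k + 1) * t : ℝ) : ℂ) := by push_cast; ring
      rw [this, ← Complex.ofReal_sinh, Real.sinh_eq, hpow, one_div, ← Real.exp_neg]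
      congr 4 <;> ring
    rw [EvT, hsinh, lamT, lamT]
    have hp : ((Q ^ 2 : ℝ) : ℂ) ^ (k + 1) = ((Q ^ (k + 1) : ℝ) : ℂ) ^ 2 := by push_cast; ring
    rw [hp]
    rw [← Complex.ofReal_pow]
    set y := Q ^ (k + 1)
    have hy1 : (y : ℂ) ≠ 0 := by exact_mod_cast hp0.ne'
    have hy2 : (1 - (y : ℂ)) ≠ 0 := by exact_mod_cast (by linarith : (1 - y) ≠ 0)
    have hy3 : (1 + (y : ℂ)) ≠ 0 := by exact_mod_cast (by linarith : (1 + y) ≠ 0)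
    have hy4 : (1 - (y : ℂ) ^ 2) ≠ 0 := by
      have : (1 - (y : ℂ) ^ 2) = (1 - y) * (1 + y) := by ring
      rw [this]; exact mul_ne_zero hy2 hy3
    push_cast
    have e4 : 4 * ((k : ℂ) + 1) * ((1 / y - y) / 2) = 2 * (k + 1) * ((1 - y) * (1 + y)) / y := by
      field_simp; ring
    rw [e4, show (1 - (y : ℂ) ^ 2) = (1 - y) * (1 + y) by ring]
    field_simp
    ring
  have hE2 : Ev t = _ := hE.tsum_eq
  rw [c1, c2] at hE2
  have hf : HasSum (fun j : ℕ => ((fL ((j + 1) * (2 * t)) : ℝ) : ℂ)) (2 * Ev t) := by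
    refine hs_congr (b1.neg.hasSum.sub b2.neg.hasSum) (fun k => ?_) ?_
    · have hp1 : Q ^ (k + 1) < 1 := pow_lt_one₀ hQ0.le hQ1 (by omega)
      have hp0 : 0 < Q ^ (k + 1) := by positivity
      rw [log_cast (x := 1 - Q ^ (k + 1)) (by linarith) k Q Q (by ring),
        log_cast (x := 1 - (Q ^ (k + 1)) ^ 2) (by nlinarith) k (Q ^ 2) (Q ^ 2) (by ring)]
      rw [fL, ← hpow]
      have : 1 - (Q ^ (k + 1)) ^ 2 = (1 - Q ^ (k + 1)) * (1 + Q ^ (k + 1)) := by ring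
      rw [this, Real.log_mul (by linarith) (by linarith)]
      push_cast; ring
    · rw [hE2]; ring
  rw [real_of_conj_Ev t] at hf
  have : (2 : ℂ) * ((Ev t).re : ℝ) = ((2 * (Ev t).re : ℝ) : ℂ) := by push_cast; rfl
  rw [this] at hf
  exact Complex.hasSum_ofReal.1 hf

lemma Ev_rec {h : ℝ} (hh : 0 < h) :
    |(2 * (Ev (h / 2 : ℝ)).re - 4 * (Ev h).re) - 1 / 2 * fL h| ≤ 2 * ((2 * h) ^ 2 + 2 * h) := by
  have H1 := Ev_log (t := h / 2) (by positivity)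
  have H2 := Ev_log hh
  have hodd : HasSum (fun i : ℕ => fL ((((2 * i : ℕ) : ℝ) + 1) * (2 * (h / 2)))) (2 * (Ev (h / 2 : ℝ)).re - 2 * (Ev h).re) := by
    have he : Summable (fun i : ℕ => fL ((((2 * i : ℕ) : ℝ) + 1) * (2 * (h / 2)))) :=
      H1.summable.comp_injective (i := fun i : ℕ => 2 * i) (fun a b hab => by simpa using hab)
    have ho : HasSum (fun i : ℕ => fL ((((2 * i + 1 : ℕ) : ℝ) + 1) * (2 * (h / 2)))) (2 * (Ev h).re) := by
      refine hs_congr H2 (fun i => ?_) rfl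
      congr 1; push_cast; ring
    have := (HasSum.even_add_odd (f := fun j : ℕ => fL ((j + 1) * (2 * (h / 2)))) he.hasSum ho).unique H1
    rw [← this, add_sub_cancel_right]; exact he.hasSum
  have hd := (hodd.sub H2).tendsto_sum_nat
  have := halfsum (r := fL) (C := 2) (a := 1 / 2) (h := 2 * h) (S := 2 * (Ev (h / 2 : ℝ)).re - 4 * (Ev h).re)
    (by norm_num) (fun y _ => fL_d1 y) (fun y _ => fL_d2 y) fL_b fL_inf (by norm_num) (by positivity) ?_
  · rwa [show 1 / 2 * (2 * h) = h by ring] at this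
  · have e : 2 * (Ev (h / 2 : ℝ)).re - 2 * (Ev h).re - 2 * (Ev h).re = 2 * (Ev (h / 2 : ℝ)).re - 4 * (Ev h).re := by ring
    rw [e] at hd
    refine hd.congr (fun N => Finset.sum_congr rfl (fun i _ => ?_))
    congr 2 <;> (push_cast; ring)

end S18

namespace S18

lemma P_bound : ∃ C, 0 < C ∧ ∀ t : ℝ, 0 < t → |(Ev t).re - π ^ 2 / 48 / t| ≤ C / √t := by
  obtain ⟨C, hC, h1⟩ := sF_bound 0
  refine ⟨2 * C, by positivity, fun t ht => ?_⟩
  have h := Ev_eq (z := t) (by simpa using ht)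
  obtain ⟨es, eb⟩ := err_sum ht
  have e : ((((Ev t).re - π ^ 2 / 48 / t : ℝ)) : ℂ) = Ev t - (π ^ 2 / 48 : ℝ) / (t : ℂ) := by
    push_cast; rw [← real_of_conj_Ev]
  rw [← Real.norm_eq_abs, ← Complex.norm_real, e, ← h.tsum_eq]
  refine (tsum_of_norm_bounded (es.mul_left C).hasSum (fun k => ?_)).trans ?_
  · have ek : 2 * ((k : ℂ) + 1) * t = ((2 * (k + 1) * t : ℝ) : ℂ) := by push_cast; ring
    rw [norm_mul, norm_div, norm_one, norm_mul, norm_k1, ek]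
    have := (h1 ((2 * (k + 1) * t : ℝ) : ℂ) (by rw [Complex.ofReal_re]; positivity) (by simp)).1
    rw [Complex.ofReal_re] at this
    simp only [Complex.norm_ofNat]
    calc _ ≤ 1 / (4 * ((k : ℝ) + 1)) * (C / (1 + 2 * ((k : ℝ) + 1) * t)) := by gcongr
      _ ≤ 1 / (1 * ((k : ℝ) + 1)) * (C / (1 + 1 * ((k : ℝ) + 1) * t)) := by
        gcongr <;> norm_num
      _ = _ := by ring
  · rw [tsum_mul_left]
    calc C * _ ≤ C * (2 / √t) := by gcongr
      _ = _ := by ring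

lemma fL_near {h : ℝ} (hh : 0 < h) : |fL h - Real.log 2| ≤ h := by
  have h1 : fL h ≤ Real.log 2 := by
    apply Real.log_le_log (by positivity)
    have : Real.exp (-h) ≤ 1 := Real.exp_le_one_iff.2 (by linarith)
    linarith
  have h2 : Real.log 2 - h ≤ fL h := by
    have : Real.log 2 - h = Real.log (2 * Real.exp (-h)) := by
      rw [Real.log_mul (by norm_num) (Real.exp_pos _).ne', Real.log_exp]; ring
    rw [this]
    apply Real.log_le_log (by positivity)
    have : Real.exp (-h) ≤ 1 := Real.exp_le_one_iff.2 (by linarith)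
    linarith
  rw [abs_le]; constructor <;> linarith

lemma Ev_asym {t : ℝ} (ht : 0 < t) (ht1 : t ≤ 1) :
    |(Ev t).re - π ^ 2 / 48 / t + Real.log 2 / 4| ≤ 7 * t := by
  set p : ℝ → ℝ := fun t => (Ev t).re - π ^ 2 / 48 / t + Real.log 2 / 4 with hp
  obtain ⟨C, hC, hP⟩ := P_bound
  have step : ∀ h, 0 < h → h ≤ 1 → |p h| ≤ 7 * h / 2 + |p (h / 2)| / 2 := by
    intro h hh hh1
    have h1 := Ev_rec hh
    have h2 := fL_near hh
    have e : p (h / 2) - 2 * p h = ((2 * (Ev (h / 2 : ℝ)).re - 4 * (Ev h).re) - 1 / 2 * fL h) / 2 + (fL h - Real.log 2) / 4 := by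
      simp only [hp]; field_simp; ring
    have e2 : |p (h / 2) - 2 * p h| ≤ 7 * h := by
      rw [e]
      refine (abs_add_le _ _).trans ?_
      rw [abs_div, abs_div, abs_of_pos (by norm_num : (0 : ℝ) < 2), abs_of_pos (by norm_num : (0 : ℝ) < 4)]
      nlinarith
    have e3 : 2 * |p h| ≤ |p (h / 2)| + |p (h / 2) - 2 * p h| := by
      have : 2 * p h = p (h / 2) - (p (h / 2) - 2 * p h) := by ring
      calc 2 * |p h| = |2 * p h| := by rw [abs_mul, abs_of_pos (by norm_num : (0 : ℝ) < 2)]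
        _ ≤ _ := by rw [this]; exact (abs_sub _ _).trans (by rw [← this])
    linarith
  have iter : ∀ n : ℕ, ∀ h, 0 < h → h ≤ 1 → |p h| ≤ 7 * h + |p (h / 2 ^ n)| / 2 ^ n := by
    intro n
    induction n with
    | zero => intro h hh _; simp; linarith
    | succ n ih =>
      intro h hh hh1
      have h1 := step h hh hh1
      have h2 := ih (h / 2) (by positivity) (by linarith)
      rw [show h / 2 / 2 ^ n = h / 2 ^ (n + 1) by rw [pow_succ]; field_simp] at h2
      have : |p (h / 2 ^ (n + 1))| / 2 ^ (n + 1) = |p (h / 2 ^ (n + 1))| / 2 ^ n / 2 := by rw [pow_succ]; field_simp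
      rw [this]; linarith
  have hlim : Tendsto (fun n : ℕ => 7 * t + (C / √t * (√2 / 2) ^ n + Real.log 2 / 4 * (1 / 2) ^ n)) atTop
      (nhds (7 * t + (C / √t * 0 + Real.log 2 / 4 * 0))) := by
    refine (((tendsto_pow_atTop_nhds_zero_of_lt_one (by positivity) ?_).const_mul _).add
      ((tendsto_pow_atTop_nhds_zero_of_lt_one (by norm_num) (by norm_num)).const_mul _)).const_add _
    have : √2 < 2 := by rw [Real.sqrt_lt' (by norm_num)]; norm_num
    linarith
  have := ge_of_tendsto hlim (Eventually.of_forall (fun n => ?_)) (b := |p t|)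
  · simpa using this
  · refine (iter n t ht ht1).trans ?_
    gcongr
    have hb := hP (t / 2 ^ n) (by positivity)
    have hl : 0 ≤ Real.log 2 / 4 := by have := Real.log_nonneg (by norm_num : (1 : ℝ) ≤ 2); positivity
    have h3 : |p (t / 2 ^ n)| ≤ C / √(t / 2 ^ n) + Real.log 2 / 4 := by
      refine (abs_add_le _ _).trans ?_
      rw [abs_of_nonneg hl]; linarith
    calc |p (t / 2 ^ n)| / 2 ^ n ≤ (C / √(t / 2 ^ n) + Real.log 2 / 4) / 2 ^ n := by gcongr
      _ = _ := by
        rw [Real.sqrt_div ht.le, Real.sqrt_eq_rpow (2 ^ n), ← Real.rpow_natCast, ← Real.rpow_mul (by norm_num),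
          mul_comm (n : ℝ), Real.rpow_mul (by norm_num), ← Real.sqrt_eq_rpow, Real.rpow_natCast, Real.rpow_natCast, div_pow, div_pow]
        field_simp
        rw [one_pow]; ring

end S18

namespace S18

noncomputable def F2 (x : ℝ) : ℝ := Real.log (1 + Real.exp (-x)) - Real.log (1 - Real.exp (-x))

lemma Od_log {t : ℝ} (ht : 0 < t) :
    HasSum (fun j : ℕ => F2 ((4 * j + 1) * t) - F2 ((4 * j + 3) * t)) (2 * (Od t).re) := by
  have hz : 0 < (t : ℂ).re := by simpa using ht
  have L1 := lam_sum hz (e := 1) (by norm_num)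
  have L2 := lam_sum hz (e := -1) (by norm_num)
  set q : ℝ := Real.exp (-t) with hq
  have hq0 : 0 < q := Real.exp_pos _
  have hq1 : q < 1 := by rw [hq, Real.exp_lt_one_iff]; linarith
  have eq : Complex.exp (-(t : ℂ)) = (q : ℝ) := by rw [hq]; push_cast; rfl
  have e1 : (1 : ℂ) * Complex.exp (-(t : ℂ)) = (q : ℝ) := by rw [eq, one_mul]
  have e2 : (-1 : ℂ) * Complex.exp (-(t : ℂ)) = ((-q : ℝ) : ℂ) := by rw [eq]; push_cast; ring
  have e3 : ((q : ℝ) : ℂ) ^ 4 = ((q ^ 4 : ℝ) : ℂ) := by push_cast; ring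
  have e4 : ((-q : ℝ) : ℂ) ^ 4 = ((q ^ 4 : ℝ) : ℂ) := by push_cast; ring
  have e5 : -((q : ℝ) : ℂ) ^ 3 = ((-q ^ 3 : ℝ) : ℂ) := by push_cast; ring
  have e6 : -((-q : ℝ) : ℂ) ^ 3 = ((q ^ 3 : ℝ) : ℂ) := by push_cast; ring
  rw [e1, e3, e5] at L1
  rw [e2, e4, e6] at L2
  have nn : ∀ m : ℕ, 0 < m → ‖((q ^ m : ℝ) : ℂ)‖ < 1 := by
    intro m hm
    rw [Complex.norm_real, Real.norm_of_nonneg (by positivity)]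
    exact pow_lt_one₀ hq0.le hq1 (by omega)
  have nX := nn 4 (by norm_num)
  have n1 : ‖(q : ℂ)‖ < 1 := by simpa using nn 1 (by norm_num)
  have n2 : ‖((-q : ℝ) : ℂ)‖ < 1 := by rw [Complex.ofReal_neg, norm_neg]; exact n1
  have n3 := nn 3 (by norm_num)
  have n4 : ‖((-q ^ 3 : ℝ) : ℂ)‖ < 1 := by rw [Complex.ofReal_neg, norm_neg]; exact n3
  obtain ⟨-, b1, c1⟩ := lam_aux n1 nX
  obtain ⟨-, b2, c2⟩ := lam_aux n2 nX
  obtain ⟨-, b3, c3⟩ := lam_aux n3 nX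
  obtain ⟨-, b4, c4⟩ := lam_aux n4 nX
  rw [c1, c4] at L1
  rw [c2, c3] at L2
  have hf : HasSum (fun j : ℕ => ((F2 ((4 * j + 1) * t) - F2 ((4 * j + 3) * t) : ℝ) : ℂ)) (2 * Od t) := by
    refine hs_congr ((b1.neg.hasSum.add b4.neg.hasSum).sub (b2.neg.hasSum.add b3.neg.hasSum)) (fun k => ?_) ?_
    · have hp1 : ∀ m : ℕ, 0 < m → q ^ m < 1 := fun m hm => pow_lt_one₀ hq0.le hq1 (by omega)
      have hp0 : ∀ m : ℕ, 0 < q ^ m := fun m => by positivity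
      have a1 := hp1 (4 * k + 1) (by omega)
      have a2 := hp0 (4 * k + 1)
      have a3 := hp1 (4 * k + 3) (by omega)
      have a4 := hp0 (4 * k + 3)
      rw [log_cast (x := 1 - q ^ (4 * k + 1)) (by linarith) k q (q ^ 4) (by ring),
        log_cast (x := 1 + q ^ (4 * k + 1)) (by linarith) k (-q) (q ^ 4) (by ring),
        log_cast (x := 1 - q ^ (4 * k + 3)) (by linarith) k (q ^ 3) (q ^ 4) (by ring),
        log_cast (x := 1 + q ^ (4 * k + 3)) (by linarith) k (-q ^ 3) (q ^ 4) (by ring)]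
      have p1 : Real.exp (-((4 * k + 1) * t)) = q ^ (4 * k + 1) := by
        rw [hq, ← Real.exp_nat_mul]; congr 1; push_cast; ring
      have p3 : Real.exp (-((4 * k + 3) * t)) = q ^ (4 * k + 3) := by
        rw [hq, ← Real.exp_nat_mul]; congr 1; push_cast; ring
      rw [F2, F2, p1, p3]
      push_cast; ring
    · rw [L1, L2]; ring
  rw [real_of_conj_Od t] at hf
  have : (2 : ℂ) * ((Od t).re : ℝ) = ((2 * (Od t).re : ℝ) : ℂ) := by push_cast; rfl
  rw [this] at hf
  exact Complex.hasSum_ofReal.1 hf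

noncomputable def rr (x : ℝ) : ℝ := F2 x - Real.log (x + 1) + Real.log x
noncomputable def rr1 (x : ℝ) : ℝ := -(Real.sinh x)⁻¹ - 1 / (x + 1) + x⁻¹
noncomputable def rr2 (x : ℝ) : ℝ := Real.cosh x / Real.sinh x ^ 2 + 1 / (x + 1) ^ 2 - 1 / x ^ 2

lemma rr_d1 (x : ℝ) (hx : 0 < x) : HasDerivAt rr (rr1 x) x := by
  have h0 : Real.exp (-x) < 1 := Real.exp_lt_one_iff.2 (by linarith)
  have hp := Real.exp_pos (-x)
  have h1 := ((hasDerivAt_neg x).exp.const_add 1).log (by positivity)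
  have h2 := ((hasDerivAt_neg x).exp.const_sub 1).log (by linarith)
  have h3 := ((hasDerivAt_id x).add_const 1).log (by simp; linarith)
  have h4 := Real.hasDerivAt_log hx.ne'
  refine (((h1.sub h2).sub h3).add h4).congr_deriv ?_
  rw [rr1, Real.sinh_eq]
  have hE : Real.exp x = (Real.exp (-x))⁻¹ := by rw [Real.exp_neg, inv_inv]
  rw [hE]
  set y := Real.exp (-x)
  have hy : (y⁻¹ - y) / 2 = (1 - y) * (1 + y) / (2 * y) := by field_simp; ring
  have hy1 : 1 - y ≠ 0 := by linarith
  rw [hy, inv_div]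
  simp only [id]
  have : 1 * -y = -y := by ring
  congr 2
  field_simp
  ring

lemma rr_d2 (x : ℝ) (hx : 0 < x) : HasDerivAt rr1 (rr2 x) x := by
  have hs : Real.sinh x ≠ 0 := (Real.sinh_pos_iff.2 hx).ne'
  have h1 := ((Real.hasDerivAt_sinh x).inv hs).neg
  have h2 := ((hasDerivAt_id x).add_const 1).inv (by simp; linarith)
  have h3 := (hasDerivAt_id x).inv hx.ne'
  have h := (h1.sub h2).add h3
  have hf : rr1 = fun x => -(Real.sinh x)⁻¹ - (x + 1)⁻¹ + x⁻¹ := by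
    funext x; rw [rr1, one_div]
  rw [hf]
  refine h.congr_deriv ?_
  rw [rr2]; simp only [id]; ring

lemma rr_b : ∃ C, 0 ≤ C ∧ ∀ x > 0, |rr2 x| ≤ C / (1 + x) ^ 2 := by
  obtain ⟨C, hC, h1⟩ := sF_bound 0
  refine ⟨C + 1, by positivity, fun x hx => ?_⟩
  have h2 := (h1 x (by simpa using hx) (by simp)).2
  rw [(hasDerivAt_sF x (by simpa using hx)).deriv, Complex.ofReal_re] at h2
  have e : (-Complex.cosh (x : ℂ) / Complex.sinh x ^ 2 + 1 / (x : ℂ) ^ 2) =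
    ((-(Real.cosh x / Real.sinh x ^ 2 - 1 / x ^ 2) : ℝ) : ℂ) := by push_cast; ring
  rw [e, Complex.norm_real, Real.norm_eq_abs, abs_neg] at h2
  have e2 : rr2 x = (Real.cosh x / Real.sinh x ^ 2 - 1 / x ^ 2) + 1 / (1 + x) ^ 2 := by
    rw [rr2]; ring
  rw [e2, add_div]
  refine (abs_add_le _ _).trans (add_le_add h2 ?_)
  rw [abs_of_nonneg (by positivity)]

lemma rr_inf : Tendsto rr atTop (nhds 0) := by
  have h1 := (exp_neg_tendsto.const_add 1).log (by norm_num)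
  have h2 := (exp_neg_tendsto.const_sub 1).log (by norm_num)
  have h3 := Real.tendsto_log_comp_add_sub_log 1
  have h := (h1.sub h2).sub h3
  simp at h
  refine h.congr (fun x => ?_)
  rw [rr, F2]; ring

lemma rr_near {x : ℝ} (hx : 0 < x) : |rr x - Real.log 2| ≤ 3 * x := by
  have h1 := fL_near hx
  have h2 : 0 ≤ Real.log (x + 1) := Real.log_nonneg (by linarith)
  have h3 : Real.log (x + 1) ≤ x := by
    have := Real.log_le_sub_one_of_pos (by linarith : 0 < x + 1); linarith
  have h0 : Real.exp (-x) < 1 := Real.exp_lt_one_iff.2 (by linarith)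
  have h4 : Real.log (1 - Real.exp (-x)) ≤ Real.log x := by
    apply Real.log_le_log (by linarith)
    have := Real.add_one_le_exp (-x); linarith
  have h5 : Real.log x - x ≤ Real.log (1 - Real.exp (-x)) := by
    have : Real.log x - x = Real.log (x * Real.exp (-x)) := by
      rw [Real.log_mul hx.ne' (Real.exp_pos _).ne', Real.log_exp]; ring
    rw [this]
    apply Real.log_le_log (by positivity)
    have h6 := Real.add_one_le_exp x
    have h7 : Real.exp (-x) * Real.exp x = 1 := by rw [← Real.exp_add]; simp
    nlinarith [Real.exp_pos (-x)]
  rw [abs_le] at h1 ⊢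
  rw [fL] at h1
  rw [rr, F2]
  constructor <;> linarith

noncomputable def LL (y : ℝ) : ℝ := Real.log (Real.Gamma (1 / 4)) + Real.log (Real.Gamma (3 / 4 + y)) -
  Real.log (Real.Gamma (3 / 4)) - Real.log (Real.Gamma (1 / 4 + y))

lemma Od_near : ∃ C : ℝ, 0 ≤ C ∧ ∀ t : ℝ, 0 < t → |2 * (Od t).re - LL (1 / (4 * t)) - 1 / 2 * rr t| ≤ C * ((4 * t) ^ 2 + 4 * t) := by
  obtain ⟨C, hC, hb⟩ := rr_b
  refine ⟨C, hC, fun t ht => ?_⟩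
  have key := halfsum (r := rr) (a := 1 / 4) (h := 4 * t) (S := 2 * (Od t).re - LL (1 / (4 * t))) hC rr_d1 rr_d2 hb rr_inf
    (by norm_num) (by positivity) ?_
  · rwa [show 1 / 4 * (4 * t) = t by ring] at key
  · have h1 := (Od_log ht).tendsto_sum_nat
    set y := 1 / (4 * t) with hy
    have hy0 : 0 < y := by positivity
    have h2 : Tendsto (fun N : ℕ => ∑ i ∈ Finset.range N, (Real.log (i + 1 / 4 + y) - Real.log (i + 1 / 4)
        - Real.log (i + 3 / 4 + y) + Real.log (i + 3 / 4))) atTop (nhds (LL y)) := by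
      rw [← tendsto_add_atTop_iff_nat 1]
      have g1 := Real.BohrMollerup.tendsto_log_gamma (x := 1 / 4) (by norm_num)
      have g2 := Real.BohrMollerup.tendsto_log_gamma (x := 3 / 4 + y) (by positivity)
      have g3 := Real.BohrMollerup.tendsto_log_gamma (x := 3 / 4) (by norm_num)
      have g4 := Real.BohrMollerup.tendsto_log_gamma (x := 1 / 4 + y) (by positivity)
      refine (((g1.add g2).sub g3).sub g4).congr (fun N => ?_)
      simp only [Real.BohrMollerup.logGammaSeq, Finset.sum_add_distrib, Finset.sum_sub_distrib]
      have c1 : ∀ c : ℝ, ∑ x ∈ Finset.range (N + 1), Real.log ((x : ℝ) + c) = ∑ x ∈ Finset.range (N + 1), Real.log (c + x) := by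
        intro c; simp only [add_comm c]
      have c2 : ∀ c : ℝ, ∑ x ∈ Finset.range (N + 1), Real.log ((x : ℝ) + c + y) = ∑ x ∈ Finset.range (N + 1), Real.log (c + y + x) := by
        intro c; refine Finset.sum_congr rfl (fun i _ => ?_); congr 1; ring
      rw [c1, c1, c2, c2]
      ring
    refine (h1.sub h2).congr (fun N => ?_)
    rw [← Finset.sum_sub_distrib]
    refine Finset.sum_congr rfl (fun i _ => ?_)
    have hi : (0 : ℝ) ≤ i := Nat.cast_nonneg i
    have r1 : ∀ c : ℝ, 0 < c → rr ((i + c) * (4 * t)) = F2 ((i + c) * (4 * t)) - (Real.log (i + c + y) - Real.log (i + c)) := by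
      intro c hc
      have : (i + c) * (4 * t) + 1 = (i + c + y) * (4 * t) := by rw [hy]; field_simp
      rw [rr, this, Real.log_mul (x := i + c + y) (y := 4 * t) (by positivity) (by positivity),
        Real.log_mul (x := i + c) (y := 4 * t) (by positivity) (by positivity)]
      ring
    rw [show (i : ℝ) + 1 / 4 + 1 / 2 = i + 3 / 4 by ring, r1 _ (by norm_num), r1 _ (by norm_num)]
    rw [show ((i : ℝ) + 1 / 4) * (4 * t) = (4 * i + 1) * t by ring, show ((i : ℝ) + 3 / 4) * (4 * t) = (4 * i + 3) * t by ring]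
    ring

lemma gamma_half {x : ℝ} (hx : 0 < x) :
    Real.log (Real.Gamma (x + 1 / 2)) - Real.log (Real.Gamma x) - 1 / 2 * Real.log x ≤ 0 ∧
    1 / 2 * Real.log x - 1 / 2 * Real.log (x + 1 / 2) ≤
      Real.log (Real.Gamma (x + 1 / 2)) - Real.log (Real.Gamma x) - 1 / 2 * Real.log x := by
  have hc := Real.convexOn_log_Gamma.2
  have a1 := hc (show x ∈ Set.Ioi 0 from hx) (show x + 1 ∈ Set.Ioi 0 by simp; linarith)
    (by norm_num : (0 : ℝ) ≤ 1 / 2) (by norm_num : (0 : ℝ) ≤ 1 / 2) (by norm_num)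
  have a2 := hc (show x + 1 / 2 ∈ Set.Ioi 0 by simp; linarith) (show x + 1 / 2 + 1 ∈ Set.Ioi 0 by simp; linarith)
    (by norm_num : (0 : ℝ) ≤ 1 / 2) (by norm_num : (0 : ℝ) ≤ 1 / 2) (by norm_num)
  simp only [Function.comp, smul_eq_mul] at a1 a2
  rw [show 1 / 2 * x + 1 / 2 * (x + 1) = x + 1 / 2 by ring, Real.Gamma_add_one hx.ne',
    Real.log_mul hx.ne' (Real.Gamma_pos_of_pos hx).ne'] at a1
  rw [show 1 / 2 * (x + 1 / 2) + 1 / 2 * (x + 1 / 2 + 1) = x + 1 by ring, Real.Gamma_add_one hx.ne',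
    Real.log_mul hx.ne' (Real.Gamma_pos_of_pos hx).ne', Real.Gamma_add_one (by positivity),
    Real.log_mul (by positivity) (Real.Gamma_pos_of_pos (by positivity)).ne'] at a2
  constructor <;> linarith

lemma Od_asym : Tendsto (fun t : ℝ => 2 * (Od t).re + 1 / 2 * Real.log (4 * t)) (nhdsWithin 0 (Set.Ioi 0))
    (nhds (1 / 2 * Real.log 2 + Real.log (Real.Gamma (1 / 4)) - Real.log (Real.Gamma (3 / 4)))) := by
  obtain ⟨C, hC, h⟩ := Od_near
  have hid : Tendsto (fun t : ℝ => t) (nhdsWithin 0 (Set.Ioi 0)) (nhds 0) := nhdsWithin_le_nhds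
  have t1 : Tendsto (fun t : ℝ => 2 * (Od t).re - LL (1 / (4 * t)) - 1 / 2 * rr t) (nhdsWithin 0 (Set.Ioi 0)) (nhds 0) := by
    apply squeeze_zero_norm' (a := fun t => C * ((4 * t) ^ 2 + 4 * t))
    · filter_upwards [self_mem_nhdsWithin] with t ht
      exact h t ht
    · have := ((((hid.const_mul 4).pow 2).add (hid.const_mul 4)).const_mul C)
      simpa using this
  have t2 : Tendsto (fun t : ℝ => rr t - Real.log 2) (nhdsWithin 0 (Set.Ioi 0)) (nhds 0) := by
    apply squeeze_zero_norm' (a := fun t => 3 * t)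
    · filter_upwards [self_mem_nhdsWithin] with t ht
      exact rr_near ht
    · simpa using hid.const_mul 3
  have hy : Tendsto (fun t : ℝ => 1 / (4 * t)) (nhdsWithin 0 (Set.Ioi 0)) atTop := by
    have := tendsto_inv_nhdsGT_zero (𝕜 := ℝ)
    refine (this.const_mul_atTop (by norm_num : (0 : ℝ) < 1 / 4)).congr (fun t => ?_)
    rw [one_div_mul_eq_div, one_div, mul_inv]; ring
  have t3 : Tendsto (fun y : ℝ => LL y - 1 / 2 * Real.log y) atTop
      (nhds (Real.log (Real.Gamma (1 / 4)) - Real.log (Real.Gamma (3 / 4)))) := by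
    have s1 : Tendsto (fun x : ℝ => Real.log (Real.Gamma (x + 1 / 2)) - Real.log (Real.Gamma x) - 1 / 2 * Real.log x) atTop (nhds 0) := by
      refine tendsto_of_tendsto_of_tendsto_of_le_of_le' (g := fun x => 1 / 2 * Real.log x - 1 / 2 * Real.log (x + 1 / 2)) (h := fun _ => 0) ?_ tendsto_const_nhds ?_ ?_
      · have := (Real.tendsto_log_comp_add_sub_log (1 / 2)).const_mul (-1 / 2)
        simp only [mul_zero] at this
        exact this.congr (fun x => by ring)
      · filter_upwards [eventually_gt_atTop 0] with x hx using (gamma_half hx).2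
      · filter_upwards [eventually_gt_atTop 0] with x hx using (gamma_half hx).1
    have s2 := s1.comp (tendsto_atTop_add_const_left atTop (1 / 4 : ℝ) tendsto_id)
    have s3 := (Real.tendsto_log_comp_add_sub_log (1 / 4)).const_mul (1 / 2)
    have s := (s2.add s3).const_add (Real.log (Real.Gamma (1 / 4)) - Real.log (Real.Gamma (3 / 4)))
    simp only [mul_zero, add_zero] at s
    refine s.congr (fun y => ?_)
    simp only [Function.comp, id, LL]
    rw [show 1 / 4 + y + 1 / 2 = 3 / 4 + y by ring, add_comm y (1 / 4)]
    ring
  have t4 := t3.comp hy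
  have := (t1.add (t2.const_mul (1 / 2))).add (t4.add_const (1 / 2 * Real.log 2))
  refine (this.congr' ?_).trans (le_of_eq ?_)
  · filter_upwards [self_mem_nhdsWithin] with t ht
    have ht' : 0 < t := ht
    simp only [Function.comp, one_div (4 * t), Real.log_inv]
    ring
  · congr 1; ring

end S18

namespace S18

lemma Ev_cont {t : ℝ} (ht : 0 < t) : Continuous (fun θ : ℝ => Ev (t + θ * Complex.I)) := by
  unfold Ev
  refine continuous_tsum (u := fun k : ℕ => 1 / (8 * ((k : ℝ) + 1) ^ 2 * t)) (fun k => ?_) (EvB_hasSum t).summable (fun k θ => ?_)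
  · unfold EvT
    refine continuous_const.div (by fun_prop) (fun θ => ?_)
    have hk : ((k : ℂ) + 1) ≠ 0 := by exact_mod_cast Nat.succ_ne_zero k
    refine mul_ne_zero (mul_ne_zero (by norm_num) hk) (sinh_ne _ ?_)
    simp; positivity
  · have := EvT_norm (z := t + θ * Complex.I) (by simpa using ht) k
    simpa using this

lemma Od_cont {t : ℝ} (ht : 0 < t) : Continuous (fun θ : ℝ => Od (t + θ * Complex.I)) := by
  unfold Od
  refine continuous_tsum (u := fun k : ℕ => 1 / (2 * (2 * (k : ℝ) + 1) ^ 2 * t)) (fun k => ?_) (OdB_hasSum t).summable (fun k θ => ?_)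
  · unfold OdT
    refine continuous_const.div (by fun_prop) (fun θ => ?_)
    have hk : (2 * (k : ℂ) + 1) ≠ 0 := by
      have : (2 * (k : ℂ) + 1) = ((2 * k + 1 : ℕ) : ℂ) := by push_cast; ring
      rw [this]; exact Nat.cast_ne_zero.2 (by omega)
    refine mul_ne_zero (mul_ne_zero (by norm_num) hk) (cosh_ne _ ?_)
    simp; positivity
  · have := OdT_norm (z := t + θ * Complex.I) (by simpa using ht) k
    simpa using this

lemma exp_int_zero (t : ℝ) (n m : ℕ) (h : n ≠ m) (he : Even (m + n)) :
    ∫ θ in -(π / 2)..(π / 2), Complex.exp (((n : ℂ) - m) * (t + θ * Complex.I)) = 0 := by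
  have hne : ((n : ℂ) - m) ≠ 0 := by
    rw [sub_ne_zero]; exact_mod_cast h
  have e : ∀ θ : ℝ, Complex.exp (((n : ℂ) - m) * (t + θ * Complex.I)) =
      Complex.exp (((n : ℂ) - m) * t) * Complex.exp ((((n : ℂ) - m) * Complex.I) * θ) := by
    intro θ; rw [← Complex.exp_add]; congr 1; ring
  simp_rw [e]
  rw [intervalIntegral.integral_const_mul, integral_exp_mul_complex (mul_ne_zero hne Complex.I_ne_zero)]
  obtain ⟨j, hj⟩ := he
  have : Complex.exp ((((n : ℂ) - m) * Complex.I) * ((π / 2 : ℝ) : ℂ)) =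
      Complex.exp ((((n : ℂ) - m) * Complex.I) * ((-(π / 2) : ℝ) : ℂ)) := by
    rw [Complex.exp_eq_exp_iff_exists_int]
    refine ⟨(j : ℤ) - m, ?_⟩
    have hn : (n : ℂ) = j + j - m := by
      have : ((m + n : ℕ) : ℂ) = ((j + j : ℕ) : ℂ) := by rw [hj]
      push_cast at this; linear_combination this
    rw [hn]; push_cast; ring
  rw [this, sub_self, zero_div, mul_zero]

lemma cauchy (g : ℕ → ℝ)
    (hg : ∀ q : ℂ, ‖q‖ < 1 →
      ∑' n : ℕ, (g n : ℂ) * q ^ n =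
        1 / ((∏' k : ℕ, (1 - q * (q ^ 4) ^ k)) *
              (∏' k : ℕ, (1 - (-q ^ 3) * (q ^ 4) ^ k)))) (n : ℕ) {t : ℝ} (ht : 0 < t) :
    (2 * π * g n : ℂ) = ∫ θ in -(π / 2)..(π / 2),
      (Complex.exp (Ev (t + θ * Complex.I) + Od (t + θ * Complex.I)) +
        (-1) ^ n * Complex.exp (Ev (t + θ * Complex.I) - Od (t + θ * Complex.I))) * Complex.exp (n * (t + θ * Complex.I)) := by
  have hq : ∀ (e : ℂ), e ^ 2 = 1 → ∀ z : ℂ, 0 < z.re → HasSum (fun m : ℕ => (g m : ℂ) * (e * Complex.exp (-z)) ^ m)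
      (Complex.exp (Ev z + e * Od z)) := by
    intro e he z hz
    have hn : ‖e‖ = 1 := by
      have : ‖e‖ ^ 2 = 1 := by rw [← norm_pow, he]; simp
      nlinarith [norm_nonneg e]
    have h1 := hg (e * Complex.exp (-z)) (by rw [norm_mul, hn, one_mul]; exact q_norm hz)
    rw [G_eq hz he] at h1
    have hs : Summable (fun m : ℕ => (g m : ℂ) * (e * Complex.exp (-z)) ^ m) := by
      by_contra hc
      rw [tsum_eq_zero_of_not_summable hc] at h1
      exact Complex.exp_ne_zero _ h1.symm
    rw [← h1]; exact hs.hasSum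
  have hsum : Summable (fun m : ℕ => 2 * (|g m| * Real.exp (-t) ^ m) * Real.exp (n * t)) := by
    have := (hq 1 (by norm_num) t (by simpa using ht)).summable.norm
    have h2 : Summable (fun m : ℕ => |g m| * Real.exp (-t) ^ m) := by
      refine this.congr (fun m => ?_)
      rw [norm_mul, norm_pow, one_mul, Complex.norm_exp, Complex.norm_real, Real.norm_eq_abs]
      simp
    exact (h2.mul_left 2).mul_right _
  have key := intervalIntegral.hasSum_integral_of_dominated_convergence (μ := MeasureTheory.volume)
    (a := -(π / 2)) (b := π / 2)
    (F := fun (m : ℕ) (θ : ℝ) => (g m : ℂ) * (1 + (-1) ^ (m + n)) * Complex.exp (((n : ℂ) - m) * (t + θ * Complex.I)))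
    (f := fun θ : ℝ => (Complex.exp (Ev (t + θ * Complex.I) + Od (t + θ * Complex.I)) +
        (-1) ^ n * Complex.exp (Ev (t + θ * Complex.I) - Od (t + θ * Complex.I))) * Complex.exp (n * (t + θ * Complex.I)))
    (fun m _ => 2 * (|g m| * Real.exp (-t) ^ m) * Real.exp (n * t))
    (fun m => Continuous.aestronglyMeasurable (by fun_prop))
    (fun m => Eventually.of_forall (fun θ _ => ?_))
    (Eventually.of_forall (fun θ _ => hsum)) (by simp)
    (Eventually.of_forall (fun θ _ => ?_))
  · have hz : ∀ m, m ≠ n → ∫ θ in -(π / 2)..(π / 2), (g m : ℂ) * (1 + (-1) ^ (m + n)) * Complex.exp (((n : ℂ) - m) * (t + θ * Complex.I)) = 0 := by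
      intro m hm
      rcases Nat.even_or_odd (m + n) with h | h
      · rw [intervalIntegral.integral_const_mul, exp_int_zero t n m (Ne.symm hm) h, mul_zero]
      · rw [h.neg_one_pow]; simp
    have h2 := hasSum_single (f := fun m => ∫ θ in -(π / 2)..(π / 2), (g m : ℂ) * (1 + (-1) ^ (m + n)) * Complex.exp (((n : ℂ) - m) * (t + θ * Complex.I))) n (fun m hm => hz m hm)
    rw [← h2.unique key]
    have : ((-1 : ℂ)) ^ (n + n) = 1 := by rw [← two_mul, pow_mul]; simp
    simp only [this, sub_self, zero_mul, Complex.exp_zero, mul_one, intervalIntegral.integral_const]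
    rw [show π / 2 - -(π / 2) = π by ring, Complex.real_smul]
    ring
  · rw [norm_mul, norm_mul, Complex.norm_exp, Complex.norm_real, Real.norm_eq_abs]
    have e1 : ‖(1 : ℂ) + (-1) ^ (m + n)‖ ≤ 2 := by
      refine (norm_add_le _ _).trans ?_
      simp; norm_num
    have e2 : (((n : ℂ) - m) * (t + θ * Complex.I)).re = m * (-t) + n * t := by
      simp; ring
    rw [e2, Real.exp_add, Real.exp_nat_mul]
    calc |g m| * ‖(1 : ℂ) + (-1) ^ (m + n)‖ * (Real.exp (-t) ^ m * Real.exp (n * t)) ≤ |g m| * 2 * (Real.exp (-t) ^ m * Real.exp (n * t)) := by gcongr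
      _ = _ := by ring
  · have hz : 0 < ((t : ℂ) + θ * Complex.I).re := by simpa using ht
    have a1 := hq 1 (by norm_num) _ hz
    have a2 := hq (-1) (by norm_num) _ hz
    refine hs_congr ((a1.add (a2.mul_left ((-1) ^ n))).mul_right (Complex.exp (n * (t + θ * Complex.I)))) (fun m => ?_) ?_
    · rw [sub_mul, sub_eq_add_neg, Complex.exp_add, mul_pow, mul_pow, ← Complex.exp_nat_mul,
        show -((m : ℂ) * (t + θ * Complex.I)) = m * (-(t + θ * Complex.I)) by ring, pow_add]
      ring
    · rw [one_mul, neg_one_mul, ← sub_eq_add_neg]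

end S18

namespace S18

/-- exponent -/
noncomputable def Xp (s t θ : ℝ) : ℂ :=
  Ev (t + θ * Complex.I) + s * Od (t + θ * Complex.I) + (π ^ 2 / 48 / t ^ 2 : ℝ) * (θ * Complex.I) - (Ev t + Od t)

lemma main_D : ∃ C, 0 < C ∧ ∀ s t θ : ℝ, (s = 1 ∨ s = -1) → 0 < t → |θ| ≤ 1000 * t →
    ‖Xp s t θ - (s - 1) * Od t + (π ^ 2 / 48 : ℝ) * θ ^ 2 / (t ^ 2 * (t + θ * Complex.I))‖ ≤ C * (|θ| / t) := by
  obtain ⟨C, hC, h⟩ := lip_main 1000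
  refine ⟨2 * C, by positivity, fun s t θ hs ht hθ => ?_⟩
  obtain ⟨h1, h2⟩ := h t θ ht hθ
  have hz : (t : ℂ) + θ * Complex.I ≠ 0 := by
    intro h; have := congrArg Complex.re h; simp at this; linarith
  have ht0 : (t : ℂ) ≠ 0 := by exact_mod_cast ht.ne'
  have hsn : ‖(s : ℂ)‖ = 1 := by rcases hs with h | h <;> simp [h]
  have e : Xp s t θ - (s - 1) * Od t + (π ^ 2 / 48 : ℝ) * θ ^ 2 / (t ^ 2 * (t + θ * Complex.I)) =
    ((Ev (t + θ * Complex.I) - (π ^ 2 / 48 : ℝ) / (t + θ * Complex.I)) - (Ev t - (π ^ 2 / 48 : ℝ) / t)) +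
      s * (Od (t + θ * Complex.I) - Od t) := by
    have : ((π ^ 2 / 48 / t ^ 2 : ℝ) : ℂ) * (θ * Complex.I) + (π ^ 2 / 48 : ℝ) * θ ^ 2 / (t ^ 2 * (t + θ * Complex.I)) =
       - ((π ^ 2 / 48 : ℝ) / (t + θ * Complex.I)) + (π ^ 2 / 48 : ℝ) / t := by
      rw [Complex.ofReal_div (π ^ 2 / 48)]
      generalize ((π ^ 2 / 48 : ℝ) : ℂ) = a
      push_cast
      field_simp
      linear_combination (a * θ ^ 2) * Complex.I_sq
    rw [Xp]
    linear_combination this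
  rw [e]
  refine (norm_add_le _ _).trans ?_
  rw [norm_mul, hsn]
  linarith

lemma quot_re {t θ : ℝ} (ht : 0 < t) :
    ((π ^ 2 / 48 : ℝ) * (θ : ℂ) ^ 2 / (t ^ 2 * (t + θ * Complex.I))).re = π ^ 2 / 48 * θ ^ 2 / (t * (t ^ 2 + θ ^ 2)) := by
  have e : (π ^ 2 / 48 : ℝ) * (θ : ℂ) ^ 2 / (t ^ 2 * (t + θ * Complex.I)) =
    ((π ^ 2 / 48 * θ ^ 2 / t ^ 2 : ℝ) : ℂ) * ((t : ℂ) + θ * Complex.I)⁻¹ := by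
    push_cast; field_simp
  rw [e, Complex.re_ofReal_mul, Complex.inv_re]
  have hns : Complex.normSq ((t : ℂ) + θ * Complex.I) = t ^ 2 + θ ^ 2 := by simp [Complex.normSq_apply]; ring
  rw [hns]
  simp
  have : t ^ 2 + θ ^ 2 ≠ 0 := by positivity
  field_simp

lemma Od_inf : Tendsto (fun t : ℝ => (Od t).re) (nhdsWithin 0 (Set.Ioi 0)) atTop := by
  have h1 := Od_asym
  have h2 : Tendsto (fun t : ℝ => -(1 / 2 * Real.log (4 * t))) (nhdsWithin 0 (Set.Ioi 0)) atTop := by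
    have hz : Tendsto (fun t : ℝ => 4 * t) (nhdsWithin 0 (Set.Ioi 0)) (nhdsWithin 0 (Set.Ioi 0)) := by
      refine tendsto_nhdsWithin_iff.2 ⟨?_, ?_⟩
      · have : Tendsto (fun t : ℝ => 4 * t) (nhds 0) (nhds (4 * 0)) := tendsto_id.const_mul 4
        rw [mul_zero] at this
        exact this.mono_left nhdsWithin_le_nhds
      · filter_upwards [self_mem_nhdsWithin] with t ht
        have : (0 : ℝ) < t := ht
        show 0 < 4 * t
        linarith
    have := (Real.tendsto_log_nhdsGT_zero.comp hz).const_mul_atBot (by norm_num : (0 : ℝ) < 1 / 2)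
    exact tendsto_neg_atBot_atTop.comp this
  have h3 := (h1.add_atTop h2).const_mul_atTop (by norm_num : (0 : ℝ) < 1 / 2)
  exact h3.congr (fun t => by ring)

lemma major_bound : ∃ B c, 0 < B ∧ 0 < c ∧ ∀ s t u : ℝ, (s = 1 ∨ s = -1) → 0 < t → 0 ≤ (Od t).re → |t * √t * u| ≤ 1000 * t →
    ‖Complex.exp (Xp s t (t * √t * u))‖ ≤ B * Real.exp (-c * u ^ 2) * Real.exp ((s - 1) * (Od t).re) := by
  obtain ⟨C, hC, h⟩ := main_D
  refine ⟨Real.exp (C * 1000), π ^ 2 / 48 / (1 + 1000 ^ 2), Real.exp_pos _, by positivity, fun s t u hs ht hO hu => ?_⟩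
  set θ := t * √t * u with hθ
  have h1 := (Complex.re_le_norm _).trans (h s t θ hs ht hu)
  rw [Complex.add_re, quot_re ht, Complex.sub_re] at h1
  have e1 : (((s : ℂ) - 1) * Od t).re = (s - 1) * (Od t).re := by
    rw [← Complex.ofReal_one, ← Complex.ofReal_sub, Complex.re_ofReal_mul]
  rw [e1] at h1
  have h2 : C * (|θ| / t) ≤ C * 1000 := by
    gcongr; rw [div_le_iff₀ ht]; exact hu
  have hsq : √t * √t = t := Real.mul_self_sqrt ht.le
  have hθ2 : θ ^ 2 = t ^ 3 * u ^ 2 := by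
    rw [hθ]; calc (t * √t * u) ^ 2 = t ^ 2 * (√t * √t) * u ^ 2 := by ring
      _ = _ := by rw [hsq]; ring
  have h3 : π ^ 2 / 48 / (1 + 1000 ^ 2) * u ^ 2 ≤ π ^ 2 / 48 * θ ^ 2 / (t * (t ^ 2 + θ ^ 2)) := by
    have h4 : θ ^ 2 ≤ 1000 ^ 2 * t ^ 2 := by
      rw [← sq_abs, ← mul_pow]; gcongr
    rw [le_div_iff₀ (by positivity)]
    calc π ^ 2 / 48 / (1 + 1000 ^ 2) * u ^ 2 * (t * (t ^ 2 + θ ^ 2)) ≤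
        π ^ 2 / 48 / (1 + 1000 ^ 2) * u ^ 2 * (t * (t ^ 2 + 1000 ^ 2 * t ^ 2)) := by gcongr
      _ = _ := by rw [hθ2]; field_simp
  rw [Complex.norm_exp, ← Real.exp_add, ← Real.exp_add]
  apply Real.exp_le_exp.2
  linarith

lemma minor_bound : ∃ t0 > 0, ∀ s t θ : ℝ, (s = 1 ∨ s = -1) → 0 < t → t < t0 → t ≤ 1 → 0 ≤ (Od t).re → 1000 * t ≤ |θ| → |θ| ≤ π / 2 →
    ‖Complex.exp (Xp s t θ)‖ ≤ Real.exp 8 * Real.exp (-(1 / 2000 / t)) := by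
  obtain ⟨t0, h0, h⟩ := minor
  refine ⟨t0, h0, fun s t θ hs ht htt ht1 hO h1 h2 => ?_⟩
  have h3 := h t θ s ht htt hs h1 h2
  have h4 := (abs_le.1 (Ev_asym ht ht1)).1
  have hl : Real.log 2 ≤ 1 := by
    have := Real.log_le_sub_one_of_pos (by norm_num : (0 : ℝ) < 2); linarith
  rw [Complex.norm_exp, ← Real.exp_add]
  apply Real.exp_le_exp.2
  rw [Xp, Complex.sub_re, Complex.add_re, Complex.re_ofReal_mul, Complex.add_re (Ev t)]
  have : ((θ : ℂ) * Complex.I).re = 0 := by simp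
  rw [this, mul_zero, add_zero]
  rw [sub_div] at h3
  linarith

noncomputable def Psi (s t u : ℝ) : ℂ :=
  Set.indicator {u : ℝ | |t * √t * u| ≤ π / 2} (fun u => Complex.exp (Xp s t (t * √t * u))) u

lemma Psi_meas (s : ℝ) {t : ℝ} (ht : 0 < t) : MeasureTheory.AEStronglyMeasurable (Psi s t) MeasureTheory.volume := by
  have hc : Continuous (fun u : ℝ => t * √t * u) := by fun_prop
  have h1 := (Ev_cont ht).comp hc
  have h2 := (Od_cont ht).comp hc
  apply MeasureTheory.AEStronglyMeasurable.indicator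
  · apply Continuous.aestronglyMeasurable
    apply Complex.continuous_exp.comp
    unfold Xp
    apply Continuous.sub _ continuous_const
    apply Continuous.add
    · exact h1.add (continuous_const.mul h2)
    · fun_prop
  · exact (isClosed_le (by fun_prop) continuous_const).measurableSet

lemma exp_cube {t : ℝ} (ht : 0 < t) (ht1 : t ≤ 1) {u : ℝ} (hu : |t * √t * u| ≤ π / 2) :
    Real.exp (-(1 / 2000 / t)) ≤ (24 * 2000 ^ 3) * (1 + u ^ 2)⁻¹ := by
  have hsq : √t * √t = t := Real.mul_self_sqrt ht.le
  have h1 : t ^ 3 * u ^ 2 ≤ 3 := by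
    have : t ^ 3 * u ^ 2 = |t * √t * u| ^ 2 := by
      rw [sq_abs]; calc t ^ 3 * u ^ 2 = t ^ 2 * t * u ^ 2 := by ring
        _ = t ^ 2 * (√t * √t) * u ^ 2 := by rw [hsq]
        _ = _ := by ring
    rw [this]
    calc |t * √t * u| ^ 2 ≤ (π / 2) ^ 2 := by gcongr
      _ ≤ 3 := by nlinarith [Real.pi_lt_d2, Real.pi_pos]
  have h2 : t ^ 3 * (1 + u ^ 2) ≤ 4 := by
    have : t ^ 3 ≤ 1 := pow_le_one₀ ht.le ht1
    linarith
  have h3 := Real.pow_div_factorial_le_exp (x := 1 / 2000 / t) (by positivity) 3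
  rw [Real.exp_neg, ← div_eq_mul_inv, inv_eq_one_div, div_le_div_iff₀ (Real.exp_pos _) (by positivity), one_mul]
  have h5 : (1 / 2000 / t) ^ 3 / (Nat.factorial 3 : ℝ) = 1 / (6 * 2000 ^ 3 * t ^ 3) := by
    simp [Nat.factorial]; field_simp
  rw [h5] at h3
  calc 1 + u ^ 2 ≤ 4 / t ^ 3 := by rw [le_div_iff₀ (by positivity)]; linarith
    _ = (24 * 2000 ^ 3) * (1 / (6 * 2000 ^ 3 * t ^ 3)) := by field_simp; norm_num
    _ ≤ _ := by gcongr

lemma Psi_bound : ∃ B1 c B2 : ℝ, 0 < c ∧ ∀ s : ℝ, (s = 1 ∨ s = -1) → ∀ᶠ t in nhdsWithin (0 : ℝ) (Set.Ioi 0), ∀ u,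
    ‖Psi s t u‖ ≤ B1 * Real.exp (-c * u ^ 2) + B2 * (1 + u ^ 2)⁻¹ := by
  obtain ⟨B, c, hB, hc, hM⟩ := major_bound
  obtain ⟨t0, ht0, hm⟩ := minor_bound
  refine ⟨B, c, Real.exp 8 * (24 * 2000 ^ 3), hc, fun s hs => ?_⟩
  filter_upwards [self_mem_nhdsWithin, nhdsWithin_le_nhds (Iio_mem_nhds ht0), nhdsWithin_le_nhds (Iio_mem_nhds one_pos),
    Od_inf.eventually_ge_atTop 0] with t ht htt ht1 hO u
  have ht' : 0 < t := ht
  have htt' : t < t0 := htt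
  have ht1' : t < 1 := ht1
  have p1 : 0 ≤ B * Real.exp (-c * u ^ 2) := by positivity
  have p2 : 0 ≤ Real.exp 8 * (24 * 2000 ^ 3) * (1 + u ^ 2)⁻¹ := by positivity
  by_cases hu : |t * √t * u| ≤ π / 2
  · rw [Psi, Set.indicator_of_mem (by exact hu)]
    rcases le_total (|t * √t * u|) (1000 * t) with h | h
    · refine (hM s t u hs ht' hO h).trans ?_
      have : Real.exp ((s - 1) * (Od t).re) ≤ 1 := by
        apply Real.exp_le_one_iff.2
        rcases hs with h | h <;> rw [h] <;> nlinarith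
      calc _ ≤ B * Real.exp (-c * u ^ 2) * 1 := by gcongr
        _ ≤ _ := by linarith
    · refine (hm s t _ hs ht' htt' ht1'.le hO h hu).trans ?_
      have := exp_cube ht' ht1'.le hu
      calc _ ≤ Real.exp 8 * ((24 * 2000 ^ 3) * (1 + u ^ 2)⁻¹) := by gcongr
        _ ≤ _ := by linarith
  · rw [Psi, Set.indicator_of_notMem (by exact hu), norm_zero]
    linarith

end S18

namespace S18

lemma near_ev (u : ℝ) : ∀ᶠ t in nhdsWithin (0 : ℝ) (Set.Ioi 0), 0 < t ∧ |t * √t * u| ≤ 1000 * t ∧ |t * √t * u| ≤ π / 2 := by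
  have hs : Tendsto (fun t : ℝ => √t) (nhdsWithin 0 (Set.Ioi 0)) (nhds 0) := by
    have : Tendsto (fun t : ℝ => √t) (nhds 0) (nhds √0) := Real.continuous_sqrt.tendsto 0
    rw [Real.sqrt_zero] at this
    exact this.mono_left nhdsWithin_le_nhds
  have h1 : Tendsto (fun t : ℝ => √t * |u|) (nhdsWithin 0 (Set.Ioi 0)) (nhds 0) := by
    simpa using hs.mul_const |u|
  filter_upwards [self_mem_nhdsWithin, nhdsWithin_le_nhds (Iio_mem_nhds one_pos), h1.eventually (Iio_mem_nhds one_pos)] with t ht ht1 h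
  have ht' : (0 : ℝ) < t := ht
  have ht1' : t < 1 := ht1
  have h' : √t * |u| < 1 := h
  have e : |t * √t * u| = t * (√t * |u|) := by
    rw [abs_mul, abs_mul, abs_of_pos ht', abs_of_nonneg (Real.sqrt_nonneg t)]; ring
  have h0 : 0 ≤ √t * |u| := by positivity
  refine ⟨ht', ?_, ?_⟩
  · rw [e]; nlinarith
  · rw [e]; nlinarith [Real.pi_gt_three]

lemma Psi_lim_neg (u : ℝ) : Tendsto (fun t => Psi (-1) t u) (nhdsWithin 0 (Set.Ioi 0)) (nhds 0) := by
  obtain ⟨B, c, hB, hc, hM⟩ := major_bound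
  apply squeeze_zero_norm' (a := fun t : ℝ => B * Real.exp (-c * u ^ 2) * Real.exp ((-1 - 1) * (Od t).re))
  · filter_upwards [near_ev u, Od_inf.eventually_ge_atTop 0] with t ⟨ht, h1, h2⟩ hO
    rw [Psi, Set.indicator_of_mem (by exact h2)]
    exact hM (-1) t u (Or.inr rfl) ht hO h1
  · have : Tendsto (fun t : ℝ => Real.exp ((-1 - 1) * (Od t).re)) (nhdsWithin 0 (Set.Ioi 0)) (nhds 0) :=
      Real.tendsto_exp_atBot.comp (Od_inf.const_mul_atTop_of_neg (by norm_num))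
    have h := this.const_mul (B * Real.exp (-c * u ^ 2))
    rw [mul_zero] at h
    exact h

lemma Psi_lim_pos (u : ℝ) : Tendsto (fun t => Psi 1 t u) (nhdsWithin 0 (Set.Ioi 0)) (nhds (Real.exp (-(π ^ 2 / 48) * u ^ 2) : ℝ)) := by
  obtain ⟨C, hC, hM⟩ := main_D
  have hs : Tendsto (fun t : ℝ => √t) (nhdsWithin 0 (Set.Ioi 0)) (nhds 0) := by
    have : Tendsto (fun t : ℝ => √t) (nhds 0) (nhds √0) := Real.continuous_sqrt.tendsto 0
    rw [Real.sqrt_zero] at this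
    exact this.mono_left nhdsWithin_le_nhds
  have h1 : Tendsto (fun t : ℝ => Xp 1 t (t * √t * u) + (π ^ 2 / 48 : ℝ) * u ^ 2 / (1 + (√t : ℝ) * u * Complex.I))
      (nhdsWithin 0 (Set.Ioi 0)) (nhds 0) := by
    apply squeeze_zero_norm' (a := fun t : ℝ => C * (√t * |u|))
    · filter_upwards [near_ev u] with t ⟨ht, h1, h2⟩
      have := hM 1 t (t * √t * u) (Or.inl rfl) ht h1
      have e : |t * √t * u| / t = √t * |u| := by
        rw [abs_mul, abs_mul, abs_of_pos ht, abs_of_nonneg (Real.sqrt_nonneg t)]; field_simp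
      rw [e] at this
      refine le_trans (le_of_eq ?_) this
      congr 1
      rw [Complex.ofReal_one, sub_self, zero_mul, sub_zero]
      congr 1
      have ht0 : (t : ℂ) ≠ 0 := by exact_mod_cast ht.ne'
      have hsq : ((√t : ℝ) : ℂ) ^ 2 = t := by
        rw [← Complex.ofReal_pow, Real.sq_sqrt ht.le]
      have hz : (1 : ℂ) + (√t : ℝ) * u * Complex.I ≠ 0 := by
        intro h; have := congrArg Complex.re h; simp at this
      have e2 : (t : ℂ) + ((t * √t * u : ℝ) : ℂ) * Complex.I = t * (1 + (√t : ℝ) * u * Complex.I) := by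
        push_cast; ring
      rw [e2]
      have e3 : ((t * √t * u : ℝ) : ℂ) ^ 2 = t ^ 3 * u ^ 2 := by
        push_cast; rw [mul_pow, mul_pow, hsq]; ring
      rw [e3]
      field_simp
    · simpa using (hs.mul_const |u|).const_mul C
  have h2 : Tendsto (fun t : ℝ => ((π ^ 2 / 48 : ℝ) : ℂ) * u ^ 2 / (1 + (√t : ℝ) * u * Complex.I))
      (nhdsWithin 0 (Set.Ioi 0)) (nhds (((π ^ 2 / 48 : ℝ) : ℂ) * u ^ 2 / (1 + ((0 : ℝ) : ℂ) * u * Complex.I))) := by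
    refine tendsto_const_nhds.div (tendsto_const_nhds.add ?_) (by simp)
    exact (((Complex.continuous_ofReal.tendsto 0).comp hs).mul_const _).mul_const _
  have h3 := (Complex.continuous_exp.tendsto _).comp (h1.sub h2)
  have e : (0 : ℂ) - ((π ^ 2 / 48 : ℝ) : ℂ) * u ^ 2 / (1 + ((0 : ℝ) : ℂ) * u * Complex.I) = ((-(π ^ 2 / 48) * u ^ 2 : ℝ) : ℂ) := by
    push_cast; simp
  rw [e, ← Complex.ofReal_exp] at h3
  refine h3.congr' ?_
  filter_upwards [near_ev u] with t ⟨ht, h1, h2⟩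
  rw [Psi, Set.indicator_of_mem (by exact h2)]
  simp only [Function.comp, add_sub_cancel_right]

lemma Psi_int_neg : Tendsto (fun t => ∫ u, Psi (-1) t u) (nhdsWithin 0 (Set.Ioi 0)) (nhds 0) := by
  obtain ⟨B1, c, B2, hc, h⟩ := Psi_bound
  have := MeasureTheory.tendsto_integral_filter_of_dominated_convergence (μ := MeasureTheory.volume)
    (F := fun t u => Psi (-1) t u) (f := fun _ => (0 : ℂ)) (l := nhdsWithin (0 : ℝ) (Set.Ioi 0))
    (fun u => B1 * Real.exp (-c * u ^ 2) + B2 * (1 + u ^ 2)⁻¹)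
    (by filter_upwards [self_mem_nhdsWithin] with t ht using Psi_meas _ ht)
    (by filter_upwards [h (-1) (Or.inr rfl)] with t ht using Eventually.of_forall ht)
    (((integrable_exp_neg_mul_sq hc).const_mul _).add (integrable_inv_one_add_sq.const_mul _))
    (Eventually.of_forall (fun u => Psi_lim_neg u))
  simpa using this

lemma Psi_int_pos : Tendsto (fun t => ∫ u, Psi 1 t u) (nhdsWithin 0 (Set.Ioi 0)) (nhds (√(π / (π ^ 2 / 48)) : ℝ)) := by
  obtain ⟨B1, c, B2, hc, h⟩ := Psi_bound
  have := MeasureTheory.tendsto_integral_filter_of_dominated_convergence (μ := MeasureTheory.volume)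
    (F := fun t u => Psi 1 t u) (f := fun u => ((Real.exp (-(π ^ 2 / 48) * u ^ 2) : ℝ) : ℂ)) (l := nhdsWithin (0 : ℝ) (Set.Ioi 0))
    (fun u => B1 * Real.exp (-c * u ^ 2) + B2 * (1 + u ^ 2)⁻¹)
    (by filter_upwards [self_mem_nhdsWithin] with t ht using Psi_meas _ ht)
    (by filter_upwards [h 1 (Or.inl rfl)] with t ht using Eventually.of_forall ht)
    (((integrable_exp_neg_mul_sq hc).const_mul _).add (integrable_inv_one_add_sq.const_mul _))
    (Eventually.of_forall (fun u => Psi_lim_pos u))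
  rwa [integral_complex_ofReal, integral_gaussian] at this

lemma Psi_int_eq (s : ℝ) {t : ℝ} (ht : 0 < t) :
    ∫ θ in -(π / 2)..(π / 2), Complex.exp (Xp s t θ) = (t * √t : ℝ) * ∫ u, Psi s t u := by
  have hc : 0 < t * √t := mul_pos ht (Real.sqrt_pos.2 ht)
  have h1 := MeasureTheory.Measure.integral_comp_mul_left
    (fun θ : ℝ => Set.indicator (Set.Icc (-(π / 2)) (π / 2)) (fun θ => Complex.exp (Xp s t θ)) θ) (t * √t)
  have h2 : ∀ u, Psi s t u = Set.indicator (Set.Icc (-(π / 2)) (π / 2)) (fun θ => Complex.exp (Xp s t θ)) (t * √t * u) := by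
    intro u
    by_cases hu : |t * √t * u| ≤ π / 2
    · rw [Psi, Set.indicator_of_mem (by exact hu), Set.indicator_of_mem (by exact abs_le.1 hu)]
    · have hu' : t * √t * u ∉ Set.Icc (-(π / 2)) (π / 2) := fun h => hu (abs_le.2 ⟨h.1, h.2⟩)
      rw [Psi, Set.indicator_of_notMem (by exact hu), Set.indicator_of_notMem hu']
  simp_rw [h2]
  rw [h1, MeasureTheory.integral_indicator measurableSet_Icc, MeasureTheory.integral_Icc_eq_integral_Ioc,
    ← intervalIntegral.integral_of_le (by linarith [Real.pi_pos]), abs_of_pos (inv_pos.2 hc), Complex.real_smul]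
  rw [← mul_assoc, ← Complex.ofReal_mul, mul_inv_cancel₀ hc.ne', Complex.ofReal_one, one_mul]

lemma Xp_cont (s : ℝ) {t : ℝ} (ht : 0 < t) : Continuous (fun θ : ℝ => Xp s t θ) := by
  have h1 := Ev_cont ht
  have h2 := Od_cont ht
  unfold Xp
  apply Continuous.sub _ continuous_const
  apply Continuous.add
  · exact h1.add (continuous_const.mul h2)
  · fun_prop

lemma g_formula (g : ℕ → ℝ)
    (hg : ∀ q : ℂ, ‖q‖ < 1 →
      ∑' n : ℕ, (g n : ℂ) * q ^ n =
        1 / ((∏' k : ℕ, (1 - q * (q ^ 4) ^ k)) *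
              (∏' k : ℕ, (1 - (-q ^ 3) * (q ^ 4) ^ k)))) (n : ℕ) {t : ℝ} (ht : 0 < t) (hn : (n : ℝ) = π ^ 2 / 48 / t ^ 2) :
    (2 * π * g n : ℂ) = (Real.exp (n * t + (Ev t).re + (Od t).re) * (t * √t) : ℝ) *
      ((∫ u, Psi 1 t u) + (-1) ^ n * ∫ u, Psi (-1) t u) := by
  rw [cauchy g hg n ht]
  have e : ∀ θ : ℝ, (Complex.exp (Ev (t + θ * Complex.I) + Od (t + θ * Complex.I)) +
        (-1) ^ n * Complex.exp (Ev (t + θ * Complex.I) - Od (t + θ * Complex.I))) * Complex.exp (n * (t + θ * Complex.I)) =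
      (Real.exp (n * t + (Ev t).re + (Od t).re) : ℝ) * (Complex.exp (Xp 1 t θ) + (-1) ^ n * Complex.exp (Xp (-1) t θ)) := by
    intro θ
    have hnc : (n : ℂ) = ((π ^ 2 / 48 / t ^ 2 : ℝ) : ℂ) := by rw [← hn]; simp
    have hx : ((Real.exp (n * t + (Ev t).re + (Od t).re) : ℝ) : ℂ) = Complex.exp (n * t + Ev t + Od t) := by
      rw [real_of_conj_Ev, real_of_conj_Od]; push_cast; simp
    rw [hx]
    have x1 : Complex.exp (Ev (t + θ * Complex.I) + Od (t + θ * Complex.I)) * Complex.exp (n * (t + θ * Complex.I)) =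
        Complex.exp (n * t + Ev t + Od t) * Complex.exp (Xp 1 t θ) := by
      rw [← Complex.exp_add, ← Complex.exp_add, Xp, ← hnc]
      congr 1; push_cast; ring
    have x2 : Complex.exp (Ev (t + θ * Complex.I) - Od (t + θ * Complex.I)) * Complex.exp (n * (t + θ * Complex.I)) =
        Complex.exp (n * t + Ev t + Od t) * Complex.exp (Xp (-1) t θ) := by
      rw [← Complex.exp_add, ← Complex.exp_add, Xp, ← hnc]
      congr 1; push_cast; ring
    linear_combination x1 + (-1) ^ n * x2
  simp_rw [e]
  have i1 := (Complex.continuous_exp.comp (Xp_cont 1 ht)).intervalIntegrable (μ := MeasureTheory.volume) (-(π / 2)) (π / 2)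
  have i2 := (Complex.continuous_exp.comp (Xp_cont (-1) ht)).intervalIntegrable (μ := MeasureTheory.volume) (-(π / 2)) (π / 2)
  simp only [Function.comp_def] at i1 i2
  rw [intervalIntegral.integral_const_mul, intervalIntegral.integral_add i1 (i2.const_mul _), intervalIntegral.integral_const_mul,
    Psi_int_eq 1 ht, Psi_int_eq (-1) ht]
  push_cast; ring

end S18

namespace S18

lemma beta_integrable {α β : ℝ} (hα : 0 < α) (hβ : 0 < β) :
    MeasureTheory.Integrable (ProbabilityTheory.betaPDFReal α β) ∧ ∫ y, ProbabilityTheory.betaPDFReal α β y = 1 := by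
  have h := ProbabilityTheory.lintegral_betaPDF_eq_one hα hβ
  have hn : ∀ y, 0 ≤ ProbabilityTheory.betaPDFReal α β y := by
    intro y
    by_cases hy : 0 < y ∧ y < 1
    · exact (ProbabilityTheory.betaPDFReal_pos hy.1 hy.2 hα hβ).le
    · rw [ProbabilityTheory.betaPDFReal, if_neg hy]
  have hm := ProbabilityTheory.stronglyMeasurable_betaPDFReal α β
  constructor
  · refine ⟨hm.aestronglyMeasurable, ?_⟩
    rw [MeasureTheory.hasFiniteIntegral_iff_ofReal (Eventually.of_forall hn)]
    have : ∫⁻ a, ENNReal.ofReal (ProbabilityTheory.betaPDFReal α β a) = 1 := h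
    rw [this]; exact ENNReal.one_lt_top
  · rw [MeasureTheory.integral_eq_lintegral_of_nonneg_ae (Eventually.of_forall hn) hm.aestronglyMeasurable]
    have : ∫⁻ a, ENNReal.ofReal (ProbabilityTheory.betaPDFReal α β a) = 1 := h
    rw [this]; rfl

lemma moment (m : ℕ) {a : ℝ} (ha : 0 < a) :
    MeasureTheory.IntegrableOn (fun t : ℝ => t ^ (2 * m) * (1 - t ^ 2) ^ (a - 1)) (Set.Ioo 0 1) ∧
    ∫ t in Set.Ioo (0 : ℝ) 1, t ^ (2 * m) * (1 - t ^ 2) ^ (a - 1) = ProbabilityTheory.beta (m + 1 / 2) a / 2 := by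
  have hm : (0 : ℝ) < m + 1 / 2 := by positivity
  set b := ProbabilityTheory.beta (m + 1 / 2) a with hb
  have hbp : 0 < b := ProbabilityTheory.beta_pos hm ha
  obtain ⟨h1, h2⟩ := beta_integrable hm ha
  set f := ProbabilityTheory.betaPDFReal (m + 1 / 2) a with hf
  have e : Set.EqOn (fun x : ℝ => (|2| * x ^ ((2 : ℝ) - 1)) • f (x ^ (2 : ℝ)))
      (Set.indicator (Set.Ioo (0 : ℝ) 1) (fun t => 2 / b * (t ^ (2 * m) * (1 - t ^ 2) ^ (a - 1)))) (Set.Ioi 0) := by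
    intro x hx
    have hx' : 0 < x := hx
    simp only [smul_eq_mul, hf, ProbabilityTheory.betaPDFReal, Real.rpow_two]
    by_cases h : x < 1
    · rw [if_pos ⟨by positivity, by nlinarith⟩, Set.indicator_of_mem (show x ∈ Set.Ioo (0 : ℝ) 1 from ⟨hx', h⟩), ← hb]
      have : (x ^ 2) ^ ((m : ℝ) + 1 / 2 - 1) * x = x ^ (2 * m) := by
        rw [← Real.rpow_natCast x 2, ← Real.rpow_mul hx'.le]
        nth_rewrite 2 [← Real.rpow_one x]
        rw [← Real.rpow_add hx', ← Real.rpow_natCast x (2 * m)]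
        congr 1; push_cast; ring
      rw [← this, abs_of_pos (by norm_num : (0 : ℝ) < 2)]
      norm_num
      ring
    · rw [if_neg (fun h' => h (by nlinarith [h'.2])), Set.indicator_of_notMem (show x ∉ Set.Ioo (0 : ℝ) 1 from fun h' => h h'.2), mul_zero]
  have i1 := (MeasureTheory.integrableOn_Ioi_comp_rpow_iff f (two_ne_zero)).2 h1.integrableOn
  have i2 := MeasureTheory.integral_comp_rpow_Ioi f (two_ne_zero (α := ℝ))
  rw [MeasureTheory.setIntegral_congr_fun measurableSet_Ioi e, MeasureTheory.setIntegral_indicator measurableSet_Ioo] at i2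
  rw [MeasureTheory.integrableOn_congr_fun e measurableSet_Ioi, MeasureTheory.IntegrableOn,
    MeasureTheory.integrable_indicator_iff measurableSet_Ioo] at i1
  have hs : Set.Ioi (0 : ℝ) ∩ Set.Ioo 0 1 = Set.Ioo 0 1 := by ext; simp
  have i3 : ∫ y in Set.Ioi (0 : ℝ), f y = 1 := by
    rw [← h2]
    apply MeasureTheory.setIntegral_eq_integral_of_forall_compl_eq_zero
    intro x hx
    rw [hf, ProbabilityTheory.betaPDFReal, if_neg (fun h => hx h.1)]
  rw [hs, i3, MeasureTheory.integral_const_mul] at i2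
  rw [MeasureTheory.IntegrableOn, MeasureTheory.Measure.restrict_restrict measurableSet_Ioo, Set.inter_comm, hs] at i1
  constructor
  · have := i1.const_mul (b / 2)
    refine this.congr (Eventually.of_forall (fun x => ?_))
    simp only; field_simp
  · field_simp at i2 ⊢
    linarith

lemma bessel_hasSum {s x : ℝ} (hs : -1 / 2 < s) (hx : 0 < x) :
    HasSum (fun m : ℕ => (x / 2) ^ ((2 * m : ℝ) + s) / (m.factorial * Real.Gamma (m + s + 1)))
      ((x / 2) ^ s / (√π * Real.Gamma (s + 1 / 2)) * 2 *
        ∫ t in Set.Ioo (0 : ℝ) 1, Real.cosh (x * t) * (1 - t ^ 2) ^ (s + 1 / 2 - 1)) := by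
  have ha : 0 < s + 1 / 2 := by linarith
  set a := s + 1 / 2 with hadef
  have hG := Real.Gamma_pos_of_pos ha
  set F : ℕ → ℝ → ℝ := fun m t => x ^ (2 * m) / (2 * m).factorial * (t ^ (2 * m) * (1 - t ^ 2) ^ (a - 1)) with hF
  have hpos : ∀ m, ∀ t ∈ Set.Ioo (0 : ℝ) 1, 0 ≤ F m t := by
    intro m t ht
    have : 0 ≤ 1 - t ^ 2 := by nlinarith [ht.1, ht.2]
    have h2 := Real.rpow_nonneg this (a - 1)
    have := ht.1.le
    simp only [hF]; positivity
  have hInt : ∀ m, MeasureTheory.Integrable (F m) (MeasureTheory.volume.restrict (Set.Ioo 0 1)) :=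
    fun m => (moment m ha).1.const_mul _
  have hval : ∀ m, ∫ t in Set.Ioo (0 : ℝ) 1, F m t = x ^ (2 * m) / (2 * m).factorial * (ProbabilityTheory.beta (m + 1 / 2) a / 2) := by
    intro m
    rw [← (moment m ha).2, ← MeasureTheory.integral_const_mul]
  have hnorm : ∀ m, ∫ t in Set.Ioo (0 : ℝ) 1, ‖F m t‖ = ∫ t in Set.Ioo (0 : ℝ) 1, F m t := by
    intro m
    exact MeasureTheory.setIntegral_congr_fun measurableSet_Ioo (fun t ht => Real.norm_of_nonneg (hpos m t ht))
  have hle : ∀ m, ∫ t in Set.Ioo (0 : ℝ) 1, F m t ≤ x ^ (2 * m) / (2 * m).factorial * (ProbabilityTheory.beta ((0 : ℕ) + 1 / 2) a / 2) := by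
    intro m
    rw [← (moment 0 ha).2, ← MeasureTheory.integral_const_mul]
    apply MeasureTheory.setIntegral_mono_on (hInt m) ((moment 0 ha).1.const_mul _) measurableSet_Ioo
    intro t ht
    have h0 : 0 ≤ 1 - t ^ 2 := by nlinarith [ht.1, ht.2]
    have h2 := Real.rpow_nonneg h0 (a - 1)
    have h3 : t ^ (2 * m) ≤ 1 := pow_le_one₀ ht.1.le ht.2.le
    simp only [hF]
    rw [mul_zero, pow_zero]
    gcongr
  have hsum : Summable (fun m => ∫ t in Set.Ioo (0 : ℝ) 1, ‖F m t‖) := by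
    simp_rw [hnorm]
    refine Summable.of_nonneg_of_le (fun m => MeasureTheory.setIntegral_nonneg measurableSet_Ioo (hpos m)) hle ?_
    exact (Real.hasSum_cosh x).summable.mul_right _
  have H := MeasureTheory.hasSum_integral_of_summable_integral_norm hInt hsum
  have e1 : ∫ t in Set.Ioo (0 : ℝ) 1, ∑' m, F m t = ∫ t in Set.Ioo (0 : ℝ) 1, Real.cosh (x * t) * (1 - t ^ 2) ^ (a - 1) := by
    congr 1; ext t
    rw [← ((Real.hasSum_cosh (x * t)).mul_right ((1 - t ^ 2) ^ (a - 1))).tsum_eq]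
    congr 1; ext m
    simp only [hF]; rw [mul_pow]; ring
  rw [e1] at H
  have H2 := H.mul_left ((x / 2) ^ s / (√π * Real.Gamma a) * 2)
  refine hs_congr H2 (fun m => ?_) rfl
  rw [hval, ProbabilityTheory.beta, Real.Gamma_nat_add_half]
  have e2 : (m : ℝ) + 1 / 2 + a = m + s + 1 := by rw [hadef]; ring
  rw [e2]
  have hx2 : 0 < x / 2 := by positivity
  have e3 : (x / 2) ^ ((2 * m : ℝ) + s) = (x / 2) ^ (2 * m) * (x / 2) ^ s := by
    rw [Real.rpow_add hx2, ← Real.rpow_natCast]; push_cast; rfl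
  have hG2 : 0 < Real.Gamma (m + s + 1) := Real.Gamma_pos_of_pos (by have : (0 : ℝ) ≤ m := by positivity
                                                                     linarith)
  have hf : ((2 * m).factorial : ℝ) = (2 * m - 1).doubleFactorial * (2 ^ m * m.factorial) := by
    rcases m with _ | k
    · simp
    · have h := Nat.factorial_eq_mul_doubleFactorial (2 * k + 1)
      have h2 := Nat.doubleFactorial_two_mul (k + 1)
      have : 2 * (k + 1) - 1 = 2 * k + 1 := by omega
      rw [this]
      rw [show 2 * k + 1 + 1 = 2 * (k + 1) by ring] at h
      rw [h2] at h
      rw [mul_comm (2 ^ (k + 1) * (k + 1).factorial)] at h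
      exact_mod_cast h
  have hdf : ((2 * m - 1).doubleFactorial : ℝ) ≠ 0 := by exact_mod_cast (Nat.doubleFactorial_pos _).ne'
  rw [e3, hf, div_pow, pow_mul 2 2 m]
  have h4 : ((2 : ℝ) ^ 2) ^ m = 2 ^ m * 2 ^ m := by rw [← mul_pow]; norm_num
  rw [h4]
  have hpi : √π ≠ 0 := (Real.sqrt_pos.2 Real.pi_pos).ne'
  field_simp

end S18

namespace S18

lemma K_scale {a x : ℝ} (hx : 0 < x) :
    ∫ t in Set.Ioo (0 : ℝ) 1, Real.cosh (x * t) * (1 - t ^ 2) ^ (a - 1) =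
    x⁻¹ * ∫ y, Set.indicator (Set.Ioo 0 x) (fun y => Real.cosh (x - y) * ((y / x) * (2 - y / x)) ^ (a - 1)) y := by
  rw [← MeasureTheory.integral_indicator measurableSet_Ioo]
  set k := Set.indicator (Set.Ioo (0 : ℝ) 1) (fun t => Real.cosh (x * t) * (1 - t ^ 2) ^ (a - 1)) with hk
  rw [← MeasureTheory.integral_sub_left_eq_self k MeasureTheory.volume 1]
  have h1 := MeasureTheory.Measure.integral_comp_mul_left (fun t => k (1 - t)) x⁻¹
  rw [inv_inv, abs_of_pos hx, smul_eq_mul] at h1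
  have e : ∀ y, k (1 - x⁻¹ * y) = Set.indicator (Set.Ioo 0 x) (fun y => Real.cosh (x - y) * ((y / x) * (2 - y / x)) ^ (a - 1)) y := by
    intro y
    have hy : x⁻¹ * y = y / x := by ring
    by_cases h : y ∈ Set.Ioo 0 x
    · have h' : 1 - x⁻¹ * y ∈ Set.Ioo (0 : ℝ) 1 := by
        have := (div_lt_one hx).2 h.2
        have h3 := div_pos h.1 hx
        rw [hy]; constructor <;> linarith
      rw [Set.indicator_of_mem h, hk, Set.indicator_of_mem h']
      have e1 : x * (1 - x⁻¹ * y) = x - y := by field_simp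
      have e2 : 1 - (1 - x⁻¹ * y) ^ 2 = y / x * (2 - y / x) := by rw [hy]; ring
      simp only [e1, e2]
    · have h' : 1 - x⁻¹ * y ∉ Set.Ioo (0 : ℝ) 1 := by
        intro h'; apply h
        rw [hy] at h'
        have h3 : 0 < y / x := by linarith [h'.2]
        have h4 : y / x < 1 := by linarith [h'.1]
        exact ⟨by have := mul_pos h3 hx; rwa [div_mul_cancel₀ _ hx.ne'] at this, (div_lt_one hx).1 h4⟩
      rw [Set.indicator_of_notMem h, hk, Set.indicator_of_notMem h']
  simp_rw [e] at h1
  rw [h1, ← mul_assoc, inv_mul_cancel₀ hx.ne', one_mul]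

lemma K_asym {a : ℝ} (ha : 0 < a) :
    Tendsto (fun x : ℝ => x ^ a * Real.exp (-x) * ∫ t in Set.Ioo (0 : ℝ) 1, Real.cosh (x * t) * (1 - t ^ 2) ^ (a - 1))
      atTop (nhds (2 ^ (a - 2) * Real.Gamma a)) := by
  set C : ℝ := 1 + 2 ^ (a - 1) with hC
  set F : ℝ → ℝ → ℝ := fun x => Set.indicator (Set.Ioo 0 x)
    (fun y => (Real.exp (-y) * y ^ (a - 1)) * ((1 + Real.exp (2 * (y - x))) / 2 * (2 - y / x) ^ (a - 1))) with hF
  have key : ∀ x : ℝ, 0 < x → x ^ a * Real.exp (-x) * ∫ t in Set.Ioo (0 : ℝ) 1, Real.cosh (x * t) * (1 - t ^ 2) ^ (a - 1) = ∫ y, F x y := by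
    intro x hx
    rw [K_scale hx, ← mul_assoc, ← MeasureTheory.integral_const_mul]
    congr 1; ext y
    by_cases h : y ∈ Set.Ioo 0 x
    · simp only [hF]
      rw [Set.indicator_of_mem h, Set.indicator_of_mem h]
      have hy1 : 0 ≤ y / x := (div_pos h.1 hx).le
      have hy2 : y / x < 1 := (div_lt_one hx).2 h.2
      rw [Real.mul_rpow hy1 (by linarith), Real.div_rpow h.1.le hx.le, Real.rpow_sub_one hx.ne', Real.cosh_eq]
      have hxa := (Real.rpow_pos_of_pos hx a).ne'
      have e1 : Real.exp (x - y) = Real.exp x * Real.exp (-y) := by rw [← Real.exp_add]; ring_nf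
      have e2 : Real.exp (-(x - y)) = Real.exp x * (Real.exp (-y) * Real.exp (2 * (y - x))) := by
        rw [← Real.exp_add, ← Real.exp_add]; ring_nf
      have e3 : Real.exp (-x) = (Real.exp x)⁻¹ := Real.exp_neg x
      rw [e1, e2, e3]
      field_simp
    · simp only [hF]
      rw [Set.indicator_of_notMem h, Set.indicator_of_notMem h, mul_zero]
  have hlim : Tendsto (fun x => ∫ y, F x y) atTop
      (nhds (∫ y, Set.indicator (Set.Ioi 0) (fun y : ℝ => (Real.exp (-y) * y ^ (a - 1)) * (1 / 2 * 2 ^ (a - 1))) y)) := by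
    apply MeasureTheory.tendsto_integral_filter_of_dominated_convergence
      (Set.indicator (Set.Ioi 0) (fun y : ℝ => (Real.exp (-y) * y ^ (a - 1)) * C))
    · refine Eventually.of_forall (fun x => ?_)
      apply Measurable.aestronglyMeasurable
      apply Measurable.indicator _ measurableSet_Ioo
      fun_prop
    · filter_upwards [eventually_gt_atTop 0] with x hx
      refine Eventually.of_forall (fun y => ?_)
      by_cases h : y ∈ Set.Ioo 0 x
      · simp only [hF]
        rw [Set.indicator_of_mem h, Set.indicator_of_mem (show y ∈ Set.Ioi 0 from h.1)]
        have hy1 : 0 ≤ y / x := (div_pos h.1 hx).le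
        have hy2 : y / x < 1 := (div_lt_one hx).2 h.2
        have p1 : 0 ≤ y ^ (a - 1) := Real.rpow_nonneg h.1.le _
        have p2 : 0 ≤ (2 - y / x) ^ (a - 1) := Real.rpow_nonneg (by linarith) _
        rw [Real.norm_of_nonneg (by positivity)]
        apply mul_le_mul_of_nonneg_left _ (by positivity)
        have q1 : Real.exp (2 * (y - x)) ≤ 1 := Real.exp_le_one_iff.2 (by linarith [h.2])
        have q2 : (2 - y / x) ^ (a - 1) ≤ C := by
          rcases le_total 1 a with h1 | h1
          · have := Real.rpow_le_rpow (by linarith : 0 ≤ 2 - y / x) (by linarith : 2 - y / x ≤ 2) (by linarith : 0 ≤ a - 1)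
            rw [hC]; linarith
          · have := Real.rpow_le_one_of_one_le_of_nonpos (by linarith : 1 ≤ 2 - y / x) (by linarith : a - 1 ≤ 0)
            have h2 : (0 : ℝ) ≤ 2 ^ (a - 1) := by positivity
            rw [hC]; linarith
        nlinarith
      · simp only [hF]
        rw [Set.indicator_of_notMem h, norm_zero]
        apply Set.indicator_nonneg
        intro y hy
        have p1 : 0 ≤ y ^ (a - 1) := Real.rpow_nonneg (le_of_lt hy) _
        positivity
    · rw [MeasureTheory.integrable_indicator_iff measurableSet_Ioi]
      exact (Real.GammaIntegral_convergent ha).mul_const _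
    · refine Eventually.of_forall (fun y => ?_)
      by_cases h : 0 < y
      · rw [Set.indicator_of_mem (show y ∈ Set.Ioi 0 from h)]
        have l1 : Tendsto (fun x : ℝ => Real.exp (2 * (y - x))) atTop (nhds 0) := by
          apply Real.tendsto_exp_atBot.comp
          have : Tendsto (fun x : ℝ => y + -x) atTop atBot := tendsto_atBot_add_const_left _ _ tendsto_neg_atTop_atBot
          exact (this.const_mul_atBot two_pos).congr (fun x => by ring)
        have l2 : Tendsto (fun x : ℝ => (2 - y / x) ^ (a - 1)) atTop (nhds (2 ^ (a - 1))) := by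
          have : Tendsto (fun x : ℝ => 2 - y / x) atTop (nhds (2 - 0)) :=
            tendsto_const_nhds.sub (tendsto_const_nhds.div_atTop tendsto_id)
          rw [sub_zero] at this
          exact this.rpow_const (Or.inl two_ne_zero)
        have l3 := (((l1.const_add 1).div_const 2).mul l2).const_mul (Real.exp (-y) * y ^ (a - 1))
        rw [add_zero] at l3
        refine l3.congr' ?_
        filter_upwards [eventually_gt_atTop y] with x hx
        simp only [hF]
        rw [Set.indicator_of_mem (show y ∈ Set.Ioo 0 x from ⟨h, hx⟩)]
      · rw [Set.indicator_of_notMem (show y ∉ Set.Ioi 0 from h)]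
        refine tendsto_const_nhds.congr (fun x => ?_)
        simp only [hF]
        rw [Set.indicator_of_notMem (show y ∉ Set.Ioo 0 x from fun h' => h h'.1)]
  have e : ∫ y, Set.indicator (Set.Ioi 0) (fun y : ℝ => (Real.exp (-y) * y ^ (a - 1)) * (1 / 2 * 2 ^ (a - 1))) y = 2 ^ (a - 2) * Real.Gamma a := by
    rw [MeasureTheory.integral_indicator measurableSet_Ioi, MeasureTheory.integral_mul_const, ← Real.Gamma_eq_integral ha]
    have : (2 : ℝ) ^ (a - 1) = 2 ^ (a - 2) * 2 := by
      rw [← Real.rpow_add_one two_ne_zero]; ring_nf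
    rw [this]; ring
  rw [e] at hlim
  refine hlim.congr' ?_
  filter_upwards [eventually_gt_atTop 0] with x hx
  exact (key x hx).symm

lemma bessel_asym {s : ℝ} (hs : -1 / 2 < s) :
    Tendsto (fun x : ℝ => besselI s x * (√x * Real.exp (-x))) atTop (nhds (1 / √(2 * π))) := by
  have ha : 0 < s + 1 / 2 := by linarith
  have hG := Real.Gamma_pos_of_pos ha
  have h := (K_asym ha).const_mul (2 ^ (-s) / (√π * Real.Gamma (s + 1 / 2)) * 2)
  have hpi : √π ≠ 0 := (Real.sqrt_pos.2 Real.pi_pos).ne'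
  have e : 2 ^ (-s) / (√π * Real.Gamma (s + 1 / 2)) * 2 * (2 ^ (s + 1 / 2 - 2) * Real.Gamma (s + 1 / 2)) = 1 / √(2 * π) := by
    have e1 : (2 : ℝ) ^ (-s) * 2 * 2 ^ (s + 1 / 2 - 2) = 1 / √2 := by
      rw [Real.sqrt_eq_rpow, ← Real.rpow_add_one two_ne_zero, ← Real.rpow_add two_pos, one_div ((2 : ℝ) ^ _), ← Real.rpow_neg two_pos.le]
      congr 1; ring
    rw [Real.sqrt_mul two_pos.le, ← one_div_mul_one_div, ← e1]
    generalize Real.Gamma (s + 1 / 2) = G at hG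
    field_simp
  rw [e] at h
  refine h.congr' ?_
  filter_upwards [eventually_gt_atTop 0] with x hx
  rw [besselI, (bessel_hasSum hs hx).tsum_eq, Real.div_rpow hx.le two_pos.le, Real.rpow_add hx, Real.rpow_neg two_pos.le, ← Real.sqrt_eq_rpow]
  ring

lemma bessel_rec {s x : ℝ} (hs : -1 / 2 < s) (hs0 : s ≠ 0) (hx : 0 < x) :
    besselI (s - 1) x = besselI (s + 1) x + 2 * s / x * besselI s x := by
  have hx2 : 0 < x / 2 := by positivity
  have h1 := bessel_hasSum (s := s + 1) (by linarith) hx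
  have h0 := bessel_hasSum hs hx
  have e1 : besselI (s + 1) x = _ := h1.tsum_eq
  have e0 : besselI s x = _ := h0.tsum_eq
  rw [← e1] at h1
  rw [← e0] at h0
  set F : ℕ → ℝ := fun m => (x / 2) ^ ((2 * m : ℝ) + (s - 1)) * m / (m.factorial * Real.Gamma (m + s + 1)) with hF
  have hF1 : HasSum (fun m => F (m + 1)) (besselI (s + 1) x) := by
    refine hs_congr h1 (fun m => ?_) rfl
    simp only [hF]
    rw [Nat.factorial_succ]
    have : (2 * ((m + 1 : ℕ) : ℝ)) + (s - 1) = 2 * m + (s + 1) := by push_cast; ring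
    rw [this]
    have : ((m + 1 : ℕ) : ℝ) + s + 1 = m + (s + 1) + 1 := by push_cast; ring
    rw [this]
    push_cast
    field_simp
  have hF2 : HasSum F (besselI (s + 1) x) := by
    have := (hasSum_nat_add_iff (f := F) 1).1 hF1
    simpa [hF] using this
  have h3 := hF2.add (h0.mul_left (2 * s / x))
  rw [← h3.tsum_eq, besselI]
  congr 1; ext m
  simp only [hF]
  have hms : (m : ℝ) + s ≠ 0 := by
    rcases m with _ | k
    · simpa using hs0
    · have : (0 : ℝ) ≤ k := by positivity
      push_cast; intro h; linarith
  rw [show (m : ℝ) + (s - 1) + 1 = m + s by ring, Real.Gamma_add_one hms]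
  have hG : Real.Gamma (m + s) ≠ 0 := by
    apply Real.Gamma_ne_zero
    intro k hk
    rcases m with _ | j
    · rcases k with _ | k
      · simp at hk; exact hs0 hk
      · have : (0 : ℝ) ≤ k := by positivity
        push_cast at hk; linarith
    · have : (0 : ℝ) ≤ k := by positivity
      have : (0 : ℝ) ≤ j := by positivity
      push_cast at hk; linarith
  have hp : (x / 2) ^ ((2 * m : ℝ) + s) = (x / 2) ^ ((2 * m : ℝ) + (s - 1)) * (x / 2) := by
    rw [← Real.rpow_add_one hx2.ne']; ring_nf
  rw [hp]
  have : (m.factorial : ℝ) ≠ 0 := by positivity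
  field_simp

lemma bessel34 : Tendsto (fun x : ℝ => besselI (-3 / 4) x * (√x * Real.exp (-x))) atTop (nhds (1 / √(2 * π))) := by
  have h1 := bessel_asym (s := 5 / 4) (by norm_num)
  have h2 := bessel_asym (s := 1 / 4) (by norm_num)
  have h3 : Tendsto (fun x : ℝ => 2 * (1 / 4) / x) atTop (nhds 0) := tendsto_const_nhds.div_atTop tendsto_id
  have h := h1.add (h3.mul h2)
  rw [zero_mul, add_zero] at h
  refine h.congr' ?_
  filter_upwards [eventually_gt_atTop 0] with x hx
  have := bessel_rec (s := 1 / 4) (by norm_num) (by norm_num) hx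
  norm_num at this ⊢
  rw [this]; ring

lemma bessel54 : Tendsto (fun x : ℝ => besselI (-5 / 4) x * (√x * Real.exp (-x))) atTop (nhds (1 / √(2 * π))) := by
  have h1 := bessel_asym (s := 3 / 4) (by norm_num)
  have h2 := bessel_asym (s := -1 / 4) (by norm_num)
  have h3 : Tendsto (fun x : ℝ => 2 * (-1 / 4) / x) atTop (nhds 0) := tendsto_const_nhds.div_atTop tendsto_id
  have h := h1.add (h3.mul h2)
  rw [zero_mul, add_zero] at h
  refine h.congr' ?_
  filter_upwards [eventually_gt_atTop 0] with x hx
  have := bessel_rec (s := -1 / 4) (by norm_num) (by norm_num) hx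
  norm_num at this ⊢
  rw [this]; ring

end S18

namespace S18

lemma E_asym : Tendsto (fun t : ℝ => Real.exp ((Ev t).re + (Od t).re - π ^ 2 / 48 / t) * t ^ ((1 : ℝ) / 4))
    (nhdsWithin 0 (Set.Ioi 0))
    (nhds (Real.exp (1 / 2 * (Real.log (Real.Gamma (1 / 4)) - Real.log (Real.Gamma (3 / 4)) - Real.log 2)))) := by
  have hid : Tendsto (fun t : ℝ => t) (nhdsWithin 0 (Set.Ioi 0)) (nhds 0) := tendsto_id.mono_left nhdsWithin_le_nhds
  have h1 : Tendsto (fun t : ℝ => (Ev t).re - π ^ 2 / 48 / t + Real.log 2 / 4) (nhdsWithin 0 (Set.Ioi 0)) (nhds 0) := by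
    apply squeeze_zero_norm' (a := fun t : ℝ => 7 * t)
    · filter_upwards [self_mem_nhdsWithin, nhdsWithin_le_nhds (Iio_mem_nhds one_pos)] with t ht ht1
      exact Ev_asym ht (le_of_lt ht1)
    · have := hid.const_mul 7
      rwa [mul_zero] at this
  have h2 := Od_asym
  have h3 := ((h1.add (h2.const_mul (1 / 2))).add_const (-(Real.log 2 / 4) - 1 / 4 * Real.log 4))
  have h4 := (Real.continuous_exp.tendsto _).comp h3
  have hl4 : Real.log 4 = 2 * Real.log 2 := by
    rw [show (4 : ℝ) = 2 ^ 2 by norm_num, Real.log_pow]; norm_num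
  have e : (0 + 1 / 2 * (1 / 2 * Real.log 2 + Real.log (Real.Gamma (1 / 4)) - Real.log (Real.Gamma (3 / 4))) + (-(Real.log 2 / 4) - 1 / 4 * Real.log 4)) = 1 / 2 * (Real.log (Real.Gamma (1 / 4)) - Real.log (Real.Gamma (3 / 4)) - Real.log 2) := by
    rw [hl4]; ring
  rw [e] at h4
  refine h4.congr' ?_
  filter_upwards [self_mem_nhdsWithin] with t ht
  have ht' : 0 < t := ht
  simp only [Function.comp]
  rw [Real.rpow_def_of_pos ht', ← Real.exp_add, Real.log_mul (by norm_num) ht'.ne']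
  congr 1; ring

noncomputable def tn (n : ℕ) : ℝ := π / (4 * √(3 * n))

lemma tn_pos {n : ℕ} (hn : 0 < n) : 0 < tn n := by
  unfold tn
  have : (0 : ℝ) < n := by exact_mod_cast hn
  positivity

lemma tn_n {n : ℕ} (hn : 0 < n) : (n : ℝ) = π ^ 2 / 48 / tn n ^ 2 := by
  have h : (0 : ℝ) < n := by exact_mod_cast hn
  have := Real.pi_pos
  rw [tn, div_pow, mul_pow, Real.sq_sqrt (by positivity)]
  field_simp; norm_num

lemma tn_x {n : ℕ} (hn : 0 < n) : π / 2 * √((n : ℝ) / 3) = π ^ 2 / 24 / tn n := by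
  have h : (0 : ℝ) < n := by exact_mod_cast hn
  have := Real.pi_pos
  have e : √((n : ℝ) / 3) = √(3 * n) / 3 := by
    rw [Real.sqrt_eq_iff_mul_self_eq (by positivity) (by positivity)]
    have := Real.mul_self_sqrt (show (0 : ℝ) ≤ 3 * n by positivity)
    nlinarith
  have h2 : 0 < √(3 * (n : ℝ)) := by positivity
  rw [e, tn]
  field_simp; norm_num

lemma tn_lim : Tendsto tn atTop (nhdsWithin 0 (Set.Ioi 0)) := by
  rw [tendsto_nhdsWithin_iff]
  constructor
  · apply tendsto_const_nhds.div_atTop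
    apply Tendsto.const_mul_atTop (by norm_num)
    apply Real.tendsto_sqrt_atTop.comp
    exact tendsto_natCast_atTop_atTop.const_mul_atTop (by norm_num)
  · filter_upwards [eventually_gt_atTop 0] with n hn
    exact tn_pos hn

lemma g_asym (g : ℕ → ℝ)
    (hg : ∀ q : ℂ, ‖q‖ < 1 →
      ∑' n : ℕ, (g n : ℂ) * q ^ n =
        1 / ((∏' k : ℕ, (1 - q * (q ^ 4) ^ k)) *
              (∏' k : ℕ, (1 - (-q ^ 3) * (q ^ 4) ^ k)))) :
    Tendsto (fun n : ℕ => g n * (Real.exp (-(π ^ 2 / 24 / tn n)) / (tn n ^ ((1 : ℝ) / 4)) ^ 5)) atTop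
      (nhds (Real.exp (1 / 2 * (Real.log (Real.Gamma (1 / 4)) - Real.log (Real.Gamma (3 / 4)) - Real.log 2)) *
        √(π / (π ^ 2 / 48)) / (2 * π))) := by
  have h1 := E_asym.comp tn_lim
  have h2 : Tendsto (fun n => ((∫ u, Psi 1 (tn n) u) + (-1) ^ n * ∫ u, Psi (-1) (tn n) u)) atTop (nhds ((√(π / (π ^ 2 / 48)) : ℝ) + 0)) := by
    apply (Psi_int_pos.comp tn_lim).add
    have := (Psi_int_neg.comp tn_lim).norm
    rw [norm_zero] at this
    apply squeeze_zero_norm' _ this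
    refine Eventually.of_forall (fun n => ?_)
    simp
  rw [add_zero] at h2
  have h3 := (Complex.continuous_re.tendsto _).comp h2
  rw [Complex.ofReal_re] at h3
  refine ((h1.mul h3).div_const (2 * π)).congr' ?_
  filter_upwards [eventually_gt_atTop 0] with n hn
  have ht := tn_pos hn
  have hf := congrArg Complex.re (g_formula g hg n ht (tn_n hn))
  have hl : ((2 * π * g n : ℂ)).re = 2 * π * g n := by
    rw [show (2 * π * g n : ℂ) = ((2 * π * g n : ℝ) : ℂ) by push_cast; rfl, Complex.ofReal_re]
  rw [hl, Complex.re_ofReal_mul] at hf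
  simp only [Function.comp]
  set R := ((∫ u, Psi 1 (tn n) u) + (-1) ^ n * ∫ u, Psi (-1) (tn n) u).re with hR
  have hgn : g n = Real.exp (n * tn n + (Ev (tn n)).re + (Od (tn n)).re) * (tn n * √(tn n)) * R / (2 * π) := by
    rw [← hf]; field_simp
  rw [hgn]
  have hnt : n * tn n = π ^ 2 / 48 / tn n := by
    rw [tn_n hn]; field_simp
  rw [hnt]
  set t := tn n with htdef
  have hr : 0 < t ^ ((1 : ℝ) / 4) := Real.rpow_pos_of_pos ht _
  have hr4 : t = (t ^ ((1 : ℝ) / 4)) ^ 4 := by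
    rw [← Real.rpow_natCast, ← Real.rpow_mul ht.le]; norm_num
  have hr2 : √t = (t ^ ((1 : ℝ) / 4)) ^ 2 := by
    rw [Real.sqrt_eq_rpow, ← Real.rpow_natCast, ← Real.rpow_mul ht.le]; norm_num
  have e1 : Real.exp (π ^ 2 / 48 / t + (Ev t).re + (Od t).re) * Real.exp (-(π ^ 2 / 24 / t)) = Real.exp ((Ev t).re + (Od t).re - π ^ 2 / 48 / t) := by
    rw [← Real.exp_add]; congr 1; ring
  have e2 : t * √t / (t ^ ((1 : ℝ) / 4)) ^ 5 = t ^ ((1 : ℝ) / 4) := by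
    rw [hr2]
    nth_rewrite 1 [hr4]
    generalize t ^ ((1 : ℝ) / 4) = r at hr
    field_simp
  rw [← e1]
  calc _ = Real.exp (π ^ 2 / 48 / t + (Ev t).re + (Od t).re) * Real.exp (-(π ^ 2 / 24 / t)) *
      (t * √t / (t ^ ((1 : ℝ) / 4)) ^ 5) * R / (2 * π) := by rw [e2]
    _ = _ := by ring

lemma T_asym (a b : ℝ) (k : ℕ) {s : ℝ} (hk : 8 * b = k)
    (hB : Tendsto (fun x : ℝ => besselI s x * (√x * Real.exp (-x))) atTop (nhds (1 / √(2 * π)))) :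
    Tendsto (fun n : ℕ => a / (n : ℝ) ^ b * besselI s (π / 2 * √((n : ℝ) / 3)) *
      (Real.exp (-(π ^ 2 / 24 / tn n)) / (tn n ^ ((1 : ℝ) / 4)) ^ (k + 2))) atTop
      (nhds (a / (π ^ 2 / 48) ^ b / √(π ^ 2 / 24) * (1 / √(2 * π)))) := by
  have hp := Real.pi_pos
  have hx : Tendsto (fun n : ℕ => π ^ 2 / 24 / tn n) atTop atTop := by
    have h : Tendsto (fun n => (tn n)⁻¹) atTop atTop := tendsto_inv_nhdsGT_zero.comp tn_lim
    exact h.const_mul_atTop (by positivity)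
  have h := (hB.comp hx).const_mul (a / (π ^ 2 / 48) ^ b / √(π ^ 2 / 24))
  refine h.congr' ?_
  filter_upwards [eventually_gt_atTop 0] with n hn
  have ht := tn_pos hn
  have hnn := tn_n hn
  rw [tn_x hn]
  simp only [Function.comp]
  rw [hnn]
  set t := tn n with htdef
  have hr : 0 < t ^ ((1 : ℝ) / 4) := Real.rpow_pos_of_pos ht _
  have hr2 : √t = (t ^ ((1 : ℝ) / 4)) ^ 2 := by
    rw [Real.sqrt_eq_rpow, ← Real.rpow_natCast, ← Real.rpow_mul ht.le]; norm_num
  have hrk : (t ^ 2) ^ b = (t ^ ((1 : ℝ) / 4)) ^ k := by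
    rw [← Real.rpow_natCast (t ^ ((1 : ℝ) / 4)), ← Real.rpow_mul ht.le, ← hk, ← Real.rpow_natCast t, ← Real.rpow_mul ht.le]
    congr 1; push_cast; ring
  rw [Real.div_rpow (show (0 : ℝ) ≤ π ^ 2 / 48 by positivity) (show 0 ≤ t ^ 2 by positivity), hrk, Real.sqrt_div (show (0 : ℝ) ≤ π ^ 2 / 24 by positivity) t, hr2]
  generalize t ^ ((1 : ℝ) / 4) = r at hr
  have h1 : (π ^ 2 / 48) ^ b ≠ 0 := (Real.rpow_pos_of_pos (by positivity) _).ne'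
  have h2 : √(π ^ 2 / 24) ≠ 0 := (Real.sqrt_pos.2 (by positivity)).ne'
  generalize (π ^ 2 / 48) ^ b = y1 at h1
  generalize √(π ^ 2 / 24) = y2 at h2
  rw [pow_add]
  field_simp

lemma const_eq : Real.exp (1 / 2 * (Real.log (Real.Gamma (1 / 4)) - Real.log (Real.Gamma (3 / 4)) - Real.log 2)) *
        √(π / (π ^ 2 / 48)) / (2 * π) =
    π ^ ((1 : ℝ) / 4) * Real.Gamma (1 / 4) / (2 ^ ((9 : ℝ) / 4) * 3 ^ ((3 : ℝ) / 8)) / (π ^ 2 / 48) ^ ((3 : ℝ) / 8) / √(π ^ 2 / 24) * (1 / √(2 * π)) := by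
  have hp := Real.pi_pos
  have g1 := Real.Gamma_pos_of_pos (show (0 : ℝ) < 1 / 4 by norm_num)
  have g3 := Real.Gamma_pos_of_pos (show (0 : ℝ) < 3 / 4 by norm_num)
  have hrefl := Real.Gamma_mul_Gamma_one_sub (1 / 4)
  rw [show (1 : ℝ) - 1 / 4 = 3 / 4 by norm_num, show π * (1 / 4) = π / 4 by ring, Real.sin_pi_div_four] at hrefl
  have hl := congrArg Real.log hrefl
  rw [Real.log_mul g1.ne' g3.ne', Real.log_div hp.ne' (by positivity), Real.log_div (by positivity) two_ne_zero, Real.log_sqrt two_pos.le] at hl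
  apply Real.log_injOn_pos (Set.mem_Ioi.2 (by positivity)) (Set.mem_Ioi.2 (by positivity))
  have l48 : Real.log 48 = 4 * Real.log 2 + Real.log 3 := by
    rw [show (48 : ℝ) = 2 ^ 4 * 3 by norm_num, Real.log_mul (by norm_num) (by norm_num), Real.log_pow]; norm_num
  have l24 : Real.log 24 = 3 * Real.log 2 + Real.log 3 := by
    rw [show (24 : ℝ) = 2 ^ 3 * 3 by norm_num, Real.log_mul (by norm_num) (by norm_num), Real.log_pow]; norm_num
  have lpi : Real.log (π ^ 2) = 2 * Real.log π := by rw [Real.log_pow]; norm_num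
  rw [Real.log_div (by positivity) (by positivity), Real.log_mul (by positivity) (by positivity), Real.log_exp,
    Real.log_sqrt (by positivity), Real.log_div hp.ne' (by positivity), Real.log_div (by positivity) (by positivity),
    Real.log_mul two_ne_zero hp.ne']
  rw [Real.log_mul (by positivity) (by positivity), Real.log_div (by positivity) (by positivity), Real.log_div (by positivity) (by positivity),
    Real.log_div (by positivity) (by positivity), Real.log_mul (by positivity) (by positivity), Real.log_mul (by positivity) (by positivity),
    Real.log_rpow hp, Real.log_rpow two_pos, Real.log_rpow (by norm_num), Real.log_rpow (by positivity),
    Real.log_sqrt (by positivity), one_div (√(2 * π)), Real.log_inv, Real.log_sqrt (by positivity), Real.log_mul two_ne_zero hp.ne',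
    Real.log_div (by positivity) (by positivity), Real.log_div (by positivity) (by positivity), lpi, l48, l24]
  linarith

end S18

theorem stmt_18 (g : ℕ → ℝ)
    (hg : ∀ q : ℂ, ‖q‖ < 1 →
      ∑' n : ℕ, (g n : ℂ) * q ^ n =
        1 / ((∏' k : ℕ, (1 - q * (q ^ 4) ^ k)) *
              (∏' k : ℕ, (1 - (-q ^ 3) * (q ^ 4) ^ k)))) :
    Tendsto (fun n : ℕ =>
      g n /
        (π ^ ((1 : ℝ) / 4) * Real.Gamma (1 / 4) /
            (2 ^ ((9 : ℝ) / 4) * 3 ^ ((3 : ℝ) / 8) * (n : ℝ) ^ ((3 : ℝ) / 8)) *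
            besselI (-3 / 4) (π / 2 * Real.sqrt (n / 3)) +
          (-1 : ℝ) ^ n * (π ^ ((3 : ℝ) / 4) * Real.Gamma (3 / 4) /
            (2 ^ ((11 : ℝ) / 4) * 3 ^ ((5 : ℝ) / 8) * (n : ℝ) ^ ((5 : ℝ) / 8))) *
            besselI (-5 / 4) (π / 2 * Real.sqrt (n / 3))))
      atTop (nhds 1) := by
  have hG := S18.g_asym g hg
  have hp := Real.pi_pos
  have g1 := Real.Gamma_pos_of_pos (show (0 : ℝ) < 1 / 4 by norm_num)
  rw [S18.const_eq] at hG
  have hT1 := S18.T_asym (π ^ ((1 : ℝ) / 4) * Real.Gamma (1 / 4) / (2 ^ ((9 : ℝ) / 4) * 3 ^ ((3 : ℝ) / 8))) (3 / 8) 3 (by norm_num) S18.bessel34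
  have hT2 := S18.T_asym (π ^ ((3 : ℝ) / 4) * Real.Gamma (3 / 4) / (2 ^ ((11 : ℝ) / 4) * 3 ^ ((5 : ℝ) / 8))) (5 / 8) 5 (by norm_num) S18.bessel54
  set M := π ^ ((1 : ℝ) / 4) * Real.Gamma (1 / 4) / (2 ^ ((9 : ℝ) / 4) * 3 ^ ((3 : ℝ) / 8)) / (π ^ 2 / 48) ^ ((3 : ℝ) / 8) / √(π ^ 2 / 24) * (1 / √(2 * π)) with hM
  have hMpos : 0 < M := by positivity
  have hr : Tendsto (fun n => (S18.tn n ^ ((1 : ℝ) / 4)) ^ 2) atTop (nhds 0) := by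
    have h0 : Tendsto S18.tn atTop (nhds 0) := S18.tn_lim.mono_right nhdsWithin_le_nhds
    have := (h0.rpow_const (p := (1 : ℝ) / 4) (Or.inr (by norm_num))).pow 2
    rw [Real.zero_rpow (by norm_num)] at this
    simpa using this
  have hT3 := hT2.mul hr
  rw [mul_zero] at hT3
  have hT4 : Tendsto (fun n : ℕ => (-1 : ℝ) ^ n * (π ^ ((3 : ℝ) / 4) * Real.Gamma (3 / 4) / (2 ^ ((11 : ℝ) / 4) * 3 ^ ((5 : ℝ) / 8)) / (n : ℝ) ^ ((5 : ℝ) / 8) *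
      besselI (-5 / 4) (π / 2 * √((n : ℝ) / 3)) *
      (Real.exp (-(π ^ 2 / 24 / S18.tn n)) / (S18.tn n ^ ((1 : ℝ) / 4)) ^ (5 + 2)) * (S18.tn n ^ ((1 : ℝ) / 4)) ^ 2)) atTop (nhds 0) := by
    have := hT3.norm
    rw [norm_zero] at this
    apply squeeze_zero_norm' _ this
    refine Eventually.of_forall (fun n => ?_)
    rw [norm_mul, norm_pow, norm_neg, norm_one, one_pow, one_mul]
  have hfin := hG.div (hT1.add hT4) (by rw [add_zero]; exact hMpos.ne')
  rw [add_zero, div_self hMpos.ne'] at hfin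
  refine hfin.congr' ?_
  filter_upwards [eventually_gt_atTop 0] with n hn
  have ht := S18.tn_pos hn
  have hrp : 0 < S18.tn n ^ ((1 : ℝ) / 4) := Real.rpow_pos_of_pos ht _
  have hw : Real.exp (-(π ^ 2 / 24 / S18.tn n)) / (S18.tn n ^ ((1 : ℝ) / 4)) ^ 5 ≠ 0 := by positivity
  simp only [Pi.div_apply]
  rw [← mul_div_mul_right (g n) _ hw]
  congr 1
  rw [add_mul]
  congr 1
  · rw [div_div]
  · rw [div_div]
    generalize S18.tn n ^ ((1 : ℝ) / 4) = r at hrp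
    rw [show r ^ (5 + 2) = r ^ 5 * r ^ 2 by rw [pow_add]]
    field_simp
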